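/- arXiv:math/0601397 — 4 statements merged into one kernel-verified Lean document; each statement's English description precedes it below -/
import Mathlib

section
/- (Jordan, 1871) Let p be a prime number and let G be a primitive subgroup of the symmetric group S_p on p points. Suppose G contains a non-identity permutation that moves exactly m points, where m satisfies (m²/4)·log(m/2) + m·(log(m/2) + 3/2) ≤ p, with log the natural logarithm. Then G contains the alternating group A_p; that is, G = A_p or G = S_p. -/
open Finset in
/-- A nonzero function on a finite subset `S` of a field has a nonzero moment of order less than
`#S`. -/
theorem exists_sum_mul_pow_ne_zero {K : Type*} [Field K] (S : Finset K) (v : K → K)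
    (h : ∃ x ∈ S, v x ≠ 0) : ∃ k < #S, ∑ x ∈ S, v x * x ^ k ≠ 0 := by
  by_contra! hk
  obtain ⟨x, hx, hvx⟩ := h
  have key := Matrix.eq_zero_of_forall_pow_sum_mul_pow_eq_zero
    (f := fun i : Fin #S => (S.equivFin.symm i : K)) (v := fun i => v (S.equivFin.symm i))
    (Subtype.val_injective.comp S.equivFin.symm.injective) (fun k => by
      rw [← hk k k.2, ← Finset.sum_coe_sort S]
      exact Equiv.sum_comp S.equivFin.symm (fun x : S => v x * (x : K) ^ (k : ℕ)))
  have := congrFun key (S.equivFin ⟨x, hx⟩)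
  simp [hvx] at this

open Finset in
/-- An uncertainty principle in characteristic `p`: a nonzero function `f` on `ZMod p` annihilated
by the difference operator attached to `U` has large support. -/
theorem ZMod.lt_card_support_add_card {p : ℕ} [Fact p.Prime] (f : ZMod p → ZMod p) (hf : f ≠ 0)
    (U : Finset (ZMod p)) (hU : U.Nonempty) (hU0 : 0 ∉ U)
    (h : ∀ i, ∑ u ∈ U, (f (i + u) - f i) = 0) :
    p < #{i | f i ≠ 0} + #U := by
  classical
  by_contra! hlt
  have hf' : ∃ k < #{i | f i ≠ 0}, ∑ x, f x * x ^ k ≠ 0 := by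
    obtain ⟨x, hx⟩ := Function.ne_iff.mp hf
    obtain ⟨k, hk, hs⟩ := exists_sum_mul_pow_ne_zero ({i | f i ≠ 0} : Finset (ZMod p)) f
      ⟨x, by simpa using hx, hx⟩
    refine ⟨k, hk, fun h0 => hs ?_⟩
    refine (Finset.sum_subset (Finset.subset_univ _) fun x _ hx => ?_).trans h0
    simp only [mem_filter, mem_univ, true_and, not_not] at hx
    simp [hx]
  have hU' : ∃ k < #U, ∑ u ∈ U, (-u) ^ (k + 1) ≠ 0 := by
    obtain ⟨u, hu⟩ := hU
    obtain ⟨k, hk, hs⟩ := exists_sum_mul_pow_ne_zero U id ⟨u, hu, fun h => hU0 (h ▸ hu)⟩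
    refine ⟨k, hk, fun h0 => hs ?_⟩
    rw [Finset.sum_congr rfl fun u _ => neg_pow u (k + 1), ← Finset.mul_sum] at h0
    rcases mul_eq_zero.mp h0 with h0 | h0
    · simp at h0
    · simpa [pow_succ'] using h0
  let a := Nat.find hf'
  let b := Nat.find hU'
  have ha : a < #{i | f i ≠ 0} ∧ ∑ x, f x * x ^ a ≠ 0 := Nat.find_spec hf'
  have hb : b < #U ∧ ∑ u ∈ U, (-u) ^ (b + 1) ≠ 0 := Nat.find_spec hU'
  have ha0 : ∀ l < a, ∑ x, f x * x ^ l = 0 := fun l hl => by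
    have := Nat.find_min hf' hl
    by_contra hne
    exact this ⟨by omega, hne⟩
  have hb0 : ∀ l < b, ∑ u ∈ U, (-u) ^ (l + 1) = 0 := fun l hl => by
    have := Nat.find_min hU' hl
    by_contra hne
    exact this ⟨by omega, hne⟩
  have hshift : ∀ u k, ∑ i, f (i + u) * i ^ k = ∑ i, f i * (i + -u) ^ k := fun u k => by
    rw [← Equiv.sum_comp (Equiv.addRight u) (fun i => f i * (i + -u) ^ k)]
    simp
  have hexp : ∀ k : ℕ, ∑ l ∈ range k,
      (∑ x, f x * x ^ l) * (∑ u ∈ U, (-u) ^ (k - l)) * (k.choose l : ZMod p) = 0 := by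
    intro k
    have h1 : ∑ i, (∑ u ∈ U, (f (i + u) - f i)) * i ^ k = 0 := by simp [h]
    simp_rw [Finset.sum_mul, sub_mul] at h1
    rw [Finset.sum_comm] at h1
    simp_rw [Finset.sum_sub_distrib, hshift, add_pow, Finset.sum_range_succ] at h1
    simp only [Nat.sub_self, pow_zero, mul_one, Nat.choose_self, Nat.cast_one, mul_add,
      Finset.sum_add_distrib, add_sub_cancel_right] at h1
    rw [← h1]
    simp_rw [Finset.sum_mul_sum, Finset.sum_mul, Finset.mul_sum]
    rw [Finset.sum_comm]
    conv_rhs => rw [Finset.sum_comm]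
    refine Finset.sum_congr rfl fun x _ => ?_
    rw [Finset.sum_comm]
    refine Finset.sum_congr rfl fun u _ => Finset.sum_congr rfl fun l _ => ?_
    ring
  have hk := hexp (a + (b + 1))
  rw [Finset.sum_eq_single a] at hk
  · rw [Nat.add_sub_cancel_left] at hk
    have hc : (((a + (b + 1)).choose a : ℕ) : ZMod p) ≠ 0 := by
      rw [Ne, ZMod.natCast_eq_zero_iff]
      intro hd
      have h2 : p ∣ (a + (b + 1)).factorial :=
        Nat.choose_mul_factorial_mul_factorial (Nat.le_add_right a (b + 1)) ▸
          (hd.mul_right _).mul_right _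
      exact absurd ((Fact.out : p.Prime).dvd_factorial.mp h2) (by omega)
    exact mul_ne_zero (mul_ne_zero ha.2 hb.2) hc hk
  · intro l hl hne
    rcases lt_or_gt_of_ne hne with hla | hla
    · simp [ha0 l hla]
    · have hl' := Finset.mem_range.mp hl
      have := hb0 (a + (b + 1) - l - 1) (by omega)
      rw [Nat.sub_add_cancel (by omega)] at this
      simp [this]
  · intro hn
    simp at hn

open Finset in
/-- A special case of Burnside's theorem on permutation groups of prime degree, for groups
containing the translations of `ZMod p`. -/
theorem ZMod.exists_mem_apply_eq_of_two_mul_card_support_le {p : ℕ} [Fact p.Prime]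
    (H : Subgroup (Equiv.Perm (ZMod p))) (hH : Equiv.addRight (1 : ZMod p) ∈ H)
    (σ : Equiv.Perm (ZMod p)) (hσ : σ ∈ H) (hσ1 : σ ≠ 1) (hcard : 2 * #σ.support ≤ p + 2)
    {a b a' b' : ZMod p} (hab : a ≠ b) (hab' : a' ≠ b') :
    ∃ h ∈ H, h a = a' ∧ h b = b' := by
  classical
  by_contra! hno
  have htr : ∀ t : ZMod p, Equiv.addRight t ∈ H := fun t => by
    have h1 : Equiv.addRight t = Equiv.addRight (1 : ZMod p) ^ t.val := by
      ext i
      simp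
    rw [h1]
    exact H.pow_mem hH _
  let U : ZMod p → ZMod p → Finset (ZMod p) := fun x y => {u | ∃ k ∈ H, k y - k x = u}
  have hU : ∀ x y u, u ∈ U x y ↔ ∃ k ∈ H, k y - k x = u := fun x y u => by simp [U]
  have hU0 : ∀ x y, x ≠ y → 0 ∉ U x y := fun x y hxy h0 => by
    obtain ⟨k, -, hk⟩ := (hU _ _ _).mp h0
    exact hxy (k.injective (sub_eq_zero.mp hk).symm)
  have hbound : ∀ x y, x ≠ y → p < #σ.support + #(U x y) := fun x y hxy => by
    have hmaps : ∀ i, ∀ u ∈ U x y, σ (i + u) - σ i ∈ U x y := fun i u hu => by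
      obtain ⟨k, hk, rfl⟩ := (hU _ _ _).mp hu
      refine (hU _ _ _).mpr ⟨_, H.mul_mem hσ (H.mul_mem (htr (i - k x)) hk), ?_⟩
      simp only [Equiv.Perm.mul_apply, Equiv.coe_addRight]
      congr 2 <;> ring
    have hinj : ∀ i, Set.InjOn (fun u => σ (i + u) - σ i) (U x y) := fun i u _ v _ huv => by
      simpa using huv
    have hsum : ∀ i, ∑ u ∈ U x y, (σ (i + u) - σ i) = ∑ u ∈ U x y, u := fun i => by
      have himg : (U x y).image (fun u => σ (i + u) - σ i) = U x y :=
        Finset.eq_of_subset_of_card_le (Finset.image_subset_iff.mpr (hmaps i))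
          (Finset.card_image_of_injOn (hinj i)).ge
      conv_rhs => rw [← himg]
      rw [Finset.sum_image (hinj i)]
    have := ZMod.lt_card_support_add_card (fun i => σ i - i)
      (fun h0 => hσ1 (Equiv.ext fun i => sub_eq_zero.mp (congrFun h0 i)))
      (U x y) ⟨y - x, (hU _ _ _).mpr ⟨1, H.one_mem, rfl⟩⟩ (hU0 x y hxy) (fun i => by
        have h2 := hsum i
        rw [← sub_eq_zero, ← Finset.sum_sub_distrib] at h2
        rw [← h2]
        exact Finset.sum_congr rfl fun u _ => by ring)
    convert this using 3
    ext i
    simp [sub_eq_zero]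
  have hdisj : Disjoint (U a b) (U a' b') := by
    rw [Finset.disjoint_left]
    intro u hu hu'
    obtain ⟨k, hk, h1⟩ := (hU _ _ _).mp hu
    obtain ⟨k', hk', h2⟩ := (hU _ _ _).mp hu'
    refine hno _ (H.mul_mem (H.inv_mem hk') (H.mul_mem (htr (k' a' - k a)) hk)) ?_ ?_
    · simp [Equiv.Perm.mul_apply]
    · rw [Equiv.Perm.mul_apply, Equiv.Perm.inv_eq_iff_eq]
      simp only [Equiv.Perm.mul_apply, Equiv.coe_addRight]
      linear_combination h1 - h2
  have hle : #(U a b) + #(U a' b') + 1 ≤ p := by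
    rw [← Finset.card_union_of_disjoint hdisj,
      ← Finset.card_insert_of_notMem (a := 0) (by simp [hU0 _ _ hab, hU0 _ _ hab'])]
    simpa [ZMod.card] using Finset.card_le_univ (insert 0 (U a b ∪ U a' b'))
  have := hbound a b hab
  have := hbound a' b' hab'
  omega

open Finset in
/-- A transitive group of prime degree containing a non-identity permutation `σ` with
`2 * #σ.support ≤ p + 2` is doubly transitive. -/
theorem Equiv.Perm.exists_mem_apply_eq_of_two_mul_card_support_le {α : Type*} [Fintype α]
    [DecidableEq α] {p : ℕ} (hp : p.Prime) (hα : Fintype.card α = p)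
    (G : Subgroup (Equiv.Perm α)) (htrans : ∀ a b : α, ∃ g ∈ G, g a = b)
    (σ : Equiv.Perm α) (hσ : σ ∈ G) (hσ1 : σ ≠ 1) (hcard : 2 * #σ.support ≤ p + 2)
    {a b a' b' : α} (hab : a ≠ b) (hab' : a' ≠ b') :
    ∃ g ∈ G, g a = a' ∧ g b = b' := by
  classical
  have : Fact p.Prime := ⟨hp⟩
  have hpre : MulAction.IsPretransitive G α :=
    ⟨fun x y => (htrans x y).elim fun g hg => ⟨⟨g, hg.1⟩, hg.2⟩⟩
  have hdvd : p ∣ Nat.card G := by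
    rw [← hα, ← Nat.card_eq_fintype_card, ← MulAction.index_stabilizer_of_transitive G a]
    exact Subgroup.index_dvd_card _
  obtain ⟨⟨c, hcG⟩, hc⟩ := exists_prime_orderOf_dvd_card' p hdvd
  rw [Subgroup.orderOf_mk] at hc
  obtain ⟨x, hx⟩ : ∃ x, c x ≠ x := by
    by_contra! hfix
    have : c = 1 := Equiv.ext hfix
    rw [this, orderOf_one] at hc
    exact hp.one_lt.ne hc
  have hper : Function.IsPeriodicPt c p x := by
    rw [Function.IsPeriodicPt, Function.IsFixedPt, Equiv.Perm.iterate_eq_pow, ← hc,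
      pow_orderOf_eq_one, Equiv.Perm.one_apply]
  have hmin : Function.minimalPeriod c x = p :=
    ((Nat.dvd_prime hp).mp hper.minimalPeriod_dvd).resolve_left fun h1 =>
      hx (Function.minimalPeriod_eq_one_iff_isFixedPt.mp h1)
  have hbij : Function.Bijective fun i : ZMod p => (c ^ i.val) x := by
    rw [Fintype.bijective_iff_injective_and_card, ZMod.card, hα]
    refine ⟨fun i j hij => ZMod.val_injective p ?_, rfl⟩
    refine Function.iterate_injOn_Iio_minimalPeriod (f := c) (x := x) ?_ ?_ ?_
    · rw [hmin]; exact ZMod.val_lt i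
    · rw [hmin]; exact ZMod.val_lt j
    · simpa [Equiv.Perm.iterate_eq_pow] using hij
  let e : ZMod p ≃ α := Equiv.ofBijective _ hbij
  have he : ∀ i, e (i + 1) = c (e i) := fun i => by
    change (c ^ (i + 1).val) x = c ((c ^ i.val) x)
    rw [← Equiv.Perm.mul_apply, ← pow_succ', ZMod.val_add, ZMod.val_one]
    have hmod := pow_mod_orderOf c (i.val + 1)
    rw [hc] at hmod
    rw [hmod]
  let H : Subgroup (Equiv.Perm (ZMod p)) := G.comap e.permCongrHom.toMonoidHom
  have hH : ∀ h, h ∈ H ↔ e.permCongr h ∈ G := fun h => Iff.rfl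
  obtain ⟨h, hh, h1, h2⟩ := ZMod.exists_mem_apply_eq_of_two_mul_card_support_le H
    (by
      rw [hH]
      convert hcG
      ext y
      simp [Equiv.permCongr_apply, he])
    (e.symm.permCongr σ)
    (by
      rw [hH]
      convert hσ
      ext y
      simp [Equiv.permCongr_apply])
    (fun h1 => hσ1 (by
      ext y
      simpa [Equiv.permCongr_apply, Equiv.symm_apply_eq] using
        congrArg e (Equiv.congr_fun h1 (e.symm y))))
    (by
      refine le_trans (Nat.mul_le_mul_left 2 ?_) hcard
      refine Finset.card_le_card_of_injOn e (fun i hi => ?_) e.injective.injOn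
      simpa [Equiv.permCongr_apply, Equiv.symm_apply_eq] using hi)
    (a := e.symm a) (b := e.symm b) (a' := e.symm a') (b' := e.symm b')
    (e.symm.injective.ne hab) (e.symm.injective.ne hab')
  refine ⟨_, (hH h).mp hh, ?_, ?_⟩
  · simp [Equiv.permCongr_apply, h1]
  · simp [Equiv.permCongr_apply, h2]


open Finset in
/-- Averaging over a finite group acting transitively on `Ω`. -/
theorem MulAction.card_mul_sum_card_filter_smul_mem {G β : Type*} [Group G] [Fintype G]
    [MulAction G β] [DecidableEq β] {Ω A B : Finset β} (hA : A ⊆ Ω) (hB : B ⊆ Ω)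
    (hinv : ∀ g : G, ∀ x ∈ Ω, g • x ∈ Ω) (htr : ∀ x ∈ Ω, ∀ y ∈ Ω, ∃ g : G, g • x = y) :
    #Ω * ∑ g : G, #{x ∈ A | g • x ∈ B} = Fintype.card G * (#A * #B) := by
  have key : ∀ x ∈ Ω, ∀ y ∈ Ω, #Ω * #{g : G | g • x = y} = Fintype.card G := by
    intro x hx y hy
    have hfib := Finset.card_eq_sum_card_fiberwise (f := fun g : G => g • x) (s := univ) (t := Ω)
      (fun g _ => hinv g x hx)
    rw [← Finset.card_univ (α := G), hfib, Finset.sum_const_nat (m := #{g : G | g • x = y})]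
    intro z hz
    obtain ⟨k, hk⟩ := htr z hz y hy
    refine Finset.card_equiv (Equiv.mulLeft k) fun g => ?_
    simp [mul_smul, ← hk]
  have hcount : ∀ g : G, #{x ∈ A | g • x ∈ B} = ∑ x ∈ A, ∑ y ∈ B, if g • x = y then 1 else 0 := by
    intro g
    rw [Finset.card_filter]
    refine Finset.sum_congr rfl fun x _ => ?_
    rw [Finset.sum_ite_eq]
  simp_rw [hcount]
  rw [Finset.sum_comm, Finset.mul_sum, Finset.sum_congr rfl (g := fun _ => #B * Fintype.card G)]
  · rw [Finset.sum_const, smul_eq_mul]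
    ring
  · intro x hx
    rw [Finset.sum_comm, Finset.mul_sum, Finset.sum_congr rfl (g := fun _ => Fintype.card G)]
    · simp
    · intro y hy
      rw [← Finset.card_filter]
      exact key x (hA hx) y (hB hy)

section

open Finset MulAction
open scoped commutatorElement

namespace Equiv.Perm

variable {α : Type*} [Fintype α] [DecidableEq α]

theorem card_support_commutator_le (σ τ : Perm α) :
    #(⁅σ, τ⁆).support ≤ 3 * #(σ.support ∩ τ.support) := by
  set I := σ.support ∩ τ.support with hI
  have hsub : (⁅σ, τ⁆).support ⊆ I ∪ (I.image σ ∪ I.image τ) := by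
    intro z hz
    by_contra hn
    simp only [mem_union, mem_image, not_or, not_exists, not_and] at hn
    obtain ⟨h0, h1, h2⟩ := hn
    have hIm : ∀ w, w ∈ I ↔ σ w ≠ w ∧ τ w ≠ w := fun w => by simp [hI]
    rw [mem_support, commutatorElement_def] at hz
    apply hz
    simp only [mul_apply]
    by_cases hτ : τ z = z
    · have hτ' : τ⁻¹ z = z := by rw [inv_eq_iff_eq, hτ]
      rw [hτ']
      by_cases hσ : σ z = z
      · have hσ' : σ⁻¹ z = z := by rw [inv_eq_iff_eq, hσ]
        rw [hσ', hτ, hσ]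
      · have hw : τ (σ⁻¹ z) = σ⁻¹ z := by
          by_contra hne
          refine h1 (σ⁻¹ z) ((hIm _).mpr ⟨fun h => hσ ?_, hne⟩) (by simp)
          rw [eq_inv_iff_eq] at h
          simpa using h
        rw [hw]
        exact σ.apply_symm_apply z
    · have hσ : σ z = z := by
        by_contra hne
        exact h0 ((hIm z).mpr ⟨hne, hτ⟩)
      have hw : σ (τ⁻¹ z) = τ⁻¹ z := by
        by_contra hne
        refine h2 (τ⁻¹ z) ((hIm _).mpr ⟨hne, fun h => hτ ?_⟩) (by simp)
        rw [eq_inv_iff_eq] at h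
        simpa using h
      have hw' : σ⁻¹ (τ⁻¹ z) = τ⁻¹ z := by rw [inv_eq_iff_eq, hw]
      have hz' : τ (τ⁻¹ z) = z := τ.apply_symm_apply z
      rw [hw', hz', hσ]
  calc #(⁅σ, τ⁆).support ≤ #(I ∪ (I.image σ ∪ I.image τ)) := card_le_card hsub
    _ ≤ #I + (#(I.image σ) + #(I.image τ)) :=
      (card_union_le _ _).trans (Nat.add_le_add_left (card_union_le _ _) _)
    _ ≤ 3 * #I := by
      have := card_image_le (s := I) (f := σ)
      have := card_image_le (s := I) (f := τ)
      omega

theorem card_support_commutator_conj_le (σ g : Perm α) :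
    #(⁅σ, g * σ * g⁻¹⁆).support ≤ 3 * #{a ∈ σ.support | g a ∈ σ.support} := by
  refine (card_support_commutator_le _ _).trans (Nat.mul_le_mul_left 3 ?_)
  refine card_le_card_of_injOn (g⁻¹ : Perm α) (fun a ha => ?_) (g⁻¹ : Perm α).injective.injOn
  rw [support_conj] at ha
  simp only [coe_inter, Set.mem_inter_iff, mem_coe, Finset.mem_map] at ha
  obtain ⟨ha, b, hb, rfl⟩ := ha
  exact mem_coe.mpr (by simpa using ⟨mem_support.mp hb, mem_support.mp ha⟩)

theorem commutator_conj_ne_one {β : Type*} {σ g : Perm β} {a : β} (ha : σ a ≠ a)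
    (hga : σ (g⁻¹ (σ (g a))) = g⁻¹ (σ (g a))) : ⁅σ, g * σ * g⁻¹⁆ ≠ 1 := by
  intro h
  rw [commutatorElement_eq_one_iff_mul_comm] at h
  have h1 := Equiv.congr_fun h (g a)
  have h3 : g⁻¹ (g a) = a := inv_eq_iff_eq.mpr rfl
  have h4 : ∀ x, g (g⁻¹ x) = x := g.apply_symm_apply
  simp only [mul_apply, h3, hga, h4] at h1
  exact ha (g.injective (σ.injective h1))

theorem alternatingGroup_le_of_card_support_le_three {G : Subgroup (Perm α)}
    (hG : IsPreprimitive G α) {τ : Perm α} (hτ : τ ∈ G) (hτ1 : τ ≠ 1) (hcard : #τ.support ≤ 3) :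
    alternatingGroup α ≤ G := by
  have h2 := two_le_card_support_of_ne_one hτ1
  rcases (show #τ.support = 2 ∨ #τ.support = 3 by omega) with h | h
  · rw [subgroup_eq_top_of_isPreprimitive_of_isSwap_mem hG τ (card_support_eq_two.mp h) hτ]
    exact le_top
  · exact alternatingGroup_le_of_isPreprimitive_of_isThreeCycle_mem hG
      (card_support_eq_three_iff.mp h) hτ

section DoublyTransitive

variable {G : Subgroup (Perm α)}

theorem card_mul_sum_card_filter_mem [Fintype G] [IsPretransitive G α] (S : Finset α) :
    Fintype.card α * ∑ g : G, #{a ∈ S | g • a ∈ S} = Fintype.card G * (#S * #S) := by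
  rw [← card_mul_sum_card_filter_smul_mem (G := G) (subset_univ S) (subset_univ S), card_univ]
  · simp
  · exact fun x _ y _ => exists_smul_eq G x y

theorem card_mul_sum_card_filter_mem_of_subset_offDiag [Fintype G]
    (h2 : ∀ a b a' b' : α, a ≠ b → a' ≠ b' → ∃ g ∈ G, g a = a' ∧ g b = b')
    {A B : Finset (α × α)}
    (hA : A ⊆ (univ : Finset α).offDiag) (hB : B ⊆ (univ : Finset α).offDiag) :
    Fintype.card α * (Fintype.card α - 1) * ∑ g : G, #{x ∈ A | g • x ∈ B} =
      Fintype.card G * (#A * #B) := by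
  rw [← card_mul_sum_card_filter_smul_mem (G := G) hA hB, offDiag_card, card_univ, Nat.mul_sub_one]
  · rintro g ⟨x, y⟩ hxy
    simpa [mem_offDiag] using hxy
  · rintro ⟨x, y⟩ hxy ⟨x', y'⟩ hxy'
    obtain ⟨g, hg, rfl, rfl⟩ := h2 x y x' y' (by simpa using hxy) (by simpa using hxy')
    exact ⟨⟨g, hg⟩, rfl⟩

theorem card_mul_sum_card_filter_mem_mul_self_sub [Fintype G]
    (h2 : ∀ a b a' b' : α, a ≠ b → a' ≠ b' → ∃ g ∈ G, g a = a' ∧ g b = b')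
    (S : Finset α) :
    Fintype.card α * (Fintype.card α - 1) *
      ∑ g : G, (#{a ∈ S | g • a ∈ S} * #{a ∈ S | g • a ∈ S} - #{a ∈ S | g • a ∈ S}) =
      Fintype.card G * ((#S * #S - #S) * (#S * #S - #S)) := by
  have hS : S.offDiag ⊆ (univ : Finset α).offDiag := fun q hq => by
    simpa using (mem_offDiag.mp hq).2.2
  have h := card_mul_sum_card_filter_mem_of_subset_offDiag h2 hS hS
  rw [offDiag_card] at h
  rw [← h]
  congr 1
  refine sum_congr rfl fun g _ => ?_
  rw [← offDiag_card]
  congr 1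
  ext ⟨x, y⟩
  simp only [mem_offDiag, mem_filter, Prod.smul_mk, smul_left_cancel_iff, ne_eq]
  tauto

theorem exists_card_filter_mem_eq_one [IsPretransitive G α]
    (h2 : ∀ a b a' b' : α, a ≠ b → a' ≠ b' → ∃ g ∈ G, g a = a' ∧ g b = b')
    {S : Finset α} (hS : S.Nonempty)
    (hlt : (#S - 1) ^ 2 + 1 < Fintype.card α) :
    ∃ g ∈ G, #{a ∈ S | g a ∈ S} = 1 := by
  classical
  by_contra! hne
  have hG := Fintype.ofFinite G
  have h1 := card_mul_sum_card_filter_mem (G := G) S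
  have h3 := card_mul_sum_card_filter_mem_mul_self_sub h2 S
  have hle : ∑ g : G, #{a ∈ S | g • a ∈ S} ≤
      ∑ g : G, (#{a ∈ S | g • a ∈ S} * #{a ∈ S | g • a ∈ S} - #{a ∈ S | g • a ∈ S}) := by
    refine sum_le_sum fun g _ => ?_
    have hX : #{a ∈ S | g • a ∈ S} ≠ 1 := hne g g.2
    generalize #{a ∈ S | g • a ∈ S} = X at hX ⊢
    rcases Nat.lt_or_ge X 2 with h | h
    · interval_cases X <;> simp_all
    · exact Nat.le_sub_of_add_le (by nlinarith)
  have hN : 0 < Fintype.card G := Fintype.card_pos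
  have hm : 1 ≤ #S := hS.card_pos
  have hn : 1 ≤ Fintype.card α := by omega
  generalize #S = m at *
  generalize Fintype.card α = n at *
  obtain ⟨m, rfl⟩ := Nat.exists_eq_add_of_le' hm
  obtain ⟨n, rfl⟩ := Nat.exists_eq_add_of_le' hn
  rw [Nat.add_sub_cancel] at hlt h3
  rw [show (m + 1) * (m + 1) - (m + 1) = (m + 1) * m by
    rw [← Nat.mul_sub_one, Nat.add_sub_cancel]] at h3
  have h4 := Nat.mul_le_mul_left ((n + 1) * n) hle
  rw [h3, mul_right_comm, h1] at h4
  have h5 : (Fintype.card G * ((m + 1) * (m + 1))) * n ≤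
      (Fintype.card G * ((m + 1) * (m + 1))) * m ^ 2 := by linarith
  have := Nat.le_of_mul_le_mul_left h5 (by positivity)
  omega

theorem exists_card_filter_mem_le_two [IsPretransitive G α]
    (h2 : ∀ a b a' b' : α, a ≠ b → a' ≠ b' → ∃ g ∈ G, g a = a' ∧ g b = b')
    {σ : Perm α} (hσ : σ ≠ 1)
    (hlt : #σ.support ^ 2 + #σ.support < 2 * Fintype.card α) :
    ∃ g ∈ G, #{a ∈ σ.support | g a ∈ σ.support} ≤ 2 ∧ ⁅σ, g * σ * g⁻¹⁆ ≠ 1 := by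
  classical
  by_contra! hne
  have hG := Fintype.ofFinite G
  set S := σ.support with hS
  let A := S ×ˢ Sᶜ
  let B := S.image fun b => (b, σ b)
  have hA : A ⊆ (univ : Finset α).offDiag := fun q hq => by
    simp only [A, mem_product, mem_compl] at hq
    simpa using fun h : q.1 = q.2 => hq.2 (h ▸ hq.1)
  have hB : B ⊆ (univ : Finset α).offDiag := fun q hq => by
    simp only [B, mem_image] at hq
    obtain ⟨b, hb, rfl⟩ := hq
    simpa using (mem_support.mp hb).symm
  have h1 := card_mul_sum_card_filter_mem (G := G) S
  have h3 := card_mul_sum_card_filter_mem_mul_self_sub h2 S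
  have h4 := card_mul_sum_card_filter_mem_of_subset_offDiag h2 hA hB
  have hBcard : #B = #S := card_image_of_injective _ fun x y h => (Prod.ext_iff.mp h).1
  have hAcard : #A = #S * (Fintype.card α - #S) := by rw [card_product, card_compl]
  have hle : 3 * ∑ g : G, #{q ∈ A | g • q ∈ B} ≤
      ∑ g : G, (#{a ∈ S | g • a ∈ S} * #{a ∈ S | g • a ∈ S} - #{a ∈ S | g • a ∈ S}) +
        ∑ g : G, #{a ∈ S | g • a ∈ S} := by
    rw [← sum_add_distrib, mul_sum]
    refine sum_le_sum fun g _ => ?_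
    rw [Nat.sub_add_cancel (Nat.le_mul_self _)]
    have hYX : #{q ∈ A | g • q ∈ B} ≤ #{a ∈ S | g • a ∈ S} := by
      refine card_le_card_of_injOn Prod.fst ?_ ?_
      · rintro ⟨x, y⟩ hq
        simp only [A, B, coe_filter, mem_product, mem_image, Set.mem_ofPred_eq, Prod.smul_mk,
          Prod.mk.injEq] at hq ⊢
        obtain ⟨⟨hx, -⟩, b, hb, hbx, -⟩ := hq
        exact ⟨hx, hbx ▸ hb⟩
      · rintro ⟨x, y⟩ hq ⟨x', y'⟩ hq' hxx
        simp only [A, B, coe_filter, mem_product, mem_image, Set.mem_ofPred_eq, Prod.smul_mk,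
          Prod.mk.injEq] at hq hq' hxx ⊢
        obtain ⟨-, b, -, hbx, hby⟩ := hq
        obtain ⟨-, b', -, hbx', hby'⟩ := hq'
        subst hxx
        refine ⟨rfl, MulAction.injective g ?_⟩
        change g • y = g • y'
        rw [← hby, ← hby', hbx, hbx']
    rcases Nat.eq_zero_or_pos #{q ∈ A | g • q ∈ B} with h0 | hpos
    · rw [h0]; exact Nat.zero_le _
    · obtain ⟨⟨x, y⟩, hq⟩ := card_pos.mp hpos
      simp only [A, B, mem_filter, mem_product, mem_image, Prod.smul_mk, Prod.mk.injEq, hS,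
        mem_compl, mem_support, not_not] at hq
      obtain ⟨⟨hx, hy⟩, b, -, hbx, hby⟩ := hq
      have hX : 2 < #{a ∈ S | g • a ∈ S} := by
        by_contra! hX
        refine commutator_conj_ne_one (g := (g : Perm α)) hx ?_ (hne g g.2 hX)
        have hgx : (g : Perm α) x = b := hbx.symm
        have hgy : (g : Perm α)⁻¹ (σ b) = y := by
          rw [inv_eq_iff_eq]
          exact hby
        rw [hgx, hgy, hy]
      exact Nat.mul_le_mul hX hYX
  have hN : 0 < Fintype.card G := Fintype.card_pos
  have hm : 1 ≤ #S := by
    have := two_le_card_support_of_ne_one hσ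
    rw [hS]
    omega
  have hmn : #S ≤ Fintype.card α := card_le_univ S
  rw [hBcard, hAcard] at h4
  generalize #S = m at *
  generalize Fintype.card α = n at *
  obtain ⟨m, rfl⟩ := Nat.exists_eq_add_of_le' hm
  obtain ⟨l, rfl⟩ := Nat.exists_eq_add_of_le hmn
  rw [show (m + 1) * (m + 1) - (m + 1) = (m + 1) * m by
    rw [← Nat.mul_sub_one, Nat.add_sub_cancel]] at h3
  rw [show m + 1 + l - (m + 1) = l by omega] at h4
  rw [show m + 1 + l - 1 = m + l by omega] at h3 h4
  have h5 := Nat.mul_le_mul_left ((m + 1 + l) * (m + l)) hle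
  rw [mul_add _ (∑ _, _), h3, mul_left_comm, h4, mul_right_comm _ (m + l), h1] at h5
  have h6 : (Fintype.card G * ((m + 1) * (m + 1))) * (3 * l) ≤
      (Fintype.card G * ((m + 1) * (m + 1))) * (m ^ 2 + (m + l)) := by linarith
  have := Nat.le_of_mul_le_mul_left h6 (by positivity)
  nlinarith

/-- A doubly transitive group containing a non-identity permutation whose support is small compared
with the square root of the degree contains the alternating group. -/
theorem alternatingGroup_le_of_sq_card_support_lt
    (h2 : ∀ a b a' b' : α, a ≠ b → a' ≠ b' → ∃ g ∈ G, g a = a' ∧ g b = b')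
    (hG : IsPreprimitive G α) {σ : Perm α}
    (hσ : σ ∈ G) (hσ1 : σ ≠ 1) (hlt : (#σ.support - 1) ^ 2 + 1 < Fintype.card α) :
    alternatingGroup α ≤ G := by
  have := two_le_card_support_of_ne_one hσ1
  obtain ⟨g, hg, hX⟩ := exists_card_filter_mem_eq_one h2 (card_pos.mp (by omega)) hlt
  obtain ⟨a, ha⟩ := card_eq_one.mp hX
  have ha' : ∀ x, σ x ≠ x ∧ σ (g x) ≠ g x ↔ x = a := fun x => by
    simpa using Finset.ext_iff.mp ha x
  have haa := (ha' a).mpr rfl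
  refine alternatingGroup_le_of_card_support_le_three hG (τ := ⁅σ, g * σ * g⁻¹⁆) ?_
    (commutator_conj_ne_one haa.1 ?_) ?_
  · rw [commutatorElement_def]
    have := G.mul_mem (G.mul_mem hg hσ) (G.inv_mem hg)
    exact G.mul_mem (G.mul_mem (G.mul_mem hσ this) (G.inv_mem hσ)) (G.inv_mem this)
  · by_contra hne
    have h3 := (ha' (g⁻¹ (σ (g a)))).mp ⟨hne, by simpa using haa.2⟩
    rw [inv_eq_iff_eq] at h3
    exact haa.2 h3
  · exact (card_support_commutator_conj_le σ g).trans_eq (by rw [hX])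

/-- A variant of `alternatingGroup_le_of_sq_card_support_lt` with a better constant, for degree
greater than `26`. -/
theorem alternatingGroup_le_of_sq_card_support_add_lt
    (h2 : ∀ a b a' b' : α, a ≠ b → a' ≠ b' → ∃ g ∈ G, g a = a' ∧ g b = b')
    (hG : IsPreprimitive G α) {σ : Perm α}
    (hσ : σ ∈ G) (hσ1 : σ ≠ 1) (hlt : #σ.support ^ 2 + #σ.support < 2 * Fintype.card α)
    (hα : 26 < Fintype.card α) :
    alternatingGroup α ≤ G := by
  obtain ⟨g, hg, hX, hne⟩ := exists_card_filter_mem_le_two h2 hσ1 hlt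
  refine alternatingGroup_le_of_sq_card_support_lt h2 hG (σ := ⁅σ, g * σ * g⁻¹⁆) ?_ hne ?_
  · rw [commutatorElement_def]
    have := G.mul_mem (G.mul_mem hg hσ) (G.inv_mem hg)
    exact G.mul_mem (G.mul_mem (G.mul_mem hσ this) (G.inv_mem hσ)) (G.inv_mem this)
  · have h6 : #(⁅σ, g * σ * g⁻¹⁆).support - 1 ≤ 5 := by
      have := card_support_commutator_conj_le σ g
      omega
    have := Nat.pow_le_pow_left h6 2
    omega

end DoublyTransitive

end Equiv.Perm

end

theorem Real.two_mul_sub_one_lt_log_mul_add_two {y : ℝ} (hy : 3 ≤ y) :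
    2 * (y - 1) < Real.log y * (y + 2) := by
  have h1 : 1 - 4 / y ≤ Real.log (y / 4) := by
    simpa using Real.one_sub_inv_le_log_of_pos (show 0 < y / 4 by positivity)
  have h2 : Real.log y = Real.log (y / 4) + 2 * Real.log 2 := by
    rw [Real.log_div (by positivity) (by norm_num), show (4 : ℝ) = 2 ^ 2 by norm_num, Real.log_pow]
    push_cast
    ring
  have h3 : 4 / y ≤ 4 / 3 := div_le_div_of_nonneg_left (by norm_num) (by norm_num) hy
  have h4 : 4 / y * y = 4 := div_mul_cancel₀ _ (by positivity)
  have h5 : 19 / 8 - 4 / y ≤ Real.log y := by linarith [Real.log_two_gt_d9]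
  nlinarith [mul_le_mul_of_nonneg_right h5 (show 0 ≤ y + 2 by positivity)]

theorem sq_lt_or_sq_add_lt_of_log_le {m p : ℕ} (hp : p.Prime) (hm : 2 ≤ m)
    (h : (m : ℝ) ^ 2 / 4 * Real.log ((m : ℝ) / 2) +
        (m : ℝ) * (Real.log ((m : ℝ) / 2) + 3 / 2) ≤ p) :
    (m - 1) ^ 2 + 1 < p ∨ m ^ 2 + m < 2 * p ∧ 26 < p := by
  have hlog2 := Real.log_two_gt_d9
  rcases Nat.lt_or_ge m 7 with hm7 | hm7
  · left
    interval_cases m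
    · norm_num at h ⊢
      exact h
    · have := Real.one_sub_inv_le_log_of_pos (show (0 : ℝ) < 3 / 2 by norm_num)
      norm_num at h this ⊢
      have : (5 : ℝ) < p := by linarith
      exact_mod_cast this
    · norm_num at h ⊢
      have : (10 : ℝ) < p := by linarith
      exact_mod_cast this
    · have h1 := Real.one_sub_inv_le_log_of_pos (show (0 : ℝ) < 5 / 4 by norm_num)
      have h2 : Real.log (5 / 2) = Real.log (5 / 4) + Real.log 2 := by
        rw [← Real.log_mul (by norm_num) (by norm_num)]
        norm_num
      norm_num at h h1 h2 ⊢
      have : (17 : ℝ) < p := by linarith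
      exact_mod_cast this
    · have h1 := Real.one_sub_inv_le_log_of_pos (show (0 : ℝ) < 9 / 8 by norm_num)
      have h2 : 2 * Real.log 3 = Real.log (9 / 8) + 3 * Real.log 2 := by
        rw [Real.log_div (by norm_num) (by norm_num), show (9 : ℝ) = 3 ^ 2 by norm_num,
          show (8 : ℝ) = 2 ^ 3 by norm_num, Real.log_pow, Real.log_pow]
        push_cast
        ring
      norm_num at h h1 ⊢
      have : (25 : ℝ) < p := by linarith
      have h25 : 25 < p := by exact_mod_cast this
      refine lt_of_le_of_ne h25 ?_
      rintro rfl
      exact absurd hp (by norm_num)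
  · right
    have hm' : (7 : ℝ) ≤ m := by exact_mod_cast hm7
    have hy := Real.two_mul_sub_one_lt_log_mul_add_two (show 3 ≤ (m : ℝ) / 2 by linarith)
    have hmy := mul_lt_mul_of_pos_left hy (show (0 : ℝ) < m by positivity)
    have hlt : (m : ℝ) ^ 2 + m < 2 * p := by linarith
    have hlt' : m ^ 2 + m < 2 * p := by exact_mod_cast hlt
    exact ⟨hlt', by nlinarith⟩

/-- **Jordan (1871).** Let `p` be prime and `G` a primitive subgroup of the symmetric group
on `p` points (transitive, with only trivial blocks). If `G` contains a non-identity
permutation moving exactly `m` points, where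
`(m²/4)·log(m/2) + m·(log(m/2) + 3/2) ≤ p`, then `G` contains the alternating group. -/
theorem jordan_primitive_contains_alternating
    (p m : ℕ) (hp : p.Prime) (G : Subgroup (Equiv.Perm (Fin p)))
    (htrans : ∀ a b : Fin p, ∃ g ∈ G, g a = b)
    (hprim : ∀ B : Set (Fin p), MulAction.IsBlock G B → B.Subsingleton ∨ B = Set.univ)
    (σ : Equiv.Perm (Fin p)) (hσG : σ ∈ G) (hσ : σ ≠ 1)
    (hm : {x : Fin p | σ x ≠ x}.ncard = m)
    (hineq : (m : ℝ) ^ 2 / 4 * Real.log ((m : ℝ) / 2) +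
        (m : ℝ) * (Real.log ((m : ℝ) / 2) + 3 / 2) ≤ p) :
    alternatingGroup (Fin p) ≤ G := by
  have hσ2 := Equiv.Perm.two_le_card_support_of_ne_one hσ
  have hcard : σ.support.card = m := by
    rw [← hm, ← Set.ncard_coe_finset]
    congr 1
    ext x
    simp
  rw [hcard] at hσ2
  have hpre : MulAction.IsPretransitive G (Fin p) :=
    ⟨fun x y => (htrans x y).elim fun g hg => ⟨⟨g, hg.1⟩, hg.2⟩⟩
  have hG : MulAction.IsPreprimitive G (Fin p) := { hpre with isTrivialBlock_of_isBlock := hprim _ }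
  have hsize := sq_lt_or_sq_add_lt_of_log_le hp hσ2 hineq
  have hhalf : 2 * σ.support.card ≤ p + 2 := by
    obtain ⟨k, rfl⟩ := Nat.exists_eq_add_of_le' hσ2
    rw [hcard]
    rcases hsize with h | h
    · rw [show k + 2 - 1 = k + 1 by omega] at h
      nlinarith [sq_nonneg ((k : ℤ) - 1)]
    · nlinarith [sq_nonneg ((k : ℤ) - 1)]
  have h2 : ∀ a b a' b' : Fin p, a ≠ b → a' ≠ b' → ∃ g ∈ G, g a = a' ∧ g b = b' :=
    fun _ _ _ _ => Equiv.Perm.exists_mem_apply_eq_of_two_mul_card_support_le hp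
      (Fintype.card_fin p) G htrans σ hσG hσ hhalf
  rcases hsize with h | h
  · exact Equiv.Perm.alternatingGroup_le_of_sq_card_support_lt h2 hG hσG hσ
      (by rwa [hcard, Fintype.card_fin])
  · exact Equiv.Perm.alternatingGroup_le_of_sq_card_support_add_lt h2 hG hσG hσ
      (by rw [hcard, Fintype.card_fin]; exact h.1) (by rw [Fintype.card_fin]; exact h.2)
end

section
/- Let f ∈ ℚ[x] be an irreducible polynomial of degree 7 that has at least one non-real complex root. Then the order of the Galois group of f over ℚ is one of 14, 42, 168, 2520, or 5040 (these orders correspond to the dihedral group D_7, the Frobenius group of order 42, PSL(3,2), A_7, and S_7, which are the only possible Galois groups in this situation). -/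
open Polynomial

section Sylow

/-- A subgroup whose order is divisible by the full power of `p` dividing the order of the ambient
group contains a conjugate of every `p`-element. -/
theorem Subgroup.exists_conj_mem_of_pow_factorization_dvd_card {G : Type*} [Group G] [Finite G]
    {p : ℕ} [Fact p.Prime] {H : Subgroup G}
    (hH : p ^ (Nat.card G).factorization p ∣ Nat.card H)
    {c : G} {k : ℕ} (hc : orderOf c = p ^ k) : ∃ g : G, g * c * g⁻¹ ∈ H := by
  obtain ⟨K, hK⟩ := Sylow.exists_subgroup_card_pow_prime p hH
  have hK' : Nat.card (K.map H.subtype) = p ^ (Nat.card G).factorization p := by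
    rw [← hK]
    exact Nat.card_congr (K.equivMapOfInjective _ H.subtype_injective).symm.toEquiv
  obtain ⟨Q, hQ⟩ := (IsPGroup.of_card (p := p) (n := k)
    (by rw [Nat.card_zpowers, hc] : Nat.card (Subgroup.zpowers c) = p ^ k)).exists_le_sylow
  obtain ⟨g, hg⟩ := MulAction.exists_smul_eq G Q (Sylow.ofCard (K.map H.subtype) hK')
  refine ⟨g, ?_⟩
  have hmem : g * c * g⁻¹ ∈ g • Q := by
    rw [← SetLike.mem_coe, Sylow.coe_smul]
    exact ⟨c, hQ (Subgroup.mem_zpowers c), rfl⟩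
  rw [hg] at hmem
  exact Subgroup.map_subtype_le K hmem

/-- If a Sylow subgroup of prime order is its own normalizer, it has a normal complement. -/
theorem Sylow.exists_normal_isComplement'_of_card_normalizer_eq {G : Type*} [Group G] [Finite G]
    {p : ℕ} [Fact p.Prime] (P : Sylow p G) (hP : Nat.card P = p)
    (hN : Nat.card (Subgroup.normalizer (P : Set G)) = p) :
    ∃ N : Subgroup G, N.Normal ∧ N.IsComplement' P := by
  have heq : (P : Subgroup G) = Subgroup.normalizer (P : Set G) :=
    Subgroup.eq_of_le_of_card_ge Subgroup.le_normalizer (hN.trans hP.symm).le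
  have : IsCyclic P := isCyclic_of_prime_card hP
  have hle : Subgroup.normalizer (P : Set G) ≤ Subgroup.centralizer (P : Set G) :=
    heq ▸ Subgroup.le_centralizer (P : Subgroup G)
  exact ⟨_, inferInstance, MonoidHom.ker_transferSylow_isComplement' P hle⟩

end Sylow

namespace MulAction

variable {G α : Type*} [Group G] [MulAction G α]

/-- An abelian group acting transitively is self-centralizing in every group acting faithfully. -/
theorem centralizer_le_of_isPretransitive [FaithfulSMul G α] [Nonempty α] (P : Subgroup G)
    [IsMulCommutative P] [IsPretransitive P α] : Subgroup.centralizer (P : Set G) ≤ P := by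
  intro x hx
  let a : α := Classical.arbitrary α
  obtain ⟨g, hg⟩ := exists_smul_eq P a (x • a)
  suffices x = g from this ▸ g.2
  refine eq_of_smul_eq_smul (α := α) fun b => ?_
  obtain ⟨h, rfl⟩ := exists_smul_eq P a b
  have hxh : x * h = h * x := (Subgroup.mem_centralizer_iff.mp hx h h.2).symm
  have hgh : (g : G) * h = h * g := congrArg Subtype.val (mul_comm' g h)
  change x • (h : G) • a = (g : G) • (h : G) • a
  rw [smul_smul, hxh, mul_smul, ← hg, smul_smul _ _ a, hgh, mul_smul]
  rfl

/-- A faithful action of a group of prime order `p` on a set of `p` elements is transitive. -/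
theorem isPretransitive_of_prime_card [FaithfulSMul G α] {p : ℕ} (hp : p.Prime)
    (hG : Nat.card G = p) (hα : Nat.card α = p) : IsPretransitive G α := by
  have : Finite G := Nat.finite_of_card_ne_zero (hG ▸ hp.ne_zero)
  have : Finite α := Nat.finite_of_card_ne_zero (hα ▸ hp.ne_zero)
  have : Nontrivial G := Finite.one_lt_card_iff_nontrivial.mp (hG ▸ hp.one_lt)
  obtain ⟨g, hg⟩ := exists_ne (1 : G)
  obtain ⟨a, ha⟩ : ∃ a : α, g • a ≠ a := by
    by_contra! h
    exact hg (eq_of_smul_eq_smul fun a : α => by rw [h, one_smul])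
  have hdvd : (orbit G a).ncard ∣ p := by
    rw [← index_stabilizer, ← hG]
    exact Subgroup.index_dvd_card _
  have hne : (orbit G a).ncard ≠ 1 := by
    rw [← index_stabilizer, Ne, Subgroup.index_eq_one]
    intro h
    exact ha (mem_stabilizer_iff.mp (h ▸ Subgroup.mem_top g))
  have huniv : orbit G a = Set.univ := by
    rw [Set.eq_univ_iff_ncard, (hp.eq_one_or_self_of_dvd _ hdvd).resolve_left hne, hα]
  exact isPretransitive_iff_orbit_eq_univ a |>.mpr huniv

variable [FaithfulSMul G α]

theorem card_dvd_factorial [Finite α] : Nat.card G ∣ (Nat.card α).factorial := by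
  rw [← Nat.card_perm]
  exact Subgroup.card_dvd_of_injective (toPermHom G α) toPerm_injective

variable {p : ℕ}

omit [FaithfulSMul G α] in
theorem prime_dvd_card [IsPretransitive G α] (hp : p.Prime) (hα : Nat.card α = p) :
    p ∣ Nat.card G := by
  have : Nonempty α := (Nat.card_ne_zero.mp (hα ▸ hp.ne_zero)).1
  rw [← hα, ← index_stabilizer_of_transitive G (Classical.arbitrary α)]
  exact Subgroup.index_dvd_card _

/-- The order of a nontrivial normal subgroup of a transitive group of prime degree is divisible
by the degree. -/
theorem prime_dvd_card_of_normal [IsPretransitive G α] (hp : p.Prime) (hα : Nat.card α = p)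
    (N : Subgroup G) [N.Normal] (hN : N ≠ ⊥) : IsPretransitive N α ∧ p ∣ Nat.card N := by
  have := IsPreprimitive.of_prime_card (G := G) (hα ▸ hp : (Nat.card α).Prime)
  have : IsPretransitive N α := by
    refine IsQuasiPreprimitive.isPretransitive_of_normal (G := G) fun h => hN ?_
    rw [Subgroup.eq_bot_iff_forall]
    intro g hg
    refine eq_of_smul_eq_smul fun a : α => ?_
    have ha : a ∈ fixedPoints N α := h ▸ Set.mem_univ a
    rw [one_smul]
    exact ha ⟨g, hg⟩
  exact ⟨this, prime_dvd_card hp hα⟩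

theorem card_sylow_eq [Finite G] [IsPretransitive G α] [hp : Fact p.Prime] (hα : Nat.card α = p)
    (P : Sylow p G) : Nat.card P = p := by
  have : Finite α := Nat.finite_of_card_ne_zero (hα ▸ hp.out.ne_zero)
  have h1 : p ^ 1 ∣ Nat.card P :=
    P.pow_dvd_card_of_pow_dvd_card (by simpa using prime_dvd_card hp.out hα)
  obtain ⟨n, hn⟩ := P.isPGroup'.exists_card_eq
  have h2 : p ^ n ∣ p.factorial := by
    have := (Subgroup.card_subgroup_dvd_card (P : Subgroup G)).trans (card_dvd_factorial (α := α))
    rwa [hn, hα] at this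
  have h3 : n ≤ 1 := by
    have := (hp.out.pow_dvd_factorial_iff (b := 2) (Nat.log_lt_of_lt_pow hp.out.ne_zero
      (by nlinarith [hp.out.one_lt]))).mp h2
    simpa [Nat.div_self hp.out.pos] using this
  rw [hn] at h1 ⊢
  rw [le_antisymm h3 ((Nat.pow_dvd_pow_iff_le_right hp.out.one_lt).mp h1), pow_one]

theorem card_normalizer_sylow_dvd [Finite G] [IsPretransitive G α] [hp : Fact p.Prime]
    (hα : Nat.card α = p) (P : Sylow p G) :
    Nat.card (Subgroup.normalizer (P : Set G)) ∣ p * (p - 1) := by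
  have : Nonempty α := (Nat.card_ne_zero.mp (hα ▸ hp.out.ne_zero)).1
  have hP := card_sylow_eq hα P
  have : IsCyclic P := isCyclic_of_prime_card hP
  have : IsPretransitive (P : Subgroup G) α := isPretransitive_of_prime_card hp.out hP hα
  have hC : Subgroup.centralizer (P : Set G) = P :=
    le_antisymm (centralizer_le_of_isPretransitive (α := α) (P : Subgroup G))
      (Subgroup.le_centralizer (P : Subgroup G))
  have key := Subgroup.card_dvd_of_injective _
    (QuotientGroup.kerLift_injective (P : Subgroup G).normalizerMonoidHom)
  rw [Subgroup.normalizerMonoidHom_ker, ← Subgroup.index, ← Subgroup.relIndex,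
    IsCyclic.card_mulAut, hP, Nat.totient_prime hp.out, P.coe_coe, hC] at key
  have hcard := Subgroup.relIndex_mul_relIndex ⊥ _ _ bot_le
    (Subgroup.le_normalizer (H := (P : Subgroup G)))
  rw [Subgroup.relIndex_bot_left, Subgroup.relIndex_bot_left, hP, P.coe_coe] at hcard
  rw [← hcard]
  exact mul_dvd_mul_left p key

/-- A transitive group of prime degree whose Sylow subgroup for the degree is self-normalizing
is cyclic of prime order. -/
theorem card_eq_of_card_normalizer_sylow_eq [Finite G] [IsPretransitive G α] [hp : Fact p.Prime]
    (hα : Nat.card α = p) (P : Sylow p G)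
    (hN : Nat.card (Subgroup.normalizer (P : Set G)) = p) : Nat.card G = p := by
  have hP := card_sylow_eq hα P
  obtain ⟨N, hnormal, hcompl⟩ := P.exists_normal_isComplement'_of_card_normalizer_eq hP hN
  have hbot : N = ⊥ := by
    by_contra h
    refine P.not_dvd_index ?_
    rw [hcompl.index_eq_card]
    exact (prime_dvd_card_of_normal hp.out hα N h).2
  rw [← hcompl.card_mul_card, hbot, Subgroup.card_bot, one_mul]
  exact hP

/-- The order of a transitive group of prime degree `p` is `p * m * n`, where `n` is the number of
Sylow `p`-subgroups and `p * m` is the order of their normalizers; if `m = 1`, the order is `p`. -/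
theorem exists_card_eq_mul [Finite G] [IsPretransitive G α] [hp : Fact p.Prime]
    (hα : Nat.card α = p) : ∃ m n, Nat.card G = p * m * n ∧ m ∣ p - 1 ∧ n ≡ 1 [MOD p] ∧
      (m = 1 → Nat.card G = p) := by
  obtain ⟨P⟩ : Nonempty (Sylow p G) := inferInstance
  obtain ⟨m, hm⟩ : p ∣ Nat.card (Subgroup.normalizer (P : Set G)) := by
    have := Subgroup.card_dvd_of_le (Subgroup.le_normalizer (H := (P : Subgroup G)))
    rwa [card_sylow_eq hα P] at this
  refine ⟨m, Nat.card (Sylow p G), ?_, ?_, card_sylow_modEq_one p G, ?_⟩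
  · rw [← hm, P.card_eq_index_normalizer, Subgroup.card_mul_index]
  · have := card_normalizer_sylow_dvd hα P
    rw [hm] at this
    exact Nat.dvd_of_mul_dvd_mul_left hp.out.pos this
  · rintro rfl
    exact card_eq_of_card_normalizer_sylow_eq hα P (by rw [hm, mul_one])

end MulAction

namespace Equiv.Perm

open MulAction

variable {α : Type*} [Fintype α] [DecidableEq α] (H : Subgroup (Perm α))

theorem alternatingGroup_le_of_nine_dvd_card [IsPretransitive H α] (hα : Nat.card α = 7)
    (h : 9 ∣ Nat.card H) : alternatingGroup α ≤ H := by
  have : Fact (Nat.Prime 3) := ⟨Nat.prime_three⟩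
  have hfac : 3 ^ (Nat.card (Perm α)).factorization 3 = 9 := by
    rw [Nat.card_perm, hα, Nat.factorization_def _ Nat.prime_three,
      padicValNat_factorial (n := 7) (b := 2) (by norm_num)]
    decide
  obtain ⟨c, hc⟩ : ∃ c : Perm α, c.IsThreeCycle := by
    obtain ⟨a, b, c, hab, hac, hbc⟩ := Fintype.two_lt_card_iff.mp
      (by rw [← Nat.card_eq_fintype_card, hα]; norm_num : 2 < Fintype.card α)
    exact ⟨_, isThreeCycle_swap_mul_swap_same hab hac hbc⟩
  obtain ⟨g, hg⟩ := Subgroup.exists_conj_mem_of_pow_factorization_dvd_card (hfac ▸ h)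
    (by rw [hc.orderOf, pow_one] : orderOf c = 3 ^ 1)
  refine alternatingGroup_le_of_isPreprimitive_of_isThreeCycle_mem
    (IsPreprimitive.of_prime_card (by rw [hα]; norm_num)) (g := g * c * g⁻¹) ?_ hg
  rwa [IsThreeCycle, cycleType_conj]

theorem eq_top_of_sixteen_dvd_card [IsPretransitive H α] (hα : Nat.card α = 7)
    (h : 16 ∣ Nat.card H) : H = ⊤ := by
  have : Fact (Nat.Prime 2) := ⟨Nat.prime_two⟩
  have hfac : 2 ^ (Nat.card (Perm α)).factorization 2 = 16 := by
    rw [Nat.card_perm, hα, Nat.factorization_def _ Nat.prime_two,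
      padicValNat_factorial (n := 7) (b := 3) (by norm_num)]
    decide
  have : Nontrivial α := Finite.one_lt_card_iff_nontrivial.mp (by omega)
  obtain ⟨a, b, hab⟩ := exists_pair_ne α
  obtain ⟨g, hg⟩ := Subgroup.exists_conj_mem_of_pow_factorization_dvd_card (hfac ▸ h)
    (by rw [(isSwap_iff_cycleType.mp ⟨a, b, hab, rfl⟩ ▸ (lcm_cycleType (swap a b)).symm :
      orderOf (swap a b) = Multiset.lcm {2})]; rfl : orderOf (swap a b) = 2 ^ 1)
  refine subgroup_eq_top_of_isPreprimitive_of_isSwap_mem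
    (IsPreprimitive.of_prime_card (by rw [hα]; norm_num)) _ ?_ hg
  rw [isSwap_iff_cycleType, cycleType_conj, ← isSwap_iff_cycleType]
  exact ⟨a, b, hab, rfl⟩

end Equiv.Perm

namespace MulAction

variable {G α : Type*} [Group G] [MulAction G α] [FaithfulSMul G α] [IsPretransitive G α]

omit [FaithfulSMul G α] in
theorem isPretransitive_range_toPermHom : IsPretransitive (toPermHom G α).range α :=
  ⟨fun a b => (exists_smul_eq G a b).imp' (toPermHom G α).rangeRestrict fun _ h => h⟩

omit [IsPretransitive G α] in
theorem card_dvd_5040_of_degree_seven (hα : Nat.card α = 7) : Nat.card G ∣ 5040 := by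
  have : Finite α := Nat.finite_of_card_ne_zero (by omega)
  have h := card_dvd_factorial (G := G) (α := α)
  rwa [hα] at h

theorem eq_2520_or_5040_of_nine_dvd_card (hα : Nat.card α = 7) (h : 9 ∣ Nat.card G) :
    Nat.card G = 2520 ∨ Nat.card G = 5040 := by
  classical
  have : Finite α := Nat.finite_of_card_ne_zero (by omega)
  have := Fintype.ofFinite α
  have hcard : Nat.card (toPermHom G α).range = Nat.card G :=
    Nat.card_congr (MonoidHom.ofInjective toPerm_injective).symm.toEquiv
  have : IsPretransitive (toPermHom G α).range α :=
    isPretransitive_range_toPermHom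
  have hle := Equiv.Perm.alternatingGroup_le_of_nine_dvd_card (toPermHom G α).range hα
    (hcard ▸ h)
  have : Nontrivial α := Finite.one_lt_card_iff_nontrivial.mp (by omega)
  have hA : Nat.card (alternatingGroup α) = 2520 := by
    rw [nat_card_alternatingGroup, hα]
    rfl
  obtain ⟨k, hk⟩ := Subgroup.card_dvd_of_le hle
  have hdvd := card_dvd_5040_of_degree_seven (G := G) hα
  rw [hcard, hA] at hk
  have hk2 : k ∣ 2 := by
    rw [hk] at hdvd
    exact Nat.dvd_of_mul_dvd_mul_left (by norm_num : 0 < 2520) hdvd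
  rcases (Nat.dvd_prime Nat.prime_two).mp hk2 with rfl | rfl <;> omega

theorem eq_5040_of_sixteen_dvd_card (hα : Nat.card α = 7) (h : 16 ∣ Nat.card G) :
    Nat.card G = 5040 := by
  classical
  have : Finite α := Nat.finite_of_card_ne_zero (by omega)
  have := Fintype.ofFinite α
  have hcard : Nat.card (toPermHom G α).range = Nat.card G :=
    Nat.card_congr (MonoidHom.ofInjective toPerm_injective).symm.toEquiv
  have : IsPretransitive (toPermHom G α).range α :=
    isPretransitive_range_toPermHom
  rw [← hcard, Equiv.Perm.eq_top_of_sixteen_dvd_card (toPermHom G α).range hα (hcard ▸ h),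
    Subgroup.card_top, Nat.card_perm, hα]
  rfl

theorem card_ne_210 [Finite G] (hα : Nat.card α = 7) : Nat.card G ≠ 210 := by
  intro h
  have : Fact (Nat.Prime 2) := ⟨Nat.prime_two⟩
  have : Fact (Nat.Prime 7) := ⟨by norm_num⟩
  obtain ⟨P⟩ : Nonempty (Sylow 2 G) := inferInstance
  have hP : Nat.card P = 2 := by
    rw [P.card_eq_multiplicity, h, Nat.factorization_def _ Nat.prime_two,
      show 210 = 2 * 105 from rfl, padicValNat.mul (by norm_num) (by norm_num),
      padicValNat_self, padicValNat.eq_zero_of_not_dvd (by norm_num)]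
    rfl
  have hcyc : IsCyclic P := isCyclic_of_prime_card hP
  have hmin : (Nat.card G).minFac = 2 := by rw [h]; norm_num
  have hcompl := (IsCyclic.isComplement' hmin hcyc).card_mul_card
  set K := (MonoidHom.transferSylow P (hcyc.normalizer_le_centralizer hmin)).ker
  have hK : Nat.card K = 105 := by
    have : Nat.card K * 2 = 210 := by rw [← h, ← hcompl]; exact congrArg _ hP.symm
    omega
  have hbot : K ≠ ⊥ := by
    intro hb
    rw [hb, Subgroup.card_bot] at hK
    omega
  have := (prime_dvd_card_of_normal (G := G) (α := α) (by norm_num) hα K hbot).1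
  obtain ⟨m, n, hmn, hm, hn, h1⟩ := exists_card_eq_mul (G := K) (α := α) hα
  have hm6 := Nat.le_of_dvd (by norm_num) hm
  rw [Nat.ModEq] at hn
  interval_cases m <;> omega

/-- The possible orders of a transitive group of degree seven and even order. -/
theorem card_of_degree_seven_of_two_dvd_card [Finite G] (hα : Nat.card α = 7)
    (h2 : 2 ∣ Nat.card G) :
    Nat.card G = 14 ∨ Nat.card G = 42 ∨ Nat.card G = 168 ∨ Nat.card G = 2520 ∨
      Nat.card G = 5040 := by
  have : Fact (Nat.Prime 7) := ⟨by norm_num⟩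
  have h9 := eq_2520_or_5040_of_nine_dvd_card (G := G) hα
  have h16 := eq_5040_of_sixteen_dvd_card (G := G) hα
  have h210 := card_ne_210 (G := G) hα
  have hdvd := card_dvd_5040_of_degree_seven (G := G) hα
  obtain ⟨m, n, hmn, hm, hn, h1⟩ := exists_card_eq_mul (G := G) (α := α) hα
  rw [hmn] at h2 h9 h16 h210 hdvd h1 ⊢
  clear hmn
  have hn' : n ∈ Nat.divisors 720 := by
    rw [Nat.mem_divisors]
    refine ⟨?_, by norm_num⟩
    have : 7 * (m * n) ∣ 7 * 720 := by rwa [← mul_assoc]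
    exact (Dvd.intro_left m rfl).trans (Nat.dvd_of_mul_dvd_mul_left (by norm_num) this)
  have hn7 : n ∈ (Nat.divisors 720).filter (· % 7 = 1) := Finset.mem_filter.mpr ⟨hn', hn⟩
  rw [show (Nat.divisors 720).filter (· % 7 = 1) = {1, 8, 15, 36, 120} by decide +kernel] at hn7
  have hm' : m ∈ Nat.divisors 6 := Nat.mem_divisors.mpr ⟨hm, by norm_num⟩
  rw [show Nat.divisors 6 = {1, 2, 3, 6} by decide +kernel] at hm'
  simp only [Finset.mem_insert, Finset.mem_singleton] at hn7 hm'
  rcases hm' with rfl | rfl | rfl | rfl <;> rcases hn7 with rfl | rfl | rfl | rfl | rfl <;> omega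

end MulAction

namespace Polynomial.Gal

theorem natCard_rootSet_complex {f : ℚ[X]} (hirr : Irreducible f) :
    Nat.card (f.rootSet ℂ) = f.natDegree := by
  rw [Nat.card_eq_fintype_card]
  exact card_rootSet_eq_natDegree hirr.separable (IsAlgClosed.splits _)

/-- Complex conjugation shows that the Galois group has even order. -/
theorem two_dvd_card_of_nonreal_root {f : ℚ[X]} (hf : f ≠ 0)
    (hroot : ∃ z : ℂ, aeval z f = 0 ∧ z.im ≠ 0) : 2 ∣ Nat.card f.Gal := by
  obtain ⟨z, hz, him⟩ := hroot
  have := splits_ℚ_ℂ (p := f)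
  let c : Gal(ℂ/ℚ) := Complex.conjAe.restrictScalars ℚ
  have hc : orderOf (restrict f ℂ c) = 2 := by
    have : Fact (Nat.Prime 2) := ⟨Nat.prime_two⟩
    refine orderOf_eq_prime ?_ fun h => ?_
    · rw [← map_pow, show c ^ 2 = 1 from AlgEquiv.ext Complex.conj_conj, map_one]
    · have hz' := restrict_smul c (⟨z, mem_rootSet.mpr ⟨hf, hz⟩⟩ : f.rootSet ℂ)
      rw [h, one_smul] at hz'
      exact him (Complex.conj_eq_iff_im.mp hz'.symm)
  exact hc ▸ orderOf_dvd_natCard _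

end Polynomial.Gal

/-- An irreducible polynomial over ℚ of degree 7 with a non-real complex root has Galois
group of one of the listed orders (corresponding to the finitely many possible groups). -/
theorem galois_group_card_of_degree_7_with_nonreal_root
    (f : ℚ[X]) (hdeg : f.natDegree = 7) (hirr : Irreducible f)
    (hroot : ∃ z : ℂ, aeval z f = 0 ∧ z.im ≠ 0) :
    Nat.card f.Gal = 14 ∨ Nat.card f.Gal = 42 ∨ Nat.card f.Gal = 168 ∨ Nat.card f.Gal = 2520 ∨ Nat.card f.Gal = 5040 := by
  have := Gal.splits_ℚ_ℂ (p := f)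
  have := Gal.galAction_isPretransitive f ℂ hirr
  have : FaithfulSMul f.Gal (f.rootSet ℂ) :=
    ⟨fun h => Gal.galActionHom_injective f ℂ (Equiv.ext h)⟩
  exact MulAction.card_of_degree_seven_of_two_dvd_card
    ((Gal.natCard_rootSet_complex hirr).trans hdeg)
    (Gal.two_dvd_card_of_nonreal_root hirr.ne_zero hroot)
end

section
/- Let f ∈ ℚ[x] be an irreducible polynomial of degree 11 that has at least one non-real complex root. Then the order of the Galois group of f over ℚ is one of 22, 110, 660, 7920, 19958400, or 39916800 (these orders correspond to the dihedral group D_11, the Frobenius group F_110, PSL(2,11), the Mathieu group M_11, A_11, and S_11, which are the only possible Galois groups in this situation). -/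
open Polynomial

section

open Equiv Equiv.Perm MulAction

/-- If two permutations have supports meeting in exactly one point, their commutator is a
3-cycle. -/
theorem Equiv.Perm.isThreeCycle_commutator {α : Type*} [Fintype α] [DecidableEq α]
    {f g : Perm α} {x : α} (h : f.support ∩ g.support = {x}) :
    (f * g * f⁻¹ * g⁻¹).IsThreeCycle := by
  obtain ⟨hxf, hxg⟩ : f x ≠ x ∧ g x ≠ x := by
    simpa using (Finset.ext_iff.1 h x).2 (by simp)
  have key (y : α) (hy : y ≠ x) : f y = y ∨ g y = y := by
    by_contra! hc
    exact hy (by simpa using (Finset.ext_iff.1 h y).1 (by simpa using hc))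
  have hfx : g (f x) = f x := (key _ hxf).resolve_left fun e => hxf (f.injective e)
  have hgx : f (g x) = g x := (key _ hxg).resolve_right fun e => hxg (g.injective e)
  have hfgx : f x ≠ g x := fun e => hxf (f.injective (by rw [e, hgx]))
  set k := f * g * f⁻¹ * g⁻¹ with hk
  have hkey (y : α) : k (g (f y)) = f (g y) := by simp [hk]
  have h1 : k (f x) = g x := by rw [← hgx, ← hkey x, hfx]
  have h2 : k (g x) = x := by
    obtain ⟨u, hu⟩ := f.surjective x
    have hux : u ≠ x := by rintro rfl; exact hxf hu
    have := hkey u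
    rwa [(key u hux).resolve_left (fun e => hux (e.symm.trans hu)), hu] at this
  have h3 : k x = f x := by
    obtain ⟨v, hv⟩ := g.surjective x
    have hvx : v ≠ x := by rintro rfl; exact hxg hv
    have := hkey v
    rwa [(key v hvx).resolve_right (fun e => hvx (e.symm.trans hv)), hv] at this
  have hsupp : k.support = {x, f x, g x} := by
    ext z
    simp only [mem_support, ne_eq, Finset.mem_insert, Finset.mem_singleton]
    constructor
    · contrapose!
      rintro ⟨hzx, hzf, hzg⟩
      by_cases hfz : f z = z
      · obtain ⟨w, rfl⟩ := g.surjective z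
        have hwx : w ≠ x := by rintro rfl; exact hzg rfl
        have hw : f w = w := (key w hwx).elim id fun e => by rwa [e] at hfz
        have := hkey w
        rwa [hw, hfz] at this
      · obtain ⟨u, rfl⟩ := f.surjective z
        have hux : u ≠ x := by rintro rfl; exact hzf rfl
        have hu : g u = u := (key u hux).resolve_left fun e => hfz (by rw [e, e])
        have := hkey u
        rwa [hu, (key _ hzx).resolve_left hfz] at this
    · rintro (rfl | rfl | rfl)
      · rwa [h3]
      · rw [h1]; exact hfgx.symm
      · rw [h2]; exact hxg.symm
  rw [← card_support_eq_three_iff, hsupp, Finset.card_eq_three]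
  exact ⟨x, f x, g x, hxf.symm, hxg.symm, hfgx, rfl⟩

instance fact_prime_eleven : Fact (Nat.Prime 11) := ⟨by norm_num⟩

/-- A primitive group containing a cycle of prime length `p` is `n - p + 1` times transitive. -/
theorem Equiv.Perm.isMultiplyPretransitive_of_isCycle_mem {α : Type*} [Fintype α] [DecidableEq α]
    {G : Subgroup (Perm α)} (hG : IsPreprimitive G α) {g : Perm α} (hg : g ∈ G) (hcyc : g.IsCycle)
    {n : ℕ} (hp : g.support.card.Prime) (hn : g.support.card + n + 1 = Fintype.card α) :
    IsMultiplyPretransitive G α (n + 2) := by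
  suffices IsMultiplyPreprimitive G α (n + 2) from
    IsMultiplyPreprimitive.isMultiplyPretransitive ..
  apply hG.isMultiplyPreprimitive (s := (g.supportᶜ : Set α))
  · apply Nat.add_left_cancel
    rw [Set.ncard_add_ncard_compl, Set.ncard_coe_finset, Nat.card_eq_fintype_card, ← hn, add_assoc]
  · rw [Nat.card_eq_fintype_card, ← hn]
    have := hp.two_le
    omega
  have := isPretransitive_of_isCycle_mem hcyc hg
  classical
  apply IsPreprimitive.of_prime_card
  convert! hp
  rw [Nat.card_eq_fintype_card, Fintype.card_subtype]
  apply congr_arg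
  ext x
  simp [SubMulAction.mem_ofFixingSubgroup_iff]

/-- Every set of two to four residues modulo 11 meets one of its translates in exactly one
point. -/
theorem exists_card_inter_translate (D : Finset (ZMod 11)) (h2 : 2 ≤ D.card) (h4 : D.card ≤ 4) :
    ∃ k : ZMod 11, (D ∩ D.map (Equiv.addRight k).toEmbedding).card = 1 := by
  revert D; decide +kernel

theorem addRight_mem {H : Subgroup (Perm (ZMod 11))} (hH : Equiv.addRight 1 ∈ H) (b : ZMod 11) :
    Equiv.addRight b ∈ H := by
  have := H.pow_mem hH b.val
  rwa [nsmul_addRight, nsmul_one, ZMod.natCast_zmod_val] at this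

theorem isPreprimitive_of_addRight_mem {H : Subgroup (Perm (ZMod 11))}
    (hH : Equiv.addRight 1 ∈ H) : IsPreprimitive H (ZMod 11) := by
  have : IsPretransitive H (ZMod 11) :=
    ⟨fun x y => ⟨⟨Equiv.addRight (y - x), addRight_mem hH _⟩, by simp [Subgroup.smul_def]⟩⟩
  exact IsPreprimitive.of_prime_card (by simpa using fact_prime_eleven.out)

theorem alternatingGroup_le_of_support_inter {H : Subgroup (Perm (ZMod 11))}
    (hH : Equiv.addRight 1 ∈ H) {f g : Perm (ZMod 11)} (hf : f ∈ H) (hg : g ∈ H)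
    (hfg : (f.support ∩ g.support).card = 1) : alternatingGroup (ZMod 11) ≤ H := by
  obtain ⟨x, hx⟩ := Finset.card_eq_one.1 hfg
  exact alternatingGroup_le_of_isPreprimitive_of_isThreeCycle_mem
    (isPreprimitive_of_addRight_mem hH) (isThreeCycle_commutator hx)
    (H.mul_mem (H.mul_mem (H.mul_mem hf hg) (H.inv_mem hf)) (H.inv_mem hg))

theorem five_le_card_support {H : Subgroup (Perm (ZMod 11))}
    (hH : Equiv.addRight 1 ∈ H) (hA : ¬ alternatingGroup (ZMod 11) ≤ H)
    {g : Perm (ZMod 11)} (hg : g ∈ H) (h1 : g ≠ 1) : 5 ≤ g.support.card := by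
  by_contra! hlt
  obtain ⟨k, hk⟩ := exists_card_inter_translate g.support
    (two_le_card_support_of_ne_one h1) (by omega)
  refine hA (alternatingGroup_le_of_support_inter hH hg
    (g := Equiv.addRight k * g * (Equiv.addRight k)⁻¹)
    (H.mul_mem (H.mul_mem (addRight_mem hH k) hg) (H.inv_mem (addRight_mem hH k))) ?_)
  rwa [support_conj]

theorem not_isCycle_card_support_eq_five {H : Subgroup (Perm (ZMod 11))}
    (hH : Equiv.addRight 1 ∈ H) (hA : ¬ alternatingGroup (ZMod 11) ≤ H)
    {g : Perm (ZMod 11)} (hg : g ∈ H) (hcyc : g.IsCycle) : g.support.card ≠ 5 := by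
  intro h5
  have h7 : IsMultiplyPretransitive H (ZMod 11) (5 + 2) :=
    isMultiplyPretransitive_of_isCycle_mem (isPreprimitive_of_addRight_mem hH) hg hcyc
      (by rw [h5]; norm_num) (by rw [h5, ZMod.card])
  have h5' : IsMultiplyPretransitive H (ZMod 11) 5 :=
    isMultiplyPretransitive_of_le (n := 5 + 2) (by norm_num) (by simp)
  obtain ⟨x, hx⟩ := Finset.card_pos.1 (h5 ▸ Nat.succ_pos 4 : 0 < g.support.card)
  have hcompl : g.supportᶜ.card = 6 := by
    rw [Finset.card_compl, h5, ZMod.card]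
  obtain ⟨t, ht, ht4⟩ := Finset.exists_subset_card_eq (hcompl ▸ (by norm_num) : 4 ≤ g.supportᶜ.card)
  have hxt : x ∉ t := fun h => by simpa [hx] using ht h
  have hu : (insert x t).card = 5 := by rw [Finset.card_insert_of_notMem hxt, ht4]
  let e₁ : Fin 5 ↪ ZMod 11 :=
    (Finset.equivFinOfCardEq h5).symm.toEmbedding.trans (Function.Embedding.subtype _)
  let e₂ : Fin 5 ↪ ZMod 11 :=
    (Finset.equivFinOfCardEq hu).symm.toEmbedding.trans (Function.Embedding.subtype _)
  obtain ⟨σ, hσ⟩ := exists_smul_eq H e₁ e₂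
  have hmap : g.support.map (σ : Perm (ZMod 11)).toEmbedding = insert x t := by
    refine Finset.eq_of_subset_of_card_le (fun y hy => ?_) (by rw [hu, Finset.card_map, h5])
    obtain ⟨z, hz, rfl⟩ := Finset.mem_map.1 hy
    have := DFunLike.congr_fun hσ (Finset.equivFinOfCardEq h5 ⟨z, hz⟩)
    simp only [e₁, e₂, Function.Embedding.smul_apply, Function.Embedding.trans_apply,
      Equiv.coe_toEmbedding, Equiv.symm_apply_apply, Function.Embedding.subtype_apply] at this
    simp only [Equiv.coe_toEmbedding]
    rw [← Perm.smul_def, ← Subgroup.smul_def, this]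
    exact Subtype.coe_prop _
  refine hA (alternatingGroup_le_of_support_inter hH hg (g := σ * g * (σ : Perm (ZMod 11))⁻¹)
    (H.mul_mem (H.mul_mem σ.2 hg) (H.inv_mem σ.2)) ?_)
  rw [support_conj, hmap, Finset.card_eq_one]
  refine ⟨x, ?_⟩
  ext y
  have := @ht y
  simp only [Finset.mem_inter, Finset.mem_insert, Finset.mem_singleton, Finset.mem_compl] at *
  grind

theorem descFactorial_dvd_card {H : Subgroup (Perm (ZMod 11))} {k : ℕ}
    [hk : IsMultiplyPretransitive H (ZMod 11) k] (hk11 : k ≤ 11) :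
    Nat.descFactorial 11 k ∣ Nat.card H := by
  have : Nonempty (Fin k ↪ ZMod 11) :=
    Function.Embedding.nonempty_of_card_le (by simpa using hk11)
  obtain ⟨e⟩ := this
  have := @index_stabilizer_of_transitive H (Fin k ↪ ZMod 11) _ _ e hk
  rw [Nat.card_eq_fintype_card, Fintype.card_embedding_eq, ZMod.card, Fintype.card_fin] at this
  rw [← this]
  exact Subgroup.index_dvd_card _

/-- A permutation group all of whose nonidentity elements fix fewer than `k` points
acts freely on `k`-tuples of distinct points. -/
theorem card_dvd_descFactorial {Q : Subgroup (Perm (ZMod 11))} {k : ℕ}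
    (hQ : ∀ g ∈ Q, g ≠ 1 → 11 < g.support.card + k) :
    Nat.card Q ∣ Nat.descFactorial 11 k := by
  have h (e : Fin k ↪ ZMod 11) : stabilizer Q e = ⊥ := by
    rw [eq_bot_iff]
    rintro ⟨g, hg⟩ hge
    by_contra hne
    have hlt := hQ g hg (by simpa using hne)
    have hsub : Finset.univ.map e ⊆ g.supportᶜ := by
      intro y hy
      obtain ⟨i, -, rfl⟩ := Finset.mem_map.1 hy
      simpa using DFunLike.congr_fun hge i
    have := Finset.card_le_card hsub
    rw [Finset.card_map, Finset.card_compl, ZMod.card, Finset.card_fin] at this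
    have := g.support.card_le_univ
    rw [ZMod.card] at this
    omega
  have := Nat.card_congr (selfEquivOrbitsQuotientProd h)
  rw [Nat.card_prod, Nat.card_eq_fintype_card, Fintype.card_embedding_eq, ZMod.card,
    Fintype.card_fin] at this
  rw [this]
  exact Dvd.intro_left _ rfl

theorem card_dvd_of_not_alternatingGroup_le {H : Subgroup (Perm (ZMod 11))}
    (hH : Equiv.addRight 1 ∈ H) (hA : ¬ alternatingGroup (ZMod 11) ≤ H) :
    Nat.card H ∣ 1663200 :=
  card_dvd_descFactorial (k := 7) fun g hg h1 => by
    have := five_le_card_support hH hA hg h1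
    omega

theorem not_twentyFive_dvd_card {H : Subgroup (Perm (ZMod 11))}
    (hH : Equiv.addRight 1 ∈ H) (hA : ¬ alternatingGroup (ZMod 11) ≤ H) :
    ¬ 25 ∣ Nat.card H := by
  intro h
  have : Fact (Nat.Prime 5) := ⟨by norm_num⟩
  have key (g : Perm (ZMod 11)) (hg : g ∈ H) (h5 : orderOf g = 5) : 10 ≤ g.support.card := by
    by_contra! hlt
    have hcyc : g.IsCycle :=
      isCycle_of_prime_order (by rw [h5]; norm_num) (by rw [h5]; exact hlt)
    exact not_isCycle_card_support_eq_five hH hA hg hcyc (by rw [← hcyc.orderOf, h5])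
  obtain ⟨Q, hQ⟩ := Sylow.exists_subgroup_card_pow_prime (G := H) 5 (n := 2) h
  have hdvd : Nat.card (Q.map H.subtype) ∣ Nat.descFactorial 11 2 := by
    refine card_dvd_descFactorial ?_
    rintro _ ⟨g, hg, rfl⟩ h1
    simp only [Subgroup.subtype_apply] at h1 ⊢
    have hpow : (g : Perm (ZMod 11)) ^ 5 ^ 2 = 1 := by
      have : (⟨g, hg⟩ : Q) ^ Nat.card Q = 1 := pow_card_eq_one'
      rw [hQ] at this
      simpa [Subtype.ext_iff] using this
    by_cases h5 : (g : Perm (ZMod 11)) ^ 5 = 1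
    · have := key g g.2 (orderOf_eq_prime h5 h1)
      omega
    · have := key (g ^ 5) (H.pow_mem g.2 5) (orderOf_eq_prime (by rwa [← pow_mul]) h5)
      have := Finset.card_le_card (support_pow_le (g : Perm (ZMod 11)) 5)
      omega
  rw [Subgroup.card_map_of_injective H.subtype_injective, hQ] at hdvd
  revert hdvd
  decide

theorem dvd_card_of_seven_dvd_card {H : Subgroup (Perm (ZMod 11))}
    (hH : Equiv.addRight 1 ∈ H) (h7 : 7 ∣ Nat.card H) : 55440 ∣ Nat.card H := by
  have : Fact (Nat.Prime 7) := ⟨by norm_num⟩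
  obtain ⟨g, hg⟩ := exists_prime_orderOf_dvd_card' 7 h7
  rw [← Subgroup.orderOf_coe] at hg
  have hcyc : (g : Perm (ZMod 11)).IsCycle := by
    apply isCycle_of_prime_order'
    · rw [hg]; norm_num
    · rw [hg]; simp
  have hcard : (g : Perm (ZMod 11)).support.card = 7 := by rw [← hcyc.orderOf, hg]
  have : IsMultiplyPretransitive H (ZMod 11) (3 + 2) :=
    isMultiplyPretransitive_of_isCycle_mem (isPreprimitive_of_addRight_mem hH) g.2 hcyc
      (by rw [hcard]; norm_num) (by rw [hcard, ZMod.card])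
  exact descFactorial_dvd_card (k := 3 + 2) (by norm_num)

/-- Multiplication by a unit, as a permutation. -/
abbrev mulPerm : (ZMod 11)ˣ →* Perm (ZMod 11) := MulAction.toPermHom _ _

theorem mem_zpowers_addRight_one {g : Perm (ZMod 11)} :
    g ∈ Subgroup.zpowers (Equiv.addRight 1) ↔ ∃ b, g = Equiv.addRight b := by
  constructor
  · rintro ⟨n, rfl⟩
    exact ⟨n • 1, zsmul_addRight 1 n⟩
  · rintro ⟨b, rfl⟩
    exact addRight_mem (Subgroup.mem_zpowers _) b

theorem exists_eq_addRight_mul_mulPerm {g : Perm (ZMod 11)}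
    (hg : g * Equiv.addRight 1 * g⁻¹ ∈ Subgroup.zpowers (Equiv.addRight (1 : ZMod 11))) :
    ∃ b u, g = Equiv.addRight b * mulPerm u := by
  obtain ⟨k, hk⟩ := mem_zpowers_addRight_one.1 hg
  have hstep (x : ZMod 11) : g (x + 1) = g x + k := by
    rw [mul_inv_eq_iff_eq_mul] at hk
    exact DFunLike.congr_fun hk x
  have hlin (n : ℕ) : g n = g 0 + k * n := by
    induction n with
    | zero => simp
    | succ n ih => rw [Nat.cast_succ, hstep, ih]; ring
  have hk0 : k ≠ 0 := by
    rintro rfl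
    have := g.injective ((hstep 0).trans (add_zero _))
    simp at this
  refine ⟨g 0, Units.mk0 k hk0, ?_⟩
  ext x : 1
  rw [← ZMod.natCast_zmod_val x, hlin]
  simp [Units.smul_def, add_comm]

theorem addRight_mul_mulPerm_injective :
    Function.Injective fun p : ZMod 11 × (ZMod 11)ˣ => Equiv.addRight p.1 * mulPerm p.2 := by
  rintro ⟨b, u⟩ ⟨b', u'⟩ h
  have h0 := DFunLike.congr_fun h 0
  have h1 := DFunLike.congr_fun h 1
  simp [Units.smul_def] at h0 h1
  simp_all [Units.ext_iff]

theorem orderOf_addRight_one : orderOf (Equiv.addRight (1 : ZMod 11)) = 11 := by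
  refine orderOf_eq_prime ?_ ?_
  · rw [nsmul_addRight]
    ext x
    simp
    decide
  · intro h
    simpa using DFunLike.congr_fun h 0

theorem conj_addRight (b : ZMod 11) (u : (ZMod 11)ˣ) (x : ZMod 11) :
    (Equiv.addRight b * mulPerm u) * Equiv.addRight x * (Equiv.addRight b * mulPerm u)⁻¹ =
      Equiv.addRight (u * x) := by
  rw [mul_inv_eq_iff_eq_mul]
  ext y
  simp [Units.smul_def]
  ring_nf

theorem mem_normalizer_zpowers_iff {H : Subgroup (Perm (ZMod 11))} (hH : Equiv.addRight 1 ∈ H)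
    (g : H) : g ∈ Subgroup.normalizer (Subgroup.zpowers (⟨Equiv.addRight 1, hH⟩ : H) : Set H) ↔
      ∃ b u, (g : Perm (ZMod 11)) = Equiv.addRight b * mulPerm u := by
  have hz (x : H) : x ∈ Subgroup.zpowers (⟨Equiv.addRight 1, hH⟩ : H) ↔
      (x : Perm (ZMod 11)) ∈ Subgroup.zpowers (Equiv.addRight (1 : ZMod 11)) := by
    simp [Subgroup.mem_zpowers_iff, Subtype.ext_iff]
  rw [Subgroup.mem_normalizer_iff]
  constructor
  · intro h
    exact exists_eq_addRight_mul_mulPerm ((hz _).1 ((h ⟨_, hH⟩).1 (Subgroup.mem_zpowers _)))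
  · rintro ⟨b, u, hg⟩ x
    rw [hz, hz, mem_zpowers_addRight_one, mem_zpowers_addRight_one]
    simp only [Subgroup.coe_mul, Subgroup.coe_inv, hg]
    constructor
    · rintro ⟨y, hy⟩
      exact ⟨u * y, by rw [hy, conj_addRight]⟩
    · rintro ⟨y, hy⟩
      refine ⟨(u⁻¹ : (ZMod 11)ˣ) * y, ?_⟩
      have := conj_addRight b u ((u⁻¹ : (ZMod 11)ˣ) * y)
      rw [Units.mul_inv_cancel_left, ← hy] at this
      exact mul_left_cancel (mul_right_cancel this.symm)

theorem card_normalizer {H : Subgroup (Perm (ZMod 11))} (hH : Equiv.addRight 1 ∈ H) :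
    Nat.card (Subgroup.normalizer (Subgroup.zpowers (⟨Equiv.addRight 1, hH⟩ : H) : Set H)) =
      11 * Nat.card (H.comap mulPerm) := by
  suffices Nat.card (ZMod 11 × H.comap mulPerm) =
      Nat.card (Subgroup.normalizer (Subgroup.zpowers (⟨Equiv.addRight 1, hH⟩ : H) : Set H)) by
    rw [← this, Nat.card_prod, Nat.card_zmod]
  refine Nat.card_congr (Equiv.ofBijective (fun p => ⟨⟨Equiv.addRight p.1 * mulPerm p.2,
    H.mul_mem (addRight_mem hH _) p.2.2⟩,
      (mem_normalizer_zpowers_iff hH _).2 ⟨_, _, rfl⟩⟩) ⟨?_, ?_⟩)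
  · rintro ⟨b, u, hu⟩ ⟨b', u', hu'⟩ h
    have := @addRight_mul_mulPerm_injective (b, u) (b', u')
      (congrArg (fun x => ((x : H) : Perm (ZMod 11))) (congrArg Subtype.val h))
    simpa using this
  · rintro ⟨⟨g, hg⟩, hgN⟩
    obtain ⟨b, u, rfl⟩ := (mem_normalizer_zpowers_iff hH _).1 hgN
    refine ⟨(b, ⟨u, ?_⟩), rfl⟩
    exact (Subgroup.mul_mem_cancel_left H (addRight_mem hH b)).1 hg

/-- The Sylow subgroup generated by translation. -/
noncomputable def sylowTranslations {H : Subgroup (Perm (ZMod 11))} (hH : Equiv.addRight 1 ∈ H) :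
    Sylow 11 H :=
  Sylow.ofCard (Subgroup.zpowers ⟨Equiv.addRight 1, hH⟩) (by
    rw [Nat.card_zpowers, Subgroup.orderOf_mk, orderOf_addRight_one]
    have h1 : 11 ∣ Nat.card H := by
      have := orderOf_dvd_natCard (⟨_, hH⟩ : H)
      rwa [Subgroup.orderOf_mk, orderOf_addRight_one] at this
    have h2 : Nat.card H ∣ Nat.factorial 11 := by
      have := Subgroup.card_subgroup_dvd_card H
      rwa [Nat.card_perm, Nat.card_zmod] at this
    have h3 : (Nat.card H).factorization 11 = 1 := by
      apply le_antisymm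
      · by_contra! hlt
        have h4 : 11 ^ 2 ∣ Nat.card H :=
          (fact_prime_eleven.out.pow_dvd_iff_le_factorization Nat.card_pos.ne').2 hlt
        have := h4.trans h2
        revert this; decide
      · exact (fact_prime_eleven.out.dvd_iff_one_le_factorization Nat.card_pos.ne').1 h1
    rw [h3, pow_one])

theorem exists_card_eq_eleven_mul {H : Subgroup (Perm (ZMod 11))} (hH : Equiv.addRight 1 ∈ H) :
    ∃ n, Nat.card H = 11 * Nat.card (H.comap mulPerm) * n ∧ n % 11 = 1 := by
  refine ⟨Nat.card (Sylow 11 H), ?_, card_sylow_modEq_one 11 H⟩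
  rw [← card_normalizer hH, (sylowTranslations hH).card_eq_index_normalizer]
  exact (Subgroup.card_mul_index _).symm

theorem pow_five_eq_one_of_sign_mulPerm : ∀ u : (ZMod 11)ˣ, sign (mulPerm u) = 1 → u ^ 5 = 1 := by
  decide +kernel

theorem card_comap_mulPerm {H : Subgroup (Perm (ZMod 11))} (hA : H ≤ alternatingGroup (ZMod 11)) :
    Nat.card (H.comap mulPerm) = 1 ∨ Nat.card (H.comap mulPerm) = 5 := by
  have h10 : Nat.card (H.comap mulPerm) ∣ 10 := by
    have := Subgroup.card_subgroup_dvd_card (H.comap mulPerm)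
    rwa [Nat.card_eq_fintype_card (α := (ZMod 11)ˣ), ZMod.card_units] at this
  have h2 : ¬ 2 ∣ Nat.card (H.comap mulPerm) := by
    intro h
    obtain ⟨u, hu⟩ := exists_prime_orderOf_dvd_card' 2 h
    have h5 : (u : H.comap mulPerm) ^ 5 = 1 :=
      Subtype.ext (pow_five_eq_one_of_sign_mulPerm u (hA u.2))
    have := orderOf_dvd_of_pow_eq_one h5
    rw [hu] at this
    revert this; decide
  have := Nat.le_of_dvd (by norm_num) h10
  interval_cases Nat.card (H.comap mulPerm) <;> omega

theorem card_eq_eleven {H : Subgroup (Perm (ZMod 11))} (hH : Equiv.addRight 1 ∈ H)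
    (h1 : Nat.card (H.comap mulPerm) = 1) : Nat.card H = 11 := by
  have := isPreprimitive_of_addRight_mem hH
  let P := sylowTranslations hH
  have hcent : Subgroup.normalizer (P : Set H) ≤ Subgroup.centralizer (P : Set H) := by
    intro g hg
    obtain ⟨b, u, hbu⟩ := (mem_normalizer_zpowers_iff hH g).1 hg
    have hu : u ∈ H.comap mulPerm := by
      have := g.2
      rw [hbu] at this
      exact (Subgroup.mul_mem_cancel_left H (addRight_mem hH b)).1 this
    rw [Subgroup.eq_bot_of_card_eq _ h1, Subgroup.mem_bot] at hu
    rw [Subgroup.mem_centralizer_iff]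
    intro x hx
    obtain ⟨n, rfl⟩ : x ∈ Subgroup.zpowers (⟨Equiv.addRight 1, hH⟩ : H) := hx
    refine ((Commute.zpow_right ?_ n).eq).symm
    refine Subtype.ext ?_
    simp only [Subgroup.coe_mul, hbu, hu, map_one, mul_one]
    ext y
    simp [add_right_comm]
  let N := (MonoidHom.transferSylow P hcent).ker
  have hN : ¬ 11 ∣ Nat.card N := MonoidHom.not_dvd_card_ker_transferSylow P hcent
  have hfix : fixedPoints N (ZMod 11) = .univ := by
    by_contra hne
    have : IsPretransitive N (ZMod 11) := IsQuasiPreprimitive.isPretransitive_of_normal hne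
    have := index_stabilizer_of_transitive N (0 : ZMod 11)
    rw [Nat.card_zmod] at this
    have hdvd := (stabilizer N (0 : ZMod 11)).index_dvd_card
    rw [this] at hdvd
    exact hN hdvd
  have hbot : N = ⊥ := by
    rw [eq_bot_iff]
    intro g hg
    rw [Subgroup.mem_bot]
    ext x : 2
    have hx : x ∈ fixedPoints N (ZMod 11) := hfix ▸ Set.mem_univ x
    exact hx ⟨g, hg⟩
  have hcompl : Nat.card N * Nat.card P = Nat.card H :=
    (MonoidHom.ker_transferSylow_isComplement' P hcent).card_mul_card
  rw [hbot, Subgroup.card_bot, one_mul] at hcompl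
  rw [← hcompl]
  exact (Nat.card_zpowers _).trans (by rw [Subgroup.orderOf_mk, orderOf_addRight_one])

/-- The digit of index `i` of `T` in base 16; a map `t` on `{0, …, 10}` is encoded by
`∑ i, t i * 16 ^ i`. -/
def hexDigit (T i : ℕ) : ℕ := T / 16 ^ i % 16

/-- The map `x ↦ a + b * t (2 + t x)` modulo 11, where `T` encodes `t`. -/
def codedWord (T a b x : ℕ) : ℕ := (a + b * hexDigit T ((hexDigit T x + 2) % 11)) % 11

/-- Whether `0` has period 7 under `codedWord T a b` for some `a` and some nonzero `b`. -/
def hasSevenCycle (T : ℕ) : Bool :=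
  (List.range 11).any fun a => (List.range 10).any fun b =>
    !(codedWord T a (b + 1) 0 == 0) && (codedWord T a (b + 1))^[7] 0 == 0

/-- Test `hasSevenCycle` on all ways to complete the partial code `T` by a
fixed-point-free involution on the list. -/
def searchInvolutions : ℕ → List ℕ → ℕ → Bool
  | 0, _, _ => false
  | _ + 1, [], T => hasSevenCycle T
  | n + 1, x :: L, T => L.all fun y => searchInvolutions n (L.erase y) (T + y * 16 ^ x + x * 16 ^ y)

set_option maxRecDepth 100000 in
theorem searchInvolutions_eq_true :
    ∀ z ∈ List.range' 2 9,
      searchInvolutions 5 ((List.range' 2 9).erase z) (16 + z * 16 ^ z) = true := by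
  decide +kernel

theorem hasSevenCycle_of_searchInvolutions (t : ℕ → ℕ) {n : ℕ} {L : List ℕ} {T : ℕ}
    (hL : L.Nodup) (ht : ∀ x ∈ L, t x ∈ L ∧ t x ≠ x ∧ t (t x) = x)
    (hs : searchInvolutions n L T = true) :
    hasSevenCycle (T + (L.map fun x => t x * 16 ^ x).sum) = true := by
  induction n generalizing L T with
  | zero => simp [searchInvolutions] at hs
  | succ n ih =>
    cases L with
    | nil => simpa [searchInvolutions] using hs
    | cons x L =>
      obtain ⟨hx, hxx, htx⟩ := ht x (by simp)
      have hy : t x ∈ L := (List.mem_cons.1 hx).resolve_left hxx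
      have hxL : x ∉ L := (List.nodup_cons.1 hL).1
      have hLn : L.Nodup := (List.nodup_cons.1 hL).2
      simp only [searchInvolutions, List.all_eq_true] at hs
      have := ih (hLn.erase _) (fun y hyL => ?_) (hs _ hy)
      · have hsum := ((List.perm_cons_erase hy).map fun x => t x * 16 ^ x).sum_eq
        rw [List.map_cons, List.sum_cons, htx] at hsum
        rwa [List.map_cons, List.sum_cons, hsum, ← add_assoc, ← add_assoc]
      · rw [hLn.mem_erase_iff] at hyL ⊢
        obtain ⟨h1, h2, h3⟩ := ht y (by simp [hyL.2])
        have hne : t y ≠ x := fun e => hyL.1 (by rw [← h3, e])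
        refine ⟨⟨fun e => hxL ?_, ?_⟩, h2, h3⟩
        · have : y = x := by rw [← h3, e, htx]
          exact this ▸ hyL.2
        · exact (List.mem_cons.1 h1).resolve_left hne

theorem hexDigit_sum (t : ℕ → ℕ) (ht : ∀ i, t i < 16) {n i : ℕ} (hi : i < n) :
    hexDigit ((List.range n).map fun x => t x * 16 ^ x).sum i = t i := by
  have hlt (n : ℕ) : ((List.range n).map fun x => t x * 16 ^ x).sum < 16 ^ n := by
    induction n with
    | zero => simp
    | succ n ih =>
      rw [List.sum_range_succ, pow_succ']
      have := Nat.mul_le_mul_right (16 ^ n) (Nat.le_of_lt_succ (ht n))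
      omega
  induction n with
  | zero => omega
  | succ n ih =>
    rw [hexDigit, List.sum_range_succ]
    rcases (Nat.lt_succ_iff_lt_or_eq.1 hi) with h | rfl
    · obtain ⟨m, rfl⟩ := Nat.exists_eq_add_of_lt h
      rw [show t (i + m + 1) * 16 ^ (i + m + 1) = t (i + m + 1) * 16 ^ m * 16 * 16 ^ i by ring,
        Nat.add_mul_div_right _ _ (by positivity), Nat.add_mul_mod_self_right]
      exact ih h
    · rw [Nat.add_mul_div_right _ _ (by positivity), Nat.div_eq_of_lt (hlt i), zero_add,
        Nat.mod_eq_of_lt (ht i)]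

theorem hasSevenCycle_of_involution (t : ℕ → ℕ) (ht : ∀ i < 11, t i < 11)
    (htt : ∀ i < 11, t (t i) = i) {z : ℕ} (hz : z < 11) (h0 : t 0 = 0) (h1 : t 1 = 1)
    (h0z : z ≠ 0) (h1z : z ≠ 1) (hfix : ∀ i < 11, t i = i ↔ i = 0 ∨ i = 1 ∨ i = z) :
    hasSevenCycle ((List.range 11).map fun x => t x * 16 ^ x).sum = true := by
  have hzL : z ∈ List.range' 2 9 := by rw [List.mem_range'_1]; omega
  have hnd : (List.range' 2 9).Nodup := List.nodup_range'
  have hz' : t z = z := (hfix z hz).2 (by simp)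
  have := hasSevenCycle_of_searchInvolutions t (hnd.erase z) (fun x hx => ?_)
    (searchInvolutions_eq_true z hzL)
  · have hsum := ((List.perm_cons_erase hzL).map fun x => t x * 16 ^ x).sum_eq
    rw [List.map_cons, List.sum_cons, hz'] at hsum
    have hrange : List.range 11 = 0 :: 1 :: List.range' 2 9 := rfl
    rw [add_assoc, ← hsum] at this
    rwa [hrange, List.map_cons, List.map_cons, List.sum_cons, List.sum_cons, h0, h1, zero_mul,
      zero_add, one_mul, pow_one]
  · rw [hnd.mem_erase_iff, List.mem_range'_1] at hx ⊢
    obtain ⟨hxz, hx2, hx11⟩ := hx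
    have hx11 : x < 11 := hx11
    have hne : t x ≠ x := fun e => by have := (hfix x hx11).1 e; omega
    have htx := ht x hx11
    have key (y : ℕ) (hy : t y = y) : t x ≠ y := by
      intro e
      have := htt x hx11
      rw [e, hy] at this
      exact hne (e.trans this)
    have k0 := key 0 h0
    have k1 := key 1 h1
    exact ⟨⟨key z hz', by omega, by omega⟩, hne, htt x hx11⟩

/-- An involution of `ZMod 11` with exactly three fixed points, two of them `0` and `1`, generates
together with the affine maps a permutation having a cycle of length 7 through `0`. -/
theorem exists_iterate_seven_eq (t : Perm (ZMod 11)) (htt : t * t = 1) {z : ZMod 11}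
    (h0 : t 0 = 0) (h1 : t 1 = 1) (h0z : z ≠ 0) (h1z : z ≠ 1)
    (hfix : ∀ x, t x = x ↔ x = 0 ∨ x = 1 ∨ x = z) :
    ∃ (a : ZMod 11) (u : (ZMod 11)ˣ),
      let w := Equiv.addRight a * mulPerm u * t * Equiv.addRight 2 * t
      w 0 ≠ 0 ∧ (w ^ 7) 0 = 0 := by
  let t' : ℕ → ℕ := fun i => (t i).val
  have ht' (i : ℕ) : t' i < 11 := ZMod.val_lt _
  have hval (i : ℕ) (hi : i < 11) : ((i : ZMod 11)).val = i := ZMod.val_cast_of_lt hi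
  have hcast (i : ℕ) (hi : i < 11) (x : ZMod 11) : (i : ZMod 11) = x ↔ i = x.val := by
    constructor
    · rintro rfl; exact (hval i hi).symm
    · rintro rfl; exact ZMod.natCast_zmod_val x
  have hcode := hasSevenCycle_of_involution t' (z := z.val) (fun i _ => ht' i) (fun i hi => by
      simp only [t', ZMod.natCast_zmod_val]
      rw [← Perm.mul_apply, htt, Perm.one_apply, hval i hi])
    (ZMod.val_lt z) (by simp [t', h0]) (by simp [t', h1]; rfl)
    (by rwa [Ne, ZMod.val_eq_zero])
    (fun e => h1z (by rw [← ZMod.natCast_zmod_val z, e, Nat.cast_one]))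
    (fun i hi => by
      have : t' i = i ↔ t i = i := by
        rw [eq_comm (a := t i), hcast i hi, eq_comm]
      rw [this, hfix, hcast i hi, hcast i hi, hcast i hi, ZMod.val_zero]
      rfl)
  have hdig (i : ℕ) (hi : i < 11) := hexDigit_sum t' (fun i => (ht' i).trans (by norm_num)) hi
  simp only [hasSevenCycle, List.any_eq_true, List.mem_range, Bool.and_eq_true, beq_iff_eq,
    Bool.not_eq_true', beq_eq_false_iff_ne] at hcode
  obtain ⟨a, ha, b, hb, hw0, hw7⟩ := hcode
  have hb0 : ((b + 1 : ℕ) : ZMod 11) ≠ 0 := by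
    rw [Ne, ZMod.natCast_eq_zero_iff]
    exact fun h => by have := Nat.le_of_dvd (by omega) h; omega
  refine ⟨a, Units.mk0 _ hb0, ?_⟩
  intro w
  have hstep (x : ZMod 11) :
      codedWord ((List.range 11).map fun x => t' x * 16 ^ x).sum a (b + 1) x.val = (w x).val := by
    rw [codedWord, hdig _ (ZMod.val_lt x), hdig _ (Nat.mod_lt _ (by norm_num)),
      ← ZMod.val_natCast]
    congr 1
    simp [t', w, Units.smul_def]
    ring
  have hiter (n : ℕ) : (codedWord ((List.range 11).map fun x => t' x * 16 ^ x).sum a (b + 1))^[n] 0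
      = ((w ^ n) 0).val := by
    induction n with
    | zero => rfl
    | succ n ih => rw [Function.iterate_succ_apply', ih, hstep, pow_succ']; rfl
  refine ⟨fun h => hw0 ?_, ?_⟩
  · have := hstep 0
    rwa [h, ZMod.val_zero] at this
  · rw [hiter, ZMod.val_eq_zero] at hw7
    exact hw7

theorem card_support_eq_eight {H : Subgroup (Perm (ZMod 11))} (hH : Equiv.addRight 1 ∈ H)
    (hHA : H ≤ alternatingGroup (ZMod 11)) (hA : ¬ alternatingGroup (ZMod 11) ≤ H)
    {t : Perm (ZMod 11)} (ht : t ∈ H) (h2 : orderOf t = 2) : t.support.card = 8 := by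
  have h5 := five_le_card_support hH hA ht (by rintro rfl; simp at h2)
  obtain ⟨n, hn⟩ := cycleType_prime_order (σ := t) (by rw [h2]; norm_num)
  have hsign : sign t = 1 := hHA ht
  have hcard := t.sum_cycleType
  have hle := t.support.card_le_univ
  rw [hn, h2, Multiset.sum_replicate, smul_eq_mul] at hcard
  rw [sign_of_cycleType, hn, h2, Multiset.sum_replicate, Multiset.card_replicate,
    smul_eq_mul] at hsign
  rw [ZMod.card] at hle
  have : n = 2 ∨ n = 3 ∨ n = 4 := by omega
  rcases this with rfl | rfl | rfl
  · exact absurd hsign (by decide)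
  · omega
  · exact absurd hsign (by decide)

theorem seven_dvd_card {G : Subgroup (Perm (ZMod 11))} (hG : Equiv.addRight 1 ∈ G)
    (hU : ∀ u, mulPerm u ∈ G) {t : Perm (ZMod 11)} (ht : t ∈ G) (h2 : orderOf t = 2)
    (h8 : t.support.card = 8) : 7 ∣ Nat.card G := by
  have h3 : t.supportᶜ.card = 3 := by rw [Finset.card_compl, h8, ZMod.card]
  obtain ⟨x, y, z, hxy, hxz, hyz, hfix⟩ := Finset.card_eq_three.1 h3
  have hfix (a : ZMod 11) : t a = a ↔ a = x ∨ a = y ∨ a = z := by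
    simpa using Finset.ext_iff.1 hfix a
  let v : (ZMod 11)ˣ := Units.mk0 (y - x) (sub_ne_zero.2 hxy.symm)
  let g : Perm (ZMod 11) := Equiv.addRight x * mulPerm v
  have hg : g ∈ G := G.mul_mem (addRight_mem hG x) (hU v)
  have hg0 : g 0 = x := by simp [g]
  have hg1 : g 1 = y := by simp [g, v, Units.smul_def]
  have hconj (a : ZMod 11) : (g⁻¹ * t * g) a = a ↔ t (g a) = g a := by
    exact inv_eq_iff_eq (f := g)
  have htt : t * t = 1 := by rw [← pow_two, ← h2, pow_orderOf_eq_one]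
  have hcc : (g⁻¹ * t * g) * (g⁻¹ * t * g) = 1 := by
    rw [show g⁻¹ * t * g * (g⁻¹ * t * g) = g⁻¹ * (t * t) * g by
      simp only [mul_assoc, mul_inv_cancel_left], htt, mul_one, inv_mul_cancel]
  obtain ⟨a, u, hw0, hw7⟩ := exists_iterate_seven_eq (g⁻¹ * t * g) (z := g⁻¹ z) hcc
    (by rw [hconj, hg0, hfix]; simp) (by rw [hconj, hg1, hfix]; simp)
    (fun e => hxz (by rw [← hg0, ← e]; simp)) (fun e => hyz (by rw [← hg1, ← e]; simp))
    (fun a => by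
      rw [hconj, hfix, ← hg0, ← hg1, g.injective.eq_iff, g.injective.eq_iff, eq_inv_iff_eq])
  set w := Equiv.addRight a * mulPerm u * (g⁻¹ * t * g) * Equiv.addRight 2 * (g⁻¹ * t * g)
  have htG : g⁻¹ * t * g ∈ G := G.mul_mem (G.mul_mem (G.inv_mem hg) ht) hg
  have hwG : w ∈ G := G.mul_mem (G.mul_mem (G.mul_mem (G.mul_mem (addRight_mem hG a) (hU u))
    htG) (addRight_mem hG 2)) htG
  have : Fact (Nat.Prime 7) := ⟨by norm_num⟩
  have hper : Function.minimalPeriod w 0 = 7 :=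
    Function.minimalPeriod_eq_prime
      (by rwa [Function.IsPeriodicPt, Function.IsFixedPt, ← Perm.coe_pow]) hw0
  rw [← hper]
  refine (Function.IsPeriodicPt.minimalPeriod_dvd ?_).trans (Subgroup.orderOf_dvd_natCard G hwG)
  rw [Function.IsPeriodicPt, ← Perm.coe_pow, pow_orderOf_eq_one]
  rfl

theorem sylow_count_eq {n m : ℕ} (hm : m = 55 * n) (hn : n % 11 = 1) (h : m ∣ 1663200)
    (h25 : ¬ 25 ∣ m) (h7 : 7 ∣ m → 55440 ∣ m) : n = 1 ∨ n = 12 ∨ n = 144 := by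
  subst hm
  have h1 : n ∣ 5 * 6048 := Nat.dvd_of_mul_dvd_mul_left (k := 55) (by norm_num) h
  have h5 : ¬ 5 ∣ n := fun h => h25 (by omega)
  have h2 : n ∣ 6048 :=
    Nat.Coprime.dvd_of_dvd_mul_left ((Nat.Prime.coprime_iff_not_dvd (by norm_num)).2 h5).symm h1
  by_cases h7n : 7 ∣ n
  · obtain ⟨k, hk⟩ := h7 (h7n.mul_left _)
    have : n = 1008 * k := by omega
    subst this
    have : k ∣ 6 := Nat.dvd_of_mul_dvd_mul_left (k := 1008) (by norm_num) h2
    have := Nat.le_of_dvd (by norm_num) this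
    interval_cases k <;> omega
  · have h3 : n ∣ 864 := Nat.Coprime.dvd_of_dvd_mul_left
      (m := 7) ((Nat.Prime.coprime_iff_not_dvd (by norm_num)).2 h7n).symm h2
    have hlt := Nat.le_of_dvd (by norm_num) h3
    clear * - h3 hn hlt
    have : ∀ n < 865, n ∣ 864 → n % 11 = 1 → n = 1 ∨ n = 12 ∨ n = 144 := by decide +kernel
    exact this n (by omega) h3 hn

theorem card_cases {g k a m n : ℕ} (hg : g = k ∨ g = 2 * k) (h2 : 2 ∣ g) (hk : k = 55 * n)
    (hg' : g = 11 * a * m) (hm : m % 11 = 1) (hn : n % 11 = 1) (ha : a ∣ 10) (ha5 : 5 ∣ a)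
    (hn' : n = 1 ∨ n = 12 ∨ n = 144) :
    g = 110 ∨ g = 660 ∨ g = 7920 ∨ a = 10 ∧ 2 ∣ k ∧ ¬ 7 ∣ g := by
  obtain ⟨b, rfl⟩ := ha5
  have hb : b ∣ 2 := Nat.dvd_of_mul_dvd_mul_left (k := 5) (by norm_num) ha
  rw [Nat.dvd_prime Nat.prime_two] at hb
  subst hk
  rcases hb with rfl | rfl <;> rcases hg with rfl | rfl <;> rcases hn' with rfl | rfl | rfl <;>
    norm_num at * <;> omega

/-- The orders of the groups of even order that act on `ZMod 11` and contain the translations. -/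
theorem card_of_addRight_one_mem {G : Subgroup (Perm (ZMod 11))} (hG : Equiv.addRight 1 ∈ G)
    (h2 : 2 ∣ Nat.card G) : Nat.card G ∈ ({22, 110, 660, 7920, 19958400, 39916800} : Set ℕ) := by
  obtain ⟨A, hAdef⟩ : ∃ A, A = alternatingGroup (ZMod 11) := ⟨_, rfl⟩
  simp only [Set.mem_insert_iff, Set.mem_singleton_iff]
  by_cases hA : A ≤ G
  · have hcA : Nat.card A = 19958400 := by
      have := two_mul_nat_card_alternatingGroup (α := ZMod 11)
      rw [← hAdef, Nat.card_perm, Nat.card_zmod, show Nat.factorial 11 = 39916800 by rfl] at this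
      omega
    have h1 := Subgroup.card_dvd_of_le hA
    have h3 := Subgroup.card_subgroup_dvd_card G
    rw [Nat.card_perm, Nat.card_zmod, show Nat.factorial 11 = 39916800 by rfl] at h3
    rw [hcA] at h1
    obtain ⟨k, hk⟩ := h1
    rw [hk] at h3
    have : k ∣ 2 := Nat.dvd_of_mul_dvd_mul_left (k := 19958400) (by norm_num) h3
    have := Nat.le_of_dvd (by norm_num) this
    interval_cases k <;> omega
  have hcA : Equiv.addRight (1 : ZMod 11) ∈ A := by
    have : (Equiv.addRight (1 : ZMod 11)) = Equiv.addRight 6 ^ 2 := by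
      rw [nsmul_addRight]; rfl
    rw [this, hAdef, mem_alternatingGroup, map_pow, Int.units_sq]
  obtain ⟨K, hKdef⟩ : ∃ K, K = G ⊓ A := ⟨_, rfl⟩
  have hKG : K ≤ G := hKdef ▸ inf_le_left
  have hKA' : K ≤ A := hKdef ▸ inf_le_right
  have hK : Equiv.addRight 1 ∈ K := hKdef ▸ ⟨hG, hcA⟩
  have hKA : ¬ A ≤ K := fun h => hA (h.trans hKG)
  have hindex : Nat.card G = Nat.card K ∨ Nat.card G = 2 * Nat.card K := by
    have h1 := Subgroup.relIndex_inf_mul_relIndex ⊥ A G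
    rw [bot_inf_eq, Subgroup.relIndex_bot_left, Subgroup.relIndex_bot_left, inf_comm, ← hKdef] at h1
    have h3 : A.relIndex G ∣ 2 := by
      rw [hAdef, ← alternatingGroup.index_eq_two (α := ZMod 11)]
      exact Subgroup.relIndex_dvd_index_of_normal _ _
    rcases (Nat.dvd_prime Nat.prime_two).1 h3 with h | h <;> rw [h] at h1
    · left; omega
    · right; omega
  subst hAdef
  clear hKdef
  obtain ⟨n, hn, hn1⟩ := exists_card_eq_eleven_mul hK
  obtain ⟨m, hm, hm1⟩ := exists_card_eq_eleven_mul hG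
  have hU10 : Nat.card (G.comap mulPerm) ∣ 10 := by
    have := Subgroup.card_subgroup_dvd_card (G.comap mulPerm)
    rwa [Nat.card_eq_fintype_card (α := (ZMod 11)ˣ), ZMod.card_units] at this
  rcases card_comap_mulPerm hKA' with h1 | h5
  · have := card_eq_eleven hK h1
    omega
  rw [h5] at hn
  have hn3 := sylow_count_eq hn hn1 (card_dvd_of_not_alternatingGroup_le hK hKA)
    (not_twentyFive_dvd_card hK hKA)
    (dvd_card_of_seven_dvd_card hK)
  have h5U : 5 ∣ Nat.card (G.comap mulPerm) := by
    rw [← h5]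
    exact Subgroup.card_dvd_of_le (Subgroup.comap_mono hKG)
  rcases card_cases hindex h2 hn hm hm1 hn1 hU10 h5U hn3 with h | h | h | ⟨hUcard, h2K, h7⟩
  · exact Or.inr (Or.inl h)
  · exact Or.inr (Or.inr (Or.inl h))
  · exact Or.inr (Or.inr (Or.inr (Or.inl h)))
  exfalso
  have hU (u : (ZMod 11)ˣ) : mulPerm u ∈ G := by
    have : G.comap mulPerm = ⊤ := by
      apply Subgroup.eq_top_of_card_eq
      rw [hUcard, Nat.card_eq_fintype_card, ZMod.card_units]
    have hu : u ∈ G.comap mulPerm := this ▸ Subgroup.mem_top u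
    exact hu
  obtain ⟨t, ht⟩ := exists_prime_orderOf_dvd_card' 2 h2K
  rw [← Subgroup.orderOf_coe] at ht
  exact h7 (seven_dvd_card hG hU (hKG t.2) ht (card_support_eq_eight hK hKA' hKA t.2 ht))

theorem exists_permCongrHom_eq_addRight_one {α : Type*} [Fintype α] (hα : Fintype.card α = 11)
    {σ : Perm α} (hσ : orderOf σ = 11) :
    ∃ e : α ≃ ZMod 11, e.permCongrHom σ = Equiv.addRight 1 := by
  have hcyc {τ : Perm (ZMod 11)} (hτ : orderOf τ = 11) : τ.cycleType = {11} := by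
    have := isCycle_of_prime_order'' (σ := τ) (by rw [ZMod.card]; norm_num)
      (by rw [hτ, ZMod.card])
    rw [this.cycleType, ← this.orderOf, hτ]
  let e₀ : α ≃ ZMod 11 := Fintype.equivOfCardEq (by rw [hα, ZMod.card])
  have h₀ : orderOf (e₀.permCongrHom σ) = 11 := by rw [MulEquiv.orderOf_eq, hσ]
  obtain ⟨τ, hτ⟩ := isConj_iff.1
    (isConj_of_cycleType_eq ((hcyc h₀).trans (hcyc orderOf_addRight_one).symm))
  exact ⟨e₀.trans τ, by rw [← hτ]; rfl⟩

/-- The orders of the groups of even order acting transitively and faithfully on 11 points. -/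
theorem card_of_injective_perm {G α : Type*} [Group G] [Fintype α] (hα : Fintype.card α = 11)
    (φ : G →* Perm α) (hφ : Function.Injective φ) (h11 : 11 ∣ Nat.card G) (h2 : 2 ∣ Nat.card G) :
    Nat.card G ∈ ({22, 110, 660, 7920, 19958400, 39916800} : Set ℕ) := by
  have : Finite G := Finite.of_injective φ hφ
  obtain ⟨g, hg⟩ := exists_prime_orderOf_dvd_card' 11 h11
  obtain ⟨e, he⟩ := exists_permCongrHom_eq_addRight_one hα ((orderOf_injective φ hφ g).trans hg)
  let ψ : G →* Perm (ZMod 11) := e.permCongrHom.toMonoidHom.comp φ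
  have hψ : Function.Injective ψ := e.permCongrHom.injective.comp hφ
  have hcard : Nat.card ψ.range = Nat.card G :=
    (Nat.card_congr (MonoidHom.ofInjective hψ).toEquiv).symm
  rw [← hcard] at h2 ⊢
  exact card_of_addRight_one_mem ⟨g, he⟩ h2

theorem Polynomial.card_rootSet_complex_eq_natDegree {f : ℚ[X]} (hf : f.Separable) :
    Fintype.card (f.rootSet ℂ) = f.natDegree := by
  simp_rw [rootSet_def, Finset.coe_sort_coe, Fintype.card_coe]
  rw [Multiset.toFinset_card_of_nodup, ← Splits.natDegree_eq_card_roots, natDegree_map]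
  · exact IsAlgClosed.splits _
  · exact nodup_roots ((separable_map (algebraMap ℚ ℂ)).mpr hf)

theorem Polynomial.Gal.two_dvd_card_of_nonreal_root_s12 {f : ℚ[X]} {z : ℂ} (hz : z ∈ f.rootSet ℂ)
    (him : z.im ≠ 0) : 2 ∣ Nat.card f.Gal := by
  have := Polynomial.Gal.splits_ℚ_ℂ (p := f)
  let c := restrict f ℂ (Complex.conjAe.restrictScalars ℚ)
  have hc2 : c ^ 2 = 1 := by
    rw [← map_pow, show AlgEquiv.restrictScalars ℚ Complex.conjAe ^ 2 = 1 from
      AlgEquiv.ext Complex.conj_conj, map_one]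
  have hc1 : c ≠ 1 := by
    intro h
    have := galActionHom_restrict f ℂ (Complex.conjAe.restrictScalars ℚ) ⟨z, hz⟩
    rw [show restrict f ℂ (Complex.conjAe.restrictScalars ℚ) = 1 from h, map_one] at this
    exact him (Complex.conj_eq_iff_im.1 this.symm)
  rw [← orderOf_eq_prime hc2 hc1]
  exact orderOf_dvd_natCard c

end

/-- An irreducible polynomial over ℚ of degree 11 with a non-real complex root has Galois
group of one of the listed orders (corresponding to the finitely many possible groups). -/
theorem galois_group_card_of_degree_11_with_nonreal_root
    (f : ℚ[X]) (hdeg : f.natDegree = 11) (hirr : Irreducible f)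
    (hroot : ∃ z : ℂ, aeval z f = 0 ∧ z.im ≠ 0) :
    Nat.card f.Gal = 22 ∨ Nat.card f.Gal = 110 ∨ Nat.card f.Gal = 660 ∨ Nat.card f.Gal = 7920 ∨ Nat.card f.Gal = 19958400 ∨ Nat.card f.Gal = 39916800 := by
  obtain ⟨z, hz, him⟩ := hroot
  have := Gal.splits_ℚ_ℂ (p := f)
  have h11 : 11 ∣ Nat.card f.Gal := by
    rw [← hdeg]
    exact Gal.prime_degree_dvd_card hirr (by rw [hdeg]; norm_num)
  simpa using card_of_injective_perm
    ((card_rootSet_complex_eq_natDegree hirr.separable).trans hdeg)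
    (Gal.galActionHom f ℂ) (Gal.galActionHom_injective f ℂ) h11
    (Gal.two_dvd_card_of_nonreal_root_s12 (mem_rootSet.2 ⟨hirr.ne_zero, hz⟩) him)
end

section
/- Let f ∈ ℚ[x] be an irreducible polynomial of degree 13 that has at least one non-real complex root. Then the order of the Galois group of f over ℚ is one of 26, 52, 78, 156, 5616, 3113510400, or 6227020800 (these orders correspond to the dihedral group D_13, the Frobenius groups of orders 52, 78 and 156, PSL(3,3), A_13, and S_13, which are the only possible Galois groups in this situation). -/
namespace PermThirteen

/-! ### Packed permutations

A self-map `τ` of `{0, …, 12}` is packed into the natural number whose base-`128` digits are the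
`7 * τ x`.  The definitions are written with raw recursors and `Nat` primitives, so that the kernel
evaluates them quickly; `force` makes it evaluate an argument before passing it on. -/

/-- The seven-bit field of `P` starting at bit `x`. -/
def look (P x : ℕ) : ℕ := Nat.land (Nat.shiftRight P x) 127

def addShift (a b k : ℕ) : ℕ := Nat.add a (Nat.shiftLeft b k)

/-- The number whose thirteen seven-bit fields are `h 0, h 7, …, h 84`. -/
def pack (h : ℕ → ℕ) : ℕ :=
  addShift (h 0) (addShift (h 7) (addShift (h 14) (addShift (h 21) (
  addShift (h 28) (addShift (h 35) (addShift (h 42) (addShift (h 49) (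
  addShift (h 56) (addShift (h 63) (addShift (h 70) (
  addShift (h 77) (h 84) 7) 7) 7) 7) 7) 7) 7) 7) 7) 7) 7) 7

/-- The number of `x < 13` with `h (7 * x) = 7 * x`. -/
def fixCount (h : ℕ → ℕ) : ℕ :=
  Nat.rec 0 (fun x ih => Nat.add (Nat.sub 1 (Nat.xor (h (Nat.mul 7 x)) (Nat.mul 7 x))) ih) 13

def force (n : ℕ) (k : ℕ → Bool) : Bool := Nat.rec false (fun m _ => k m) (Nat.add n 1)

/-- Whether the twelfth power of the packed map `P` has between 6 and 12 fixed points. -/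
def fewMoved (P : ℕ) : Bool :=
  force (pack fun x => look P (look P (look P x))) fun U =>
  force (fixCount fun x => look U (look U (look U (look U x)))) fun F =>
  cond (Nat.ble 6 F) (Nat.ble F 12) false

/-- Whether `fewMoved` holds for one of the first `n` rotations of the doubled table `Q`. -/
def anyRotation (Q n : ℕ) : Bool :=
  Nat.rec false (fun j ih => cond (force (Nat.shiftRight Q (Nat.mul 7 j)) fewMoved) true ih) n

def double (P : ℕ) : ℕ := addShift P P 91

def anyProduct (P R n : ℕ) : Bool :=
  Nat.rec false (fun i ih =>
    cond (force (Nat.mul 7 i) fun i' =>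
      force (double (pack fun x => look R (Nat.add (look P x) i'))) fun Q => anyRotation Q 13)
    true ih) n

/-- The packed table of inverses modulo `13`. -/
def invTable : ℕ := 233025202128781279823511680

/-- Whether the packed involution `P` is normalized, in the sense of `midpointImage`. -/
def normalized (P : ℕ) : Bool :=
  force (look P 49) fun v =>
  Nat.rec true (fun a ih =>
    cond (force (Nat.mul 7 a) fun a => force (look P a) fun y => cond (Nat.beq a y) true
      (Nat.ble v (Nat.mod (Nat.mul
        (Nat.mod (Nat.sub (Nat.add (look P (Nat.mod (Nat.mul 7 (Nat.add a y)) 91)) 91) a) 91)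
        (look invTable (Nat.mod (Nat.sub (Nat.add y 91) a) 91))) 91)))
    ih false) 13

def leaf (bad : ℕ → Bool) (P : ℕ) : Bool :=
  cond (normalized P)
    (force (double P) fun R =>
      cond (anyRotation R 7) true (cond (anyProduct P R 7) true (bad P)))
    true

/-- The images of `i` among the points of `post`, in the search `allInvolutions`. -/
def allImages (go : List ℕ → ℕ → Bool) (i P : ℕ) (post : List ℕ) : List ℕ → Bool :=
  List.rec (fun _ => true) (fun j r ih pre =>
    cond (force (addShift (addShift P i j) j i)
      fun Q => go (pre ++ r) Q) (ih (pre ++ [j])) false) post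

/-- Whether `good` holds for every extension of the partial packed involution `P` to the points
in a list. -/
def allInvolutions (good : ℕ → Bool) (fuel : ℕ) : List ℕ → ℕ → Bool :=
  Nat.rec (fun _ _ => false) (fun _ ih L => List.rec (fun P => good P) (fun i r _ P =>
    cond (force (addShift P i i) fun Q => ih r Q) (allImages ih i P r []) false) L)
    fuel

/-- Whether `P` is the packed form of one of the five exceptional involutions. -/
def exceptional (P : ℕ) : Bool :=
  cond (Nat.beq P 274006196307818685683531783) true <|
  cond (Nat.beq P 1633300689635030617239076871) true <|
  cond (Nat.beq P 1502173557400357302784770055) true <|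
  cond (Nat.beq P 1230316554386793177472172039) true <|
  cond (Nat.beq P 282501993866705697666039815) true <| false

set_option maxHeartbeats 4000000 in
set_option maxRecDepth 100000 in
theorem allInvolutions_leaf {k : ℕ} (hk : 2 ≤ k) (hk' : k < 13) :
    allInvolutions (leaf exceptional) 14
      ([14, 21, 28, 35, 42, 49, 56, 63, 70, 77, 84].filter fun x => x ≠ 7 * k ∧ x ≠ 49)
      (if k = 7 then 7 + 49 <<< 49 else 7 + 49 <<< (7 * k) + (7 * k) <<< 49) = true := by
  interval_cases k <;> decide +kernel

theorem force_eq (n : ℕ) (k : ℕ → Bool) : force n k = k n := rfl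

theorem addShift_eq (a b k : ℕ) : addShift a b k = a + b * 2 ^ k := by
  rw [← Nat.shiftLeft_eq]; rfl

theorem look_eq (P x : ℕ) : look P x = P / 2 ^ x % 128 := by
  rw [← Nat.shiftRight_eq_div_pow]
  exact Nat.and_two_pow_sub_one_eq_mod (P >>> x) 7

theorem look_shiftRight (P i x : ℕ) : look (Nat.shiftRight P i) x = look P (i + x) := by
  rw [look_eq, look_eq, show Nat.shiftRight P i = P >>> i from rfl, Nat.shiftRight_eq_div_pow,
    Nat.div_div_eq_div_mul, pow_add]

theorem pack_eq (h : ℕ → ℕ) : pack h = ∑ x ∈ Finset.range 13, h (7 * x) * 2 ^ (7 * x) := by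
  simp only [pack, addShift_eq, Finset.sum_range_succ, Finset.sum_range_zero, pow_mul,
    Nat.reduceMul]
  generalize 2 ^ 7 = b
  ring

theorem sum_lt_and_digit (h : ℕ → ℕ) (n : ℕ) (hh : ∀ x < n, h x < 128) :
    ∑ x ∈ Finset.range n, h x * 2 ^ (7 * x) < 2 ^ (7 * n) ∧
      ∀ x < n, look (∑ x ∈ Finset.range n, h x * 2 ^ (7 * x)) (7 * x) = h x := by
  induction n with
  | zero => simp
  | succ n ih =>
    obtain ⟨h1, h2⟩ := ih fun x hx => hh x (by lia)
    have hn := hh n (by lia)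
    rw [Finset.sum_range_succ]
    refine ⟨?_, fun x hx => ?_⟩
    · rw [show 7 * (n + 1) = 7 * n + 7 by ring, pow_add]
      nlinarith [Nat.mul_le_mul_right (2 ^ (7 * n)) (show h n ≤ 127 by lia)]
    · rw [look_eq]
      obtain hx | rfl := Nat.lt_succ_iff_lt_or_eq.1 hx
      · rw [← h2 x hx, look_eq]
        have : (2 : ℕ) ^ (7 * n) = 2 ^ (7 * x) * (128 * 2 ^ (7 * (n - x - 1))) := by
          rw [show (128 : ℕ) = 2 ^ 7 by norm_num, ← pow_add, ← pow_add]
          congr 1; lia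
        rw [this, show ∀ a b c : ℕ, a * (b * (128 * c)) = b * (128 * (a * c)) by intros; ring,
          Nat.add_mul_div_left _ _ (by positivity), Nat.add_mul_mod_self_left]
      · rw [Nat.add_mul_div_right _ _ (by positivity), Nat.div_eq_of_lt h1]
        lia

theorem pack_lt {h : ℕ → ℕ} (hh : ∀ x < 13, h (7 * x) < 128) : pack h < 2 ^ 91 := by
  rw [pack_eq]
  exact (sum_lt_and_digit (fun x => h (7 * x)) 13 hh).1

theorem look_pack {h : ℕ → ℕ} (hh : ∀ x < 13, h (7 * x) < 128) {x : ℕ} (hx : x < 13) :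
    look (pack h) (7 * x) = h (7 * x) := by
  rw [pack_eq]
  exact (sum_lt_and_digit (fun x => h (7 * x)) 13 hh).2 x hx

theorem fixCount_eq (h : ℕ → ℕ) :
    fixCount h = ((Finset.range 13).filter fun x => h (7 * x) = 7 * x).card := by
  rw [Finset.card_filter, fixCount]
  generalize 13 = n
  induction n with
  | zero => rfl
  | succ n ih =>
    rw [Finset.sum_range_succ, ← ih, add_comm _ (ite _ _ _)]
    change (1 - (h (7 * n) ^^^ (7 * n))) + _ = _
    congr 1
    split_ifs with h1
    · simp [h1]
    · have : h (7 * n) ^^^ (7 * n) ≠ 0 := by simpa [Nat.xor_eq_zero_iff] using h1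
      lia

/-- `P` is the packed form of `τ`. -/
def Encodes (P : ℕ) (τ : ZMod 13 → ZMod 13) : Prop :=
  ∀ x : ZMod 13, look P (7 * x.val) = 7 * (τ x).val

theorem encodes_pack {h : ℕ → ℕ} {τ : ZMod 13 → ZMod 13}
    (hh : ∀ x : ZMod 13, h (7 * x.val) = 7 * (τ x).val) :
    Encodes (pack h) τ ∧ pack h < 2 ^ 91 := by
  have h1 : ∀ x < 13, h (7 * x) < 128 := fun x hx => by
    have h2 := hh x
    have := ZMod.val_lt (τ x)
    rw [ZMod.val_cast_of_lt hx] at h2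
    lia
  exact ⟨fun x => by rw [look_pack h1 (ZMod.val_lt x), hh], pack_lt h1⟩

theorem Encodes.card_fixed_of_fewMoved {P : ℕ} {τ : ZMod 13 → ZMod 13} (hP : Encodes P τ)
    (h : fewMoved P = true) :
    6 ≤ (Finset.univ.filter fun x => τ^[12] x = x).card ∧
      (Finset.univ.filter fun x => τ^[12] x = x).card ≤ 12 := by
  have h3 : Encodes (pack fun x => look P (look P (look P x))) τ^[3] :=
    (encodes_pack fun x => by simp only [hP _]; rfl).1
  have key : fixCount (fun x => look (pack fun x => look P (look P (look P x)))
      (look (pack fun x => look P (look P (look P x)))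
      (look (pack fun x => look P (look P (look P x)))
      (look (pack fun x => look P (look P (look P x))) x)))) =
      (Finset.univ.filter fun x => τ^[12] x = x).card := by
    rw [fixCount_eq]
    refine (Finset.card_bij (fun x _ => x.val) (fun x hx => ?_) (fun x _ y _ hxy => ?_)
      (fun x hx => ?_)).symm
    · simp only [Finset.mem_filter, Finset.mem_univ, true_and, Finset.mem_range, h3 _] at hx ⊢
      refine ⟨ZMod.val_lt x, ?_⟩
      conv_rhs => rw [← hx]
      rfl
    · exact ZMod.val_injective 13 hxy
    · simp only [Finset.mem_filter, Finset.mem_univ, true_and, Finset.mem_range] at hx ⊢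
      have hv : ((x : ZMod 13)).val = x := ZMod.val_cast_of_lt hx.1
      refine ⟨(x : ZMod 13), ZMod.val_injective 13 ?_, hv⟩
      have := hx.2
      rw [← hv] at this
      simp only [h3 _] at this
      rw [hv] at this ⊢
      have h7 := Nat.eq_of_mul_eq_mul_left (by norm_num) this
      conv_rhs => rw [← h7]
      rfl
  have : fewMoved P = cond (Nat.ble 6 (Finset.univ.filter fun x => τ^[12] x = x).card)
      (Nat.ble (Finset.univ.filter fun x => τ^[12] x = x).card 12) false := by
    rw [← key]; rfl
  rw [this] at h
  simpa using h

theorem look_addShift_of_le {N y : ℕ} (P Q : ℕ) (h : y + 7 ≤ N) :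
    look (addShift P Q N) y = look P y := by
  rw [addShift_eq, look_eq, look_eq]
  have : (2 : ℕ) ^ N = 2 ^ y * (128 * 2 ^ (N - y - 7)) := by
    rw [show (128 : ℕ) = 2 ^ 7 by norm_num, ← pow_add, ← pow_add]
    congr 1; lia
  rw [this, show ∀ a b c : ℕ, a * (b * (128 * c)) = b * (128 * (a * c)) by intros; ring,
    Nat.add_mul_div_left _ _ (by positivity), Nat.add_mul_mod_self_left]

theorem look_addShift_add {N P : ℕ} (Q y : ℕ) (h : P < 2 ^ N) :
    look (addShift P Q N) (N + y) = look Q y := by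
  rw [addShift_eq, look_eq, look_eq, pow_add, ← Nat.div_div_eq_div_mul,
    Nat.add_mul_div_right _ _ (by positivity), Nat.div_eq_of_lt h, zero_add]

theorem look_double {P : ℕ} {τ : ZMod 13 → ZMod 13} (hP : Encodes P τ) (h : P < 2 ^ 91)
    (x y : ZMod 13) : look (double P) (7 * x.val + 7 * y.val) = 7 * (τ (x + y)).val := by
  have hx := ZMod.val_lt x
  have hy := ZMod.val_lt y
  rw [← hP, double]
  obtain h2 | h2 := lt_or_ge (x.val + y.val) 13
  · rw [ZMod.val_add_of_lt h2, ← mul_add, look_addShift_of_le _ _ (by lia)]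
  · rw [ZMod.val_add_of_le h2, show 7 * x.val + 7 * y.val = 91 + 7 * (x.val + y.val - 13) by lia,
      look_addShift_add _ _ h]

theorem anyRotation_succ (Q n : ℕ) : anyRotation Q (n + 1) =
    cond (fewMoved (Nat.shiftRight Q (7 * n))) true (anyRotation Q n) := by
  change cond (force _ fewMoved) _ _ = _
  rw [force_eq]; rfl

theorem Encodes.exists_rotation {P : ℕ} {τ : ZMod 13 → ZMod 13} (hP : Encodes P τ)
    (hlt : P < 2 ^ 91)
    {n : ℕ} (hn : n ≤ 13) (h : anyRotation (double P) n = true) :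
    ∃ j : ZMod 13, Encodes (Nat.shiftRight (double P) (7 * j.val)) (fun x => τ (x + j)) ∧
      fewMoved (Nat.shiftRight (double P) (7 * j.val)) = true := by
  induction n with
  | zero => simp [anyRotation] at h
  | succ n ih =>
    by_cases h1 : fewMoved (Nat.shiftRight (double P) (7 * n)) = true
    · have hv : ((n : ZMod 13)).val = n := ZMod.val_cast_of_lt (by lia)
      refine ⟨n, fun x => ?_, by rwa [hv]⟩
      rw [look_shiftRight, add_comm, look_double hP hlt]
    · refine ih (by lia) ?_
      rwa [anyRotation_succ, Bool.eq_false_of_not_eq_true h1, cond_false] at h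

theorem Encodes.exists_product {P : ℕ} {τ : ZMod 13 → ZMod 13} (hP : Encodes P τ) (hlt : P < 2 ^ 91)
    {n : ℕ} (hn : n ≤ 13) (h : anyProduct P (double P) n = true) :
    ∃ i : ZMod 13, ∃ Q < 2 ^ 91, Encodes Q (fun x => τ (τ x + i)) ∧
      anyRotation (double Q) 13 = true := by
  induction n with
  | zero => simp [anyProduct] at h
  | succ n ih =>
    by_cases h1 : anyRotation
        (double (pack fun x => look (double P) (look P x + 7 * n))) 13 = true
    · have hv : ((n : ZMod 13)).val = n := ZMod.val_cast_of_lt (by lia)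
      have := encodes_pack (h := fun x => look (double P) (look P x + 7 * n))
        (τ := fun x => τ (τ x + n)) (fun x => by
          have := look_double hP hlt (τ x) n
          rwa [hv, ← hP x] at this)
      exact ⟨n, _, this.2, this.1, h1⟩
    · refine ih (by lia) ?_
      have h2 : anyProduct P (double P) (n + 1) =
        cond (anyRotation
          (double (pack fun x => look (double P) (look P x + 7 * n))) 13) true
          (anyProduct P (double P) n) := rfl
      rw [h2] at h
      simpa [h1] using h

/-- The image of the midpoint of `a` and `t a`, in the affine coordinate in which `a` and `t a`
are `0` and `1`. -/
def midpointImage (t : ZMod 13 → ZMod 13) (a : ZMod 13) : ℕ :=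
  ((t (7 * (a + t a)) - a) * (t a - a) ^ 11).val

theorem Encodes.normalized {P : ℕ} {t : ZMod 13 → ZMod 13} (hP : Encodes P t)
    (h : ∀ a, t a ≠ a → (t 7).val ≤ midpointImage t a) : normalized P = true := by
  have h1 : ∀ a y : ZMod 13, (7 * y.val + 91 - 7 * a.val) % 91 = 7 * (y - a).val := by
    decide +kernel
  have h2 : ∀ a y : ZMod 13, 7 * (7 * a.val + 7 * y.val) % 91 = 7 * (7 * (a + y)).val := by
    decide +kernel
  have h3 : ∀ a y : ZMod 13, 7 * a.val * y.val % 91 = 7 * (a * y).val := by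
    decide +kernel
  have h4 : ∀ a : ZMod 13, look invTable (7 * a.val) = (a ^ 11).val := by
    decide +kernel
  have key : ∀ v a y m : ℕ, a = y ∨
      v ≤ (m + 91 - a) % 91 * look invTable ((y + 91 - a) % 91) % 91 →
      cond (Nat.beq a y) true
        (Nat.ble v (Nat.mod (Nat.mul (Nat.mod (Nat.sub (Nat.add m 91) a) 91)
        (look invTable (Nat.mod (Nat.sub (Nat.add y 91) a) 91))) 91)) = true := by
    intro v a y m h
    obtain h | h := h
    · simp [h]
    · have : Nat.ble v (Nat.mod (Nat.mul (Nat.mod (Nat.sub (Nat.add m 91) a) 91)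
        (look invTable (Nat.mod (Nat.sub (Nat.add y 91) a) 91))) 91) = true := by
        rw [Nat.ble_eq]; exact h
      rw [this]; cases Nat.beq a y <;> rfl
  have hv : look P 49 = 7 * (t 7).val := hP 7
  unfold PermThirteen.normalized
  rw [force_eq, hv]
  suffices ∀ n ≤ 13, Nat.rec true (fun a ih =>
    cond (force (Nat.mul 7 a) fun a => force (look P a) fun y => cond (Nat.beq a y) true
      (Nat.ble (7 * (t 7).val) (Nat.mod (Nat.mul
        (Nat.mod (Nat.sub (Nat.add (look P (Nat.mod (Nat.mul 7 (Nat.add a y)) 91)) 91) a) 91)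
        (look invTable (Nat.mod (Nat.sub (Nat.add y 91) a) 91))) 91)))
    ih false) n = true from this 13 le_rfl
  intro n hn
  induction n with
  | zero => rfl
  | succ n ih =>
    dsimp only
    rw [ih (by lia)]
    have hn' : ((n : ZMod 13)).val = n := ZMod.val_cast_of_lt (by lia)
    rw [force_eq, force_eq, key]
    · rfl
    rw [show Nat.mul 7 n = 7 * (n : ZMod 13).val by rw [hn']; rfl, hP,
      show ∀ a b, Nat.mod (Nat.mul 7 (Nat.add a b)) 91 = 7 * (a + b) % 91 from fun _ _ => rfl,
      h2, hP, h1, h1, h4, h3]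
    by_cases hf : t n = n
    · left; rw [hf]
    · right
      exact Nat.mul_le_mul_left 7 (h n hf)

theorem Encodes.of_leaf {P : ℕ} {t : ZMod 13 → ZMod 13} (hP : Encodes P t) (hlt : P < 2 ^ 91)
    (h : ∀ a, t a ≠ a → (t 7).val ≤ midpointImage t a) {bad : ℕ → Bool} (hl : leaf bad P = true) :
    (∃ j, (Finset.univ.filter fun x => (fun x => t (x + j))^[12] x = x).card ∈ Set.Icc 6 12) ∨
    (∃ i j, (Finset.univ.filter fun x => (fun x => t (t (x + j) + i))^[12] x = x).card ∈
      Set.Icc 6 12) ∨ bad P = true := by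
  rw [leaf, hP.normalized h, cond_true, force_eq] at hl
  by_cases h1 : anyRotation (double P) 7 = true
  · obtain ⟨j, hj, h1⟩ := hP.exists_rotation hlt (by norm_num) h1
    exact Or.inl ⟨j, hj.card_fixed_of_fewMoved h1⟩
  rw [Bool.eq_false_of_not_eq_true h1, cond_false] at hl
  by_cases h2 : anyProduct P (double P) 7 = true
  · obtain ⟨i, Q, hQ, hQt, h2⟩ := hP.exists_product hlt (by norm_num) h2
    obtain ⟨j, hj, h2⟩ := hQt.exists_rotation hQ le_rfl h2
    exact Or.inr (Or.inl ⟨i, j, hj.card_fixed_of_fewMoved h2⟩)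
  rw [Bool.eq_false_of_not_eq_true h2, cond_false] at hl
  exact Or.inr (Or.inr hl)

theorem of_allImages {go : List ℕ → ℕ → Bool} {i P j : ℕ} {a b pre : List ℕ}
    (h : allImages go i P (a ++ j :: b) pre = true) :
    go (pre ++ a ++ b) (addShift (addShift P i j) j i) = true := by
  induction a generalizing pre with
  | nil =>
    by_contra hc
    change cond (force (addShift (addShift P i j) j i) fun Q => go (pre ++ b) Q) _ false = true at h
    rw [force_eq] at h
    simp_all
  | cons k a ih =>
    change cond (force (addShift (addShift P i k) k i) fun Q => go (pre ++ (a ++ j :: b)) Q)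
      (allImages go i P (a ++ j :: b) (pre ++ [k])) false = true at h
    rw [Bool.cond_false_right, Bool.and_eq_true] at h
    simpa using ih h.2

theorem of_allInvolutions {good : ℕ → Bool} {T : ℕ → ℕ} {fuel : ℕ} {L : List ℕ} {P : ℕ}
    (hL : L.Nodup) (hmem : ∀ x ∈ L, T x ∈ L) (hinv : ∀ x ∈ L, T (T x) = x)
    (h : allInvolutions good fuel L P = true) :
    good (P + (L.map fun x => T x * 2 ^ x).sum) = true := by
  induction fuel generalizing L P with
  | zero => cases h
  | succ n ih =>
    cases L with
    | nil => exact h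
    | cons i r =>
      change cond (force (addShift P i i) fun Q => allInvolutions good n r Q)
        (allImages (allInvolutions good n) i P r []) false = true at h
      rw [Bool.cond_false_right, Bool.and_eq_true, force_eq, addShift_eq] at h
      have hi := hmem i (by simp)
      rw [List.nodup_cons] at hL
      obtain hTi | hTi := List.mem_cons.1 hi
      · have := ih hL.2 (fun x hx => ?_) (fun x hx => hinv x (by simp [hx])) h.1
        · simpa [hTi, add_assoc] using this
        · refine (List.mem_cons.1 (hmem x (by simp [hx]))).resolve_left fun hx' => hL.1 ?_
          have := hinv x (by simp [hx])
          rw [hx', hTi] at this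
          rwa [this]
      · obtain ⟨a, b, rfl⟩ := List.append_of_mem hTi
        have h2 := of_allImages h.2
        rw [List.nil_append, addShift_eq, addShift_eq] at h2
        have hTT := hinv i (by simp)
        have hn := hL.2
        rw [List.nodup_append_comm, List.cons_append, List.nodup_cons, List.nodup_append_comm,
          List.mem_append] at hn
        have := ih hn.2 (fun x hx => ?_) (fun x hx => hinv x (by
          simp only [List.mem_append, List.mem_cons] at hx ⊢; tauto)) h2
        · rw [← this]
          simp only [List.map_append, List.sum_append, List.map_cons, List.sum_cons, hTT]
          congr 1; ring
        · have hxm : x ∈ i :: (a ++ T i :: b) := by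
            simp only [List.mem_append, List.mem_cons] at hx ⊢; tauto
          have h3 := hmem x hxm
          have h4 := hinv x hxm
          have hxi : T x ≠ i := by
            intro h; rw [h] at h4; rw [← h4] at hx; simp only [List.mem_append] at hx; tauto
          have hxj : T x ≠ T i := by
            intro h; rw [h, hTT] at h4; rw [← h4] at hx
            simp only [List.mem_append, List.mem_cons] at hL hx; tauto
          simp only [List.mem_append, List.mem_cons] at h3 ⊢; tauto

/-- The tables of the four exceptional involutions that are not reflections. -/
def exceptionalTable : Fin 4 → ZMod 13 → ZMod 13 :=
  (![![1, 0, 7, 3, 4, 10, 6, 2, 11, 9, 5, 8, 12], ![1, 0, 7, 5, 4, 3, 6, 2, 8, 9, 10, 12, 11],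
    ![1, 0, 8, 3, 7, 5, 6, 4, 2, 12, 10, 11, 9], ![1, 0, 12, 7, 4, 5, 6, 3, 10, 9, 8, 11, 2]] :
    Fin 4 → Fin 13 → Fin 13)

theorem Encodes.of_exceptional {P : ℕ} {t : ZMod 13 → ZMod 13} (hP : Encodes P t)
    (h : exceptional P = true) : (∀ x, t x = 1 - x) ∨ ∃ k, t = exceptionalTable k := by
  have aux (n : ℕ) (u : Fin 13 → Fin 13) (hu : ∀ x : Fin 13, look n (7 * x.val) = 7 * (u x).val)
      (h : Nat.beq P n = true) : t = u := by
    funext x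
    rw [Nat.beq_eq] at h
    have h1 := hP x
    rw [h] at h1
    exact Fin.ext (Nat.eq_of_mul_eq_mul_left (by norm_num) (h1.symm.trans (hu x)))
  simp only [exceptional, Bool.or_eq_true, Bool.cond_true_left] at h
  obtain h | h | h | h | h | h := h
  · left
    have := aux _ (fun x => 1 - x) (by decide +kernel) h
    intro x; rw [this]; rfl
  · exact Or.inr ⟨0, aux _ _ (by decide +kernel) h⟩
  · exact Or.inr ⟨1, aux _ _ (by decide +kernel) h⟩
  · exact Or.inr ⟨2, aux _ _ (by decide +kernel) h⟩
  · exact Or.inr ⟨3, aux _ _ (by decide +kernel) h⟩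
  · cases h

theorem add_sum_filter (T w : ℕ → ℕ) {k : ℕ} (hk : 2 ≤ k) (hk' : k < 13) (h0 : T 0 = 7)
    (h1 : T 7 = 0) (h7 : T 49 = 7 * k) (h7' : T (7 * k) = 49) :
    (if k = 7 then 7 * w 0 + 49 * w 49 else 7 * w 0 + 49 * w (7 * k) + 7 * k * w 49) +
      (([14, 21, 28, 35, 42, 49, 56, 63, 70, 77, 84].filter fun x => x ≠ 7 * k ∧ x ≠ 49).map
        fun x => T x * w x).sum = ∑ x ∈ Finset.range 13, T (7 * x) * w (7 * x) := by
  interval_cases k <;>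
    simp [Finset.sum_range_succ, h0, h1, h7, List.filter] at h7' ⊢ <;>
    (try simp only [h7']) <;> ring

theorem search {t : ZMod 13 → ZMod 13} (ht : ∀ x, t (t x) = x) (h0 : t 0 = 1)
    (h : ∀ a, t a ≠ a → (t 7).val ≤ midpointImage t a) :
    (∃ j, (Finset.univ.filter fun x => (fun x => t (x + j))^[12] x = x).card ∈ Set.Icc 6 12) ∨
    (∃ i j, (Finset.univ.filter fun x => (fun x => t (t (x + j) + i))^[12] x = x).card ∈
      Set.Icc 6 12) ∨ (∀ x, t x = 1 - x) ∨ ∃ k, t = exceptionalTable k := by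
  set T : ℕ → ℕ := fun y => 7 * (t (y / 7 : ℕ)).val with hT
  have hT7 : ∀ x : ZMod 13, T (7 * x.val) = 7 * (t x).val := fun x => by simp [hT]
  obtain ⟨hP, hlt⟩ := encodes_pack hT7
  suffices leaf exceptional (pack T) = true by
    exact (hP.of_leaf hlt h this).imp_right (Or.imp_right hP.of_exceptional)
  have h1 : t 1 = 0 := by rw [← h0, ht]
  have hinj : Function.Injective t := fun x y hxy => by rw [← ht x, hxy, ht]
  obtain ⟨k, hk⟩ : ∃ k, k = (t 7).val := ⟨_, rfl⟩
  have hkt : t 7 = k := by rw [hk]; simp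
  have hk13 : k < 13 := hk ▸ ZMod.val_lt _
  have hk2 : 2 ≤ k := by
    by_contra hlt
    interval_cases k
    · exact absurd (hinj (hkt.trans (by rw [h1]; rfl) : t 7 = t 1)) (by decide)
    · exact absurd (hinj (hkt.trans (by rw [h0]; rfl) : t 7 = t 0)) (by decide)
  have key := allInvolutions_leaf hk2 hk13
  have hTT : ∀ x : ℕ, x < 13 → T (T (7 * x)) = 7 * x := fun x hx => by
    have h1 := hT7 x
    rw [ZMod.val_cast_of_lt hx] at h1
    rw [h1, hT7, ht, ZMod.val_cast_of_lt hx]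
  have hTlt : ∀ x, ∃ y < 13, T x = 7 * y := fun x => ⟨_, ZMod.val_lt _, rfl⟩
  have hT0 : T 0 = 7 := by have := hT7 0; rwa [h0] at this
  have hT1 : T 7 = 0 := by have := hT7 1; rwa [h1] at this
  have hTk : T 49 = 7 * k := by have := hT7 7; rwa [← hk] at this
  have hTk' : T (7 * k) = 49 := by rw [← hTk]; exact hTT 7 (by norm_num)
  have hL (x : ℕ) : x ∈ ([14, 21, 28, 35, 42, 49, 56, 63, 70, 77, 84].filter
      fun x => x ≠ 7 * k ∧ x ≠ 49) ↔ ∃ m, x = 7 * m ∧ 2 ≤ m ∧ m < 13 ∧ m ≠ k ∧ m ≠ 7 := by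
    simp only [List.mem_filter, List.mem_cons, List.not_mem_nil, or_false, decide_eq_true_eq]
    constructor
    · intro hx
      exact ⟨x / 7, by omega⟩
    · rintro ⟨m, rfl, hm⟩
      have : m < 13 := hm.2.1
      lia
  have := of_allInvolutions (T := T) (List.Nodup.filter _ (by decide)) (fun x hx => ?_)
    (fun x hx => ?_) key
  · rw [← this, pack_eq]
    rw [← add_sum_filter T (2 ^ ·) hk2 hk13 hT0 hT1 hTk hTk']
    simp only [Nat.shiftLeft_eq, pow_zero, mul_one]
  · obtain ⟨m, rfl, hm⟩ := (hL _).1 hx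
    obtain ⟨y, hy, hTy⟩ := hTlt (7 * m)
    have hmm := hTT m hm.2.1
    rw [hTy] at hmm
    refine (hL _).2 ⟨y, hTy, ?_, hy, ?_, ?_⟩
    · by_contra hlt
      interval_cases y
      · rw [mul_zero, hT0] at hmm; lia
      · rw [mul_one, hT1] at hmm; lia
    · rintro rfl; rw [hTk'] at hmm; lia
    · rintro rfl; rw [hTk] at hmm; lia
  · obtain ⟨m, rfl, hm⟩ := (hL _).1 hx
    exact hTT m hm.2.1

open Equiv Equiv.Perm MulAction

theorem isThreeCycle_commutator {α : Type*} [Fintype α] [DecidableEq α] {g k : Perm α} {a : α}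
    (hg : g a ≠ a) (hk : k a ≠ a) (h : ∀ x ≠ a, g x = x ∨ k x = x) :
    (g * k * g⁻¹ * k⁻¹).IsThreeCycle := by
  have hgk : g a ≠ k a := fun e => by
    rcases h _ hg with h1 | h1
    · exact hg (g.injective h1)
    · rw [e] at h1; exact hk (k.injective h1)
  have key : g * k = swap a (k a) * swap a (g a) * (k * g) := by
    ext x
    simp only [Perm.coe_mul, Function.comp_apply]
    have hkga : k (g a) = g a := (h _ hg).resolve_left fun e => hg (g.injective e)
    have hgka : g (k a) = k a := (h _ hk).resolve_right fun e => hk (k.injective e)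
    by_cases hxa : x = a
    · subst hxa
      rw [hgka, hkga, swap_apply_right, swap_apply_left]
    rcases h x hxa with h1 | h1
    · rw [h1]
      by_cases h2 : k x = a
      · rw [h2, swap_apply_left, swap_apply_of_ne_of_ne hg hgk]
      · have h3 : g (k x) = k x := (h _ h2).elim id fun e => by
          rw [k.injective e, h1]
        have h4 : k x ≠ g a := fun e => h2 (g.injective (h3.trans e))
        rw [h3, swap_apply_of_ne_of_ne h2 h4,
          swap_apply_of_ne_of_ne h2 fun e => hxa (k.injective e)]
    · rw [h1]
      by_cases h2 : g x = a
      · rw [h2, swap_apply_of_ne_of_ne hk hgk.symm, swap_apply_right]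
      · have h3 : k (g x) = g x := (h _ h2).elim (fun e => by rw [g.injective e, h1]) id
        have h4 : g x ≠ k a := fun e => h2 (k.injective (h3.trans e))
        rw [h3, swap_apply_of_ne_of_ne h2 (fun e => hxa (g.injective e)),
          swap_apply_of_ne_of_ne h2 h4]
  rw [key]
  convert Perm.isThreeCycle_swap_mul_swap_same hk.symm hg.symm hgk.symm using 1
  group

theorem alternatingGroup_le_of_isCycle {α : Type*} [Fintype α] [DecidableEq α]
    {G : Subgroup (Perm α)} (hG : IsPreprimitive G α) {g : Perm α} (hg : g ∈ G)
    (hgc : g.IsCycle) (hp : g.support.card.Prime) (h3 : g.support.card + 3 ≤ Fintype.card α)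
    (h2 : 2 * g.support.card ≤ Fintype.card α + 1) : alternatingGroup α ≤ G := by
  obtain ⟨n, hn⟩ : ∃ n, Fintype.card α = g.support.card + (n + 1) :=
    ⟨Fintype.card α - g.support.card - 1, by omega⟩
  have hc : (g.support : Set α)ᶜ.ncard = n + 1 := by
    apply Nat.add_left_cancel
    rw [Set.ncard_add_ncard_compl, Set.ncard_coe_finset, Nat.card_eq_fintype_card, hn]
  have h := isPretransitive_of_isCycle_mem hgc hg
  have hprim : IsPreprimitive (fixingSubgroup G (g.support : Set α)ᶜ)
      (SubMulAction.ofFixingSubgroup G (g.support : Set α)ᶜ) := by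
    apply IsPreprimitive.of_prime_card
    classical
    convert! hp
    rw [Nat.card_eq_fintype_card, Fintype.card_subtype]
    congr 1
    ext x
    simp [SubMulAction.mem_ofFixingSubgroup_iff]
  have hm := hG.isMultiplyPreprimitive hc
    (by rw [Nat.card_eq_fintype_card]; have := hp.two_le; omega) hprim
  have ht : IsMultiplyPretransitive G α (n + 2) := IsMultiplyPreprimitive.isMultiplyPretransitive ..
  replace ht : IsMultiplyPretransitive G α g.support.card :=
    isMultiplyPretransitive_of_le (n := n + 2) (by omega)
      (by rw [Nat.card_eq_fintype_card]; have := hp.two_le; omega)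
  obtain ⟨a, ha⟩ := hgc.nonempty_support
  have hcard : g.support.card ≤ (insert a g.supportᶜ).card := by
    rw [Finset.card_insert_of_notMem (by simpa using ha), Finset.card_compl]
    omega
  obtain ⟨s, hs, hsc⟩ := Finset.exists_subsuperset_card_eq
    (s := {a}) (t := insert a g.supportᶜ) (by simp) (by simpa using hp.one_lt.le) hcard
  obtain ⟨e⟩ : Nonempty (Fin g.support.card ≃ s) := ⟨(finCongr hsc.2.symm).trans s.equivFin.symm⟩
  obtain ⟨h, hh⟩ := isMultiplyPretransitive_iff.1 ht
    (g.support.equivFin.symm.toEmbedding.trans (Function.Embedding.subtype _))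
    (e.toEmbedding.trans (Function.Embedding.subtype _))
  have himg (x : α) : x ∈ g.support ↔ (h : Perm α) x ∈ s := by
    have hh' (i) : (h : Perm α) (g.support.equivFin.symm i) = e i := DFunLike.congr_fun hh i
    constructor
    · intro hx
      have := hh' (g.support.equivFin ⟨x, hx⟩)
      rw [Equiv.symm_apply_apply] at this
      exact this ▸ (e _).2
    · intro hx
      have := hh' (e.symm ⟨_, hx⟩)
      rw [Equiv.apply_symm_apply] at this
      exact (h : Perm α).injective this ▸ (g.support.equivFin.symm _).2
  have hk : ∀ x, ((h : Perm α) * g * (h : Perm α)⁻¹) x ≠ x ↔ x ∈ s := fun x => by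
    rw [← (h : Perm α).apply_symm_apply x, ← himg, mem_support]
    simp [Equiv.symm_apply_eq, eq_comm]
  refine alternatingGroup_le_of_isPreprimitive_of_isThreeCycle_mem hG
    (isThreeCycle_commutator (k := (h : Perm α) * g * (h : Perm α)⁻¹) (mem_support.1 ha)
      ((hk a).2 (hs (by simp))) fun x hx => ?_) ?_
  · by_contra! hne
    have := hsc.1 ((hk x).1 hne.2)
    simp_all
  · have hk : (h : Perm α) * g * (h : Perm α)⁻¹ ∈ G := G.mul_mem (G.mul_mem h.2 hg) (G.inv_mem h.2)
    exact G.mul_mem (G.mul_mem (G.mul_mem hg hk) (G.inv_mem hg)) (G.inv_mem hk)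

theorem alternatingGroup_le_of_pow_twelve {α : Type*} [Fintype α] [DecidableEq α]
    (hα : Fintype.card α = 13) {G : Subgroup (Perm α)} (hG : IsPreprimitive G α) {w : Perm α}
    (hw : w ∈ G) (h : (Finset.univ.filter fun x => (w ^ 12) x = x).card ∈ Set.Icc 6 12) :
    alternatingGroup α ≤ G := by
  set σ := w ^ 12 with hσ
  have hsupp : σ.support.card + (Finset.univ.filter fun x => σ x = x).card = 13 := by
    rw [add_comm, ← hα, ← Finset.card_univ,
      ← Finset.card_filter_add_card_filter_not (s := Finset.univ) (p := fun x => σ x = x)]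
    rfl
  obtain ⟨h6, h12⟩ := h
  have h35 : σ ^ 35 = 1 := by
    ext x
    rw [Perm.one_apply]
    by_cases hx : σ x = x
    · rw [← Perm.iterate_eq_pow, Function.iterate_fixed hx]
    have hper (n : ℕ) : (w ^ n) x = x ↔ Function.minimalPeriod w x ∣ n := by
      rw [← Function.isPeriodicPt_iff_minimalPeriod_dvd, Function.IsPeriodicPt,
        Function.IsFixedPt, Perm.iterate_eq_pow]
    have hpos : 0 < Function.minimalPeriod w x :=
      Nat.pos_of_dvd_of_pos ((hper _).1 (by rw [pow_orderOf_eq_one]; rfl)) (orderOf_pos w)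
    have hle : Function.minimalPeriod w x ≤ 7 := by
      have := Finset.card_le_card_of_injOn (s := Finset.range (Function.minimalPeriod w x))
        (t := σ.support) (fun i => w^[i] x) (fun i _ => ?_)
        (fun i hi j hj hij => ?_)
      · rw [Finset.card_range] at this; omega
      · beta_reduce
        rw [Finset.mem_coe, mem_support, Perm.iterate_eq_pow, ← Perm.mul_apply, hσ, ← pow_add,
          add_comm, pow_add, Perm.mul_apply]
        exact fun e => hx ((w ^ i).injective e)
      · exact Function.iterate_injOn_Iio_minimalPeriod (by simpa using hi) (by simpa using hj) hij
    rw [hσ, ← pow_mul, hper]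
    rw [hσ, hper] at hx
    revert hx hpos hle
    generalize Function.minimalPeriod w x = n
    intro hpos hle hx
    interval_cases n <;> revert hx <;> decide
  have hne : σ ≠ 1 := fun e => by
    rw [e, Perm.support_one, Finset.card_empty] at hsupp
    rw [e] at h12
    omega
  obtain ⟨g, i, rfl, hgp, hg5⟩ : ∃ g i, g = σ ^ i ∧ (orderOf g).Prime ∧ 5 ≤ orderOf g := by
    by_cases h5 : σ ^ 5 = 1
    · have := orderOf_eq_prime (hp := ⟨Nat.prime_five⟩) h5 hne
      exact ⟨_, 1, (pow_one σ).symm, by rw [this]; norm_num, this.ge⟩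
    · have := orderOf_eq_prime (hp := ⟨Nat.prime_seven⟩) (by rw [← pow_mul]; exact h35) h5
      exact ⟨_, 5, rfl, by rw [this]; norm_num, by omega⟩
  have hsub : (σ ^ i).support.card ≤ σ.support.card :=
    Finset.card_le_card (Perm.support_pow_le σ i)
  have hgc := isCycle_of_prime_order hgp (by omega)
  have hord := hgc.orderOf
  refine alternatingGroup_le_of_isCycle hG (G.pow_mem (G.pow_mem hw 12) i) hgc (hord ▸ hgp)
    ?_ ?_ <;> rw [← hσ] <;> omega

instance : Fact (Nat.Prime 13) := ⟨by norm_num⟩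

/-- The affine permutation `x ↦ u * x + b` of `ZMod 13`. -/
def affine (u : (ZMod 13)ˣ) (b : ZMod 13) : Perm (ZMod 13) where
  toFun x := u * x + b
  invFun x := ↑u⁻¹ * (x - b)
  left_inv x := by beta_reduce; rw [add_sub_cancel_right, Units.inv_mul_cancel_left]
  right_inv x := by beta_reduce; rw [Units.mul_inv_cancel_left, sub_add_cancel]

theorem affine_apply (u : (ZMod 13)ˣ) (b x : ZMod 13) : affine u b x = u * x + b := rfl

theorem affine_inv_apply (u : (ZMod 13)ˣ) (b x : ZMod 13) :
    (affine u b)⁻¹ x = ↑u⁻¹ * (x - b) := rfl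

/-- The image of `G` under conjugation by `g`. -/
abbrev conjBy (g : Perm (ZMod 13)) (G : Subgroup (Perm (ZMod 13))) : Subgroup (Perm (ZMod 13)) :=
  G.map (MulAut.conj g).toMonoidHom

theorem mem_conjBy {g w : Perm (ZMod 13)} {G : Subgroup (Perm (ZMod 13))} :
    w ∈ conjBy g G ↔ g⁻¹ * w * g ∈ G := by
  constructor
  · rintro ⟨x, hx, rfl⟩
    simpa [mul_assoc] using hx
  · exact fun h => ⟨_, h, by simp [mul_assoc]⟩

theorem conj_mem_conjBy {g w : Perm (ZMod 13)} {G : Subgroup (Perm (ZMod 13))} (hw : w ∈ G) :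
    g * w * g⁻¹ ∈ conjBy g G := ⟨w, hw, rfl⟩

theorem card_conjBy (g : Perm (ZMod 13)) (G : Subgroup (Perm (ZMod 13))) :
    Nat.card (conjBy g G) = Nat.card G :=
  (Nat.card_congr (G.equivMapOfInjective _ (MulAut.conj g).injective).toEquiv).symm

/-- A permutation group that contains the translations, but not all even permutations. -/
structure IsSmall (G : Subgroup (Perm (ZMod 13))) : Prop where
  addRight_one_mem : Equiv.addRight 1 ∈ G
  not_alternatingGroup_le : ¬ alternatingGroup (ZMod 13) ≤ G

namespace IsSmall

variable {G : Subgroup (Perm (ZMod 13))}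

theorem addRight_mem (hG : IsSmall G) (j : ZMod 13) : Equiv.addRight j ∈ G := by
  have := G.pow_mem hG.addRight_one_mem j.val
  rw [Equiv.nsmul_addRight] at this
  simpa using this

theorem conj (hG : IsSmall G) (u : (ZMod 13)ˣ) (b : ZMod 13) : IsSmall (conjBy (affine u b) G) where
  addRight_one_mem := by
    rw [mem_conjBy]
    convert hG.addRight_mem ↑u⁻¹
    refine Equiv.ext fun x => ?_
    simp only [Perm.mul_apply, affine_apply, affine_inv_apply, Equiv.coe_addRight]
    linear_combination x * u.inv_mul
  not_alternatingGroup_le h := hG.not_alternatingGroup_le fun w hw => by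
    have := h ((inferInstance : (alternatingGroup (ZMod 13)).Normal).conj_mem w hw (affine u b))
    rw [mem_conjBy] at this
    simpa [mul_assoc] using this

theorem isPreprimitive (hG : IsSmall G) : IsPreprimitive G (ZMod 13) := by
  have : IsPretransitive G (ZMod 13) :=
    ⟨fun x y => ⟨⟨_, hG.addRight_mem (y - x)⟩, by simp [Subgroup.smul_def]⟩⟩
  exact IsPreprimitive.of_prime_card (by simpa using (Fact.out : Nat.Prime 13))

theorem card_notMem (hG : IsSmall G) {w : Perm (ZMod 13)} (hw : w ∈ G) :
    (Finset.univ.filter fun x => (⇑w)^[12] x = x).card ∉ Set.Icc 6 12 := fun h =>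
  hG.not_alternatingGroup_le <| alternatingGroup_le_of_pow_twelve (by simp) hG.isPreprimitive hw
    (by simpa only [Perm.iterate_eq_pow] using h)

theorem of_normalized (hG : IsSmall G) {t : Perm (ZMod 13)} (ht : t ∈ G) (htt : t * t = 1)
    (h0 : t 0 = 1) (h : ∀ a, t a ≠ a → (t 7).val ≤ midpointImage t a) :
    (∀ x, t x = 1 - x) ∨ ∃ k, ⇑t = exceptionalTable k := by
  rcases search (fun x => DFunLike.congr_fun htt x) h0 h with ⟨j, hj⟩ | ⟨i, j, hij⟩ | h | h
  · exact absurd hj (hG.card_notMem (G.mul_mem ht (hG.addRight_mem j)))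
  · exact absurd hij (hG.card_notMem (G.mul_mem ht (G.mul_mem (hG.addRight_mem i)
      (G.mul_mem ht (hG.addRight_mem j)))))
  · exact .inl h
  · exact .inr h

theorem exists_conj (hG : IsSmall G) {t : Perm (ZMod 13)} (ht : t ∈ G) (htt : t * t = 1)
    (ht1 : t ≠ 1) : ∃ u b, (∀ x, (affine u b * t * (affine u b)⁻¹) x = 1 - x) ∨
      ∃ k, ⇑(affine u b * t * (affine u b)⁻¹) = exceptionalTable k := by
  obtain ⟨a, ha, hmin⟩ := Finset.exists_min_image (Finset.univ.filter fun a => t a ≠ a)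
    (midpointImage t) (by
      by_contra hne
      exact ht1 (Equiv.ext fun x => by simpa using (Finset.filter_eq_empty_iff.1
        (Finset.not_nonempty_iff_eq_empty.1 hne)) (Finset.mem_univ x)))
  simp only [Finset.mem_filter, Finset.mem_univ, true_and] at ha hmin
  have hd : t a - a ≠ 0 := sub_ne_zero.2 ha
  obtain ⟨v, hv⟩ : ∃ v : (ZMod 13)ˣ, v⁻¹ * (t a - a) = 1 :=
    ⟨Units.mk0 _ (sub_ne_zero.2 ha), Units.inv_mul _⟩
  refine ⟨v⁻¹, -(↑v⁻¹ * a), ?_⟩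
  obtain ⟨A, hA⟩ : ∃ A, A = affine v⁻¹ (-(↑v⁻¹ * a)) := ⟨_, rfl⟩
  have hAa (x) : A x = ↑v⁻¹ * (x - a) := by rw [hA, affine_apply]; ring
  have hAt (x) : (A * t * A⁻¹) (A x) = A (t x) := by simp
  have hmid (x) : midpointImage ⇑(A * t * A⁻¹) (A x) = midpointImage t x := by
    have h12 : (↑v⁻¹ : ZMod 13) ^ 12 = 1 := ZMod.pow_card_sub_one_eq_one (Units.ne_zero _)
    have h14 : (14 : ZMod 13) = 1 := by decide
    unfold midpointImage
    rw [hAt, show 7 * (A x + A (t x)) = A (7 * (x + t x)) by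
      simp only [hAa]; linear_combination (-(↑v⁻¹ : ZMod 13) * a) * h14, hAt]
    congr 1
    simp only [hAa]
    linear_combination (t (7 * (x + t x)) - x) * (t x - x) ^ 11 * h12
  have hA0 : A a = 0 := by rw [hAa, sub_self, mul_zero]
  have h0 : (A * t * A⁻¹) 0 = 1 := by rw [← hA0, hAt, hAa, hv]
  have h7 : midpointImage ⇑(A * t * A⁻¹) 0 = ((A * t * A⁻¹) 7).val := by
    rw [midpointImage, h0]; simp
  rw [← hA]
  refine (hA ▸ hG.conj v⁻¹ _ : IsSmall (conjBy A G)).of_normalized (conj_mem_conjBy ht) ?_ h0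
    fun x hx => ?_
  · simp [mul_assoc, ← mul_assoc t t, htt]
  · obtain ⟨y, rfl⟩ := A.surjective x
    rw [← h7, hmid, ← hA0, hmid]
    exact hmin y fun e => hx (by rw [hAt, e])

end IsSmall

theorem card_eq_mul_card_stabilizer {G : Type*} [Group G] {α : Type*} [MulAction G α]
    [IsPretransitive G α] (a : α) : Nat.card G = Nat.card α * Nat.card (stabilizer G a) := by
  rw [← index_stabilizer_of_transitive G a, mul_comm, Subgroup.card_mul_index]

namespace IsSmall

variable {G : Subgroup (Perm (ZMod 13))}

theorem exists_affine (hG : IsSmall G) {t : Perm (ZMod 13)} (ht : t ∈ G) (htt : t * t = 1)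
    (ht1 : t ≠ 1)
    (h : ∀ t ∈ G, t * t = 1 → t ≠ 1 → ∃ d : ZMod 13, ∀ x, t x = d - x) {g : Perm (ZMod 13)}
    (hg : g ∈ G) : ∃ e : ZMod 13, ∀ x, g x = g 0 + e * x := by
  have hconj : ∀ t ∈ G, t * t = 1 → t ≠ 1 → ∃ d : ZMod 13, ∀ x, g (t x) = d - g x := by
    intro t ht htt ht1
    obtain ⟨d, hd⟩ := h (g * t * g⁻¹) (G.mul_mem (G.mul_mem hg ht) (G.inv_mem hg))
      (by simp [mul_assoc, ← mul_assoc t t, htt]) (by simpa [mul_inv_eq_one] using ht1)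
    exact ⟨d, fun x => by simpa using hd (g x)⟩
  obtain ⟨d, hd⟩ := h t ht htt ht1
  have hs (x) : (Equiv.addRight 1 * t : Perm (ZMod 13)) x = d - x + 1 := by simp [hd]
  obtain ⟨d₁, h₁⟩ := hconj t ht htt ht1
  obtain ⟨d₂, h₂⟩ := hconj _ (G.mul_mem hG.addRight_one_mem ht)
    (Equiv.ext fun x => by rw [Perm.mul_apply, hs, hs, Perm.one_apply]; ring)
    (fun e => (by decide : ∀ d : ZMod 13, d - 7 * d + 1 ≠ 7 * d) d
      ((hs _).symm.trans (DFunLike.congr_fun e (7 * d))))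
  have hstep (x) : g (x + 1) = g x + (d₂ - d₁) := by
    have h1 := h₁ (d - x)
    have h2 := h₂ (d - x)
    rw [hd] at h1
    rw [hs] at h2
    rw [show d - (d - x) + 1 = x + 1 by ring] at h2
    rw [show d - (d - x) = x by ring] at h1
    rw [h1, h2]; ring
  refine ⟨d₂ - d₁, fun x => ?_⟩
  have (n : ℕ) : g n = g 0 + (d₂ - d₁) * n := by
    induction n with
    | zero => simp
    | succ n ih => rw [Nat.cast_succ, hstep, ih]; ring
  simpa using this x.val

theorem card_of_affine (hG : IsSmall G) (h2 : 2 ∣ Nat.card G)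
    (h : ∀ g ∈ G, ∃ e : ZMod 13, ∀ x, g x = g 0 + e * x) :
    Nat.card G = 26 ∨ Nat.card G = 52 ∨ Nat.card G = 78 ∨ Nat.card G = 156 := by
  have := hG.isPreprimitive
  have hc := card_eq_mul_card_stabilizer (G := G) (0 : ZMod 13)
  have hlin (g : stabilizer G (0 : ZMod 13)) (x) :
      (g : Perm (ZMod 13)) x = (g : Perm (ZMod 13)) 1 * x := by
    obtain ⟨e, he⟩ := h _ g.1.2
    have h0 : (g : Perm (ZMod 13)) 0 = 0 := g.2
    rw [he, he 1, h0]; ring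
  let φ : stabilizer G (0 : ZMod 13) →* ZMod 13 :=
    { toFun := fun g => (g : Perm (ZMod 13)) 1
      map_one' := rfl
      map_mul' := fun g k => hlin g _ }
  have hφ : Function.Injective φ.toHomUnits := fun g k hgk => by
    have h1 : (g : Perm (ZMod 13)) 1 = (k : Perm (ZMod 13)) 1 := congr_arg Units.val hgk
    exact Subtype.ext (Subtype.ext (Equiv.ext fun x => by rw [hlin, hlin k, h1]))
  have hd := Subgroup.card_dvd_of_injective _ hφ
  rw [Nat.card_eq_fintype_card (α := (ZMod 13)ˣ), ZMod.card_units] at hd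
  rw [Nat.card_zmod] at hc
  have hle := Nat.le_of_dvd (by norm_num) hd
  generalize Nat.card (stabilizer G (0 : ZMod 13)) = n at *
  rw [hc] at h2 ⊢
  interval_cases n <;> omega

end IsSmall

/-- An involution that generates, together with the translations, a copy of `PSL(3, 3)`. -/
def homology : Perm (ZMod 13) :=
  Function.Involutive.toPerm (exceptionalTable 0) (by unfold Function.Involutive; decide)

theorem homology_apply (x : ZMod 13) : homology x = exceptionalTable 0 x := rfl

/-- The product of the permutations `x ↦ t x + i`, for `i` in `l`. -/
def wordPerm (t : Perm (ZMod 13)) (l : List (ZMod 13)) : Perm (ZMod 13) :=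
  (l.map fun i => Equiv.addRight i * t).prod

def evalWord (t : ZMod 13 → ZMod 13) (l : List (ZMod 13)) (x : ZMod 13) : ZMod 13 :=
  l.foldr (fun i y => t y + i) x

theorem wordPerm_apply (t : Perm (ZMod 13)) (l : List (ZMod 13)) (x : ZMod 13) :
    wordPerm t l x = evalWord t l x := by
  induction l with
  | nil => rfl
  | cons i l ih => simpa [wordPerm, evalWord] using ih

def line (j : ZMod 13) : Finset (ZMod 13) := {j, j + 1, j + 3, j + 9}

theorem word_eq_homology : ∀ k : Fin 4, ∃ u v l, u * v = 1 ∧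
    ∀ x : ZMod 13, evalWord (fun x => u * exceptionalTable k (v * x)) l x =
      exceptionalTable 0 x := by
  have h : ∀ k : Fin 4, (![1, 8, 10, 2] k * ![1, 5, 4, 7] k : ZMod 13) = 1 ∧ ∀ x : ZMod 13,
      evalWord (fun x => ![1, 8, 10, 2] k * exceptionalTable k (![1, 5, 4, 7] k * x))
        (![[0], [10, 3, 0], [11, 2], [2, 9, 7, 0]] k) x = exceptionalTable 0 x := by
    decide +kernel
  exact fun k => ⟨_, _, _, h k⟩

theorem exceptional_dichotomy : ∀ (k : Fin 4) (u v : ZMod 13), u * v = 1 →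
    (∃ j, (Finset.univ.filter fun x =>
      (fun x => v * exceptionalTable k (u * exceptionalTable 0 (x + j)))^[12] x = x).card ∈
        Set.Icc 6 12) ∨
    (Finset.univ.filter fun x : ZMod 13 => v * exceptionalTable k (u * x) = x).card = 5 ∧
      ∃ j, ∀ x ∈ line j, v * exceptionalTable k (u * x) = x := by
  simp only [Set.mem_Icc]
  decide +kernel

theorem card_reflection_mul : (Finset.univ.filter fun x : ZMod 13 =>
    (fun x : ZMod 13 => - exceptionalTable 0 (x + 2) )^[12] x = x).card ∈ Set.Icc 6 12 := by
  simp only [Set.mem_Icc]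
  decide +kernel

theorem line_injective : ∀ i j, 2 ≤ (line i ∩ line j).card → i = j := by decide +kernel

theorem card_line : ∀ i, (line i).card = 4 := by decide +kernel

theorem fixed_inter_fixed : 
   (Finset.univ.filter fun x => (wordPerm homology [10, 3, 0]) x = x) ∩
    (Finset.univ.filter fun x => (wordPerm homology [2, 2, 5]) x = x) = line 0 := by
  decide +kernel

namespace IsSmall

variable {G : Subgroup (Perm (ZMod 13))}

theorem wordPerm_mem (hG : IsSmall G) {t : Perm (ZMod 13)} (ht : t ∈ G) (l : List (ZMod 13)) :
    wordPerm t l ∈ G :=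
  G.list_prod_mem fun g hg => by
    obtain ⟨i, -, rfl⟩ := List.mem_map.1 hg
    exact G.mul_mem (hG.addRight_mem i) ht

theorem reflection_or_exceptional (hG : IsSmall G) {t : Perm (ZMod 13)} (ht : t ∈ G)
    (htt : t * t = 1) (ht1 : t ≠ 1) : (∃ d : ZMod 13, ∀ x, t x = d - x) ∨
      ∃ k c u v, u * v = 1 ∧ ∀ x, t (x - c) + c = v * exceptionalTable k (u * x) := by
  obtain ⟨u, b, h⟩ := hG.exists_conj ht htt ht1
  obtain ⟨s, hs, hsr⟩ : ∃ s, (∀ x, affine u b (t x) = s (affine u b x)) ∧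
      ((∀ x, s x = 1 - x) ∨ ∃ k, s = exceptionalTable k) :=
    ⟨_, fun x => by simp, h⟩
  obtain ⟨v, hv⟩ : ∃ v, (u : ZMod 13) * v = 1 := ⟨_, u.mul_inv⟩
  simp only [affine_apply] at hs
  obtain h | ⟨k, rfl⟩ := hsr
  · refine .inl ⟨v * (1 - 2 * b), fun x => ?_⟩
    linear_combination v * ((hs x).trans (h _)) - (t x + x) * hv
  · refine .inr ⟨k, v * b, u, v, hv, fun x => ?_⟩
    rw [show u * x = u * (x - v * b) + b by linear_combination b * hv, ← hs]
    linear_combination (- t (x - v * b)) * hv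

theorem exists_homology_mem (hG : IsSmall G) {t : Perm (ZMod 13)} (ht : t ∈ G) (htt : t * t = 1)
    (ht1 : t ≠ 1) (hd : ¬ ∃ d : ZMod 13, ∀ x, t x = d - x) :
    ∃ g, IsSmall (conjBy g G) ∧ homology ∈ conjBy g G := by
  obtain ⟨k, c, u, v, huv, h⟩ := (hG.reflection_or_exceptional ht htt ht1).resolve_left hd
  obtain ⟨p, q, l, hpq, hl⟩ := word_eq_homology k
  obtain ⟨w, hw⟩ : ∃ w : (ZMod 13)ˣ, w = p * u := ⟨Units.mkOfMulEqOne _ (q * v)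
    (by linear_combination p * q * huv + hpq), rfl⟩
  refine ⟨_, hG.conj w 0, ?_⟩
  convert (hG.conj w 0).wordPerm_mem (conj_mem_conjBy (G.mul_mem (hG.addRight_mem c)
    (G.mul_mem ht (hG.addRight_mem (-c))))) l
  refine Equiv.ext fun x => ?_
  rw [wordPerm_apply, homology_apply, ← hl]
  congr 1
  funext x
  obtain ⟨y, rfl⟩ := (affine w 0).surjective x
  have hconj (r : Perm (ZMod 13)) : (affine w 0 * r * (affine w 0)⁻¹) (affine w 0 y) =
    affine w 0 (r y) := by simp
  rw [hconj]
  simp only [Perm.mul_apply, affine_apply, Equiv.coe_addRight, ← sub_eq_add_neg, h, hw, add_zero]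
  rw [show q * (p * u * y) = u * y by linear_combination u * y * hpq]
  linear_combination (-p * exceptionalTable k (u * y)) * huv

theorem fixes_line (hG : IsSmall G) (h₀ : homology ∈ G) {t : Perm (ZMod 13)} (ht : t ∈ G)
    (htt : t * t = 1) (ht1 : t ≠ 1) :
    (Finset.univ.filter fun x => t x = x).card = 5 ∧ ∃ j, ∀ x ∈ line j, t x = x := by
  obtain ⟨d, h⟩ | ⟨k, c, u, v, huv, h⟩ := hG.reflection_or_exceptional ht htt ht1
  · refine absurd card_reflection_mul ?_
    convert hG.card_notMem (G.mul_mem (hG.addRight_mem (-d)) (G.mul_mem ht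
      (G.mul_mem h₀ (hG.addRight_mem 2)))) using 7 with x
    simp [h, homology_apply, sub_eq_add_neg, add_right_comm d]
  · rcases exceptional_dichotomy k u v huv with ⟨j, hj⟩ | ⟨h5, j, hj⟩
    · refine absurd hj ?_
      convert hG.card_notMem (G.mul_mem (G.mul_mem (hG.addRight_mem c) ht)
        (G.mul_mem (hG.addRight_mem (-c)) (G.mul_mem h₀ (hG.addRight_mem j)))) using 7 with x
      simp [← h, homology_apply, sub_eq_add_neg]
    · simp only [← h] at h5 hj
      constructor
      · rw [← h5]
        refine Finset.card_bij (fun x _ => x + c) (fun x hx => ?_) (by simp) fun y hy => ?_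
        · simpa using hx
        · exact ⟨y - c, by simpa [eq_sub_iff_add_eq] using hy, by simp⟩
      · refine ⟨j - c, fun x hx => ?_⟩
        have := hj (x + c) ?_
        · simpa using this
        simp only [line, Finset.mem_insert, Finset.mem_singleton] at hx ⊢
        rcases hx with rfl | rfl | rfl | rfl <;> ring_nf <;> simp

end IsSmall

def Collinear (x y z : ZMod 13) : Prop := ∃ j, x ∈ line j ∧ y ∈ line j ∧ z ∈ line j

instance (x y z : ZMod 13) : Decidable (Collinear x y z) :=
  inferInstanceAs (Decidable (∃ _, _))

theorem card_eq_card_mul_card_inf_stabilizer {α : Type*} (K : Subgroup (Perm α)) (x : α)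
    (S : Finset α) (hS : ∀ y, y ∈ S ↔ ∃ g ∈ K, g x = y) :
    Nat.card K = S.card * Nat.card (K ⊓ stabilizer (Perm α) x : Subgroup (Perm α)) := by
  rw [← Subgroup.relIndex_bot_left K, ← Subgroup.relIndex_mul_relIndex ⊥
    (K ⊓ stabilizer (Perm α) x) K bot_le inf_le_left, Subgroup.relIndex_bot_left,
    Subgroup.inf_relIndex_left, mul_comm]
  congr 1
  rw [← Set.ncard_coe_finset, show (S : Set α) = orbit K x by
    ext y; simp [hS, mem_orbit_iff, Subgroup.smul_def], ← index_stabilizer]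
  rfl

theorem wordPerm_mul_self :
    wordPerm homology [10, 3, 0] * wordPerm homology [10, 3, 0] = 1 ∧
    wordPerm homology [2, 2, 5] * wordPerm homology [2, 2, 5] = 1 := by
  decide +kernel

theorem wordPerm_ne_one :
    wordPerm homology [10, 3, 0] ≠ 1 ∧ wordPerm homology [2, 2, 5] ≠ 1 := by
  decide +kernel

theorem image_add_line : ∀ i j, (line i).image (· + j) = line (i + j) := by decide +kernel

theorem exists_wordPerm₁ : ∀ y ≠ 0, ∃ l, wordPerm homology l 0 = 0 ∧
    wordPerm homology l 1 = y := by
  suffices h : ∀ y ≠ 0, ∃ l ∈ [[], [4, 8], [8, 10, 0], [10, 2], [12, 6, 1], [6, 1], [3, 4],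
      [8, 7, 2], [1, 11], [5, 10], [12, 12], [12]], wordPerm homology l 0 = 0 ∧
      wordPerm homology l 1 = y from
    fun y hy => (h y hy).imp fun l hl => hl.2
  decide +kernel

theorem exists_wordPerm₂ : ∀ y, ¬ Collinear 0 1 y → ∃ l, wordPerm homology l 0 = 0 ∧
    wordPerm homology l 1 = 1 ∧ wordPerm homology l 2 = y := by
  suffices h : ∀ y, ¬ Collinear 0 1 y → ∃ l ∈ [[], [2, 6, 6], [6, 8, 2, 0], [1, 3, 8], [10, 3, 0],
      [2, 3, 9], [4, 2, 2, 0], [7, 7, 11], [8, 8, 7, 0]], wordPerm homology l 0 = 0 ∧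
      wordPerm homology l 1 = 1 ∧ wordPerm homology l 2 = y from
    fun y hy => (h y hy).imp fun l hl => hl.2
  decide +kernel

theorem exists_wordPerm₃ : ∀ y, ¬ Collinear 0 1 y ∧ ¬ Collinear 0 2 y ∧ ¬ Collinear 1 2 y →
    ∃ l, wordPerm homology l 0 = 0 ∧ wordPerm homology l 1 = 1 ∧ wordPerm homology l 2 = 2 ∧
      wordPerm homology l 5 = y := by
  suffices h : ∀ y, ¬ Collinear 0 1 y ∧ ¬ Collinear 0 2 y ∧ ¬ Collinear 1 2 y →
      ∃ l ∈ [[], [2, 5, 2], [7, 9, 5, 0], [2, 2, 5]], wordPerm homology l 0 = 0 ∧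
        wordPerm homology l 1 = 1 ∧ wordPerm homology l 2 = 2 ∧ wordPerm homology l 5 = y from
    fun y hy => (h y hy).imp fun l hl => hl.2
  decide +kernel

/-- The lines `ab` and `cd` meet exactly in `x`. -/
def MeetsIn (a b c d x : ZMod 13) : Prop :=
  (Collinear a b x ∧ Collinear c d x) ∧ ∀ y, Collinear a b y ∧ Collinear c d y → y = x

instance (a b c d x : ZMod 13) : Decidable (MeetsIn a b c d x) :=
  inferInstanceAs (Decidable (_ ∧ _))

theorem meetsIn : MeetsIn 0 1 2 5 3 ∧ MeetsIn 0 5 1 2 4 ∧ MeetsIn 1 5 3 4 6 ∧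
    MeetsIn 0 5 2 6 7 ∧ MeetsIn 0 2 1 5 8 ∧ MeetsIn 0 1 2 6 9 ∧ MeetsIn 0 6 1 2 10 ∧
    MeetsIn 0 6 1 7 11 ∧ MeetsIn 0 2 1 7 12 := by
  refine ⟨?_, ?_, ?_, ?_, ?_, ?_, ?_, ?_, ?_⟩ <;> decide +kernel

namespace IsSmall

variable {G : Subgroup (Perm (ZMod 13))}

theorem image_line (hG : IsSmall G) (h₀ : homology ∈ G) {g : Perm (ZMod 13)} (hg : g ∈ G)
    (i : ZMod 13) : ∃ j, (line i).image g = line j := by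
  have key {g : Perm (ZMod 13)} (hg : g ∈ G) : ∃ j, (line 0).image g = line j := by
    have aux {t : Perm (ZMod 13)} (ht : t ∈ G) (htt : t * t = 1) (ht1 : t ≠ 1) :=
      hG.fixes_line h₀ (G.mul_mem (G.mul_mem hg ht) (G.inv_mem hg))
        (by simp [mul_assoc, ← mul_assoc t t, htt]) (by simpa [mul_inv_eq_one] using ht1)
    obtain ⟨h1, j, hj⟩ := aux (hG.wordPerm_mem h₀ [10, 3, 0]) wordPerm_mul_self.1 wordPerm_ne_one.1
    obtain ⟨h2, k, hk⟩ := aux (hG.wordPerm_mem h₀ [2, 2, 5]) wordPerm_mul_self.2 wordPerm_ne_one.2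
    have hfix (t : Perm (ZMod 13)) : (Finset.univ.filter fun x => (g * t * g⁻¹) x = x) =
        (Finset.univ.filter fun x => t x = x).image g := by
      ext x
      simp only [Finset.mem_filter, Finset.mem_univ, true_and, Finset.mem_image]
      constructor
      · exact fun h => ⟨g⁻¹ x, by simpa [Equiv.eq_symm_apply] using h, by simp⟩
      · rintro ⟨a, ha, rfl⟩
        simp [ha]
    have hj' : line j ⊆ _ := fun x hx => Finset.mem_filter.2 ⟨Finset.mem_univ _, hj x hx⟩
    have hk' : line k ⊆ _ := fun x hx => Finset.mem_filter.2 ⟨Finset.mem_univ _, hk x hx⟩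
    rw [hfix] at h1 h2 hj' hk'
    have hinter := Finset.image_inter
      (Finset.univ.filter fun x => wordPerm homology [10, 3, 0] x = x)
      (Finset.univ.filter fun x => wordPerm homology [2, 2, 5] x = x) g.injective
    rw [fixed_inter_fixed] at hinter
    have h4 : ((line 0).image g).card = 4 := by
      rw [Finset.card_image_of_injective _ g.injective, card_line]
    have hunion := Finset.card_union_add_card_inter
      ((Finset.univ.filter fun x => wordPerm homology [10, 3, 0] x = x).image g)
      ((Finset.univ.filter fun x => wordPerm homology [2, 2, 5] x = x).image g)
    rw [← hinter, h4, h1, h2] at hunion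
    have hunion' := Finset.card_union_add_card_inter (line j) (line k)
    rw [card_line, card_line] at hunion'
    have hle := Finset.card_le_card (Finset.union_subset_union hj' hk')
    obtain rfl := line_injective j k (by omega)
    exact ⟨j, (Finset.eq_of_subset_of_card_le (hinter ▸ Finset.subset_inter hj' hk')
      (by rw [h4, card_line])).symm⟩
  obtain ⟨j, hj⟩ := key (G.mul_mem hg (hG.addRight_mem i))
  refine ⟨j, ?_⟩
  rw [← hj, ← zero_add i, ← image_add_line, Finset.image_image, zero_add]
  rfl

theorem collinear_map (hG : IsSmall G) (h₀ : homology ∈ G) {g : Perm (ZMod 13)} (hg : g ∈ G)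
    {x y z : ZMod 13} (h : Collinear x y z) : Collinear (g x) (g y) (g z) := by
  obtain ⟨i, hx, hy, hz⟩ := h
  obtain ⟨j, hj⟩ := hG.image_line h₀ hg i
  exact ⟨j, hj ▸ Finset.mem_image_of_mem g hx, hj ▸ Finset.mem_image_of_mem g hy,
    hj ▸ Finset.mem_image_of_mem g hz⟩

theorem collinear_map_iff (hG : IsSmall G) (h₀ : homology ∈ G) {g : Perm (ZMod 13)} (hg : g ∈ G)
    {x y z : ZMod 13} : Collinear (g x) (g y) (g z) ↔ Collinear x y z :=
  ⟨fun h => by simpa using hG.collinear_map h₀ (G.inv_mem hg) h, hG.collinear_map h₀ hg⟩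

theorem eq_one_of_fixes (hG : IsSmall G) (h₀ : homology ∈ G) {g : Perm (ZMod 13)} (hg : g ∈ G)
    (h0 : g 0 = 0) (h1 : g 1 = 1) (h2 : g 2 = 2) (h5 : g 5 = 5) : g = 1 := by
  have step {x a b c d : ZMod 13} (ha : g a = a) (hb : g b = b) (hc : g c = c) (hd : g d = d)
      (h : MeetsIn a b c d x) : g x = x :=
    h.2 _ ⟨by simpa only [ha, hb] using hG.collinear_map h₀ hg h.1.1,
      by simpa only [hc, hd] using hG.collinear_map h₀ hg h.1.2⟩
  obtain ⟨e3, e4, e6, e7, e8, e9, e10, e11, e12⟩ := meetsIn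
  have h3 := step h0 h1 h2 h5 e3
  have h4 := step h0 h5 h1 h2 e4
  have h6 := step h1 h5 h3 h4 e6
  have h7 := step h0 h5 h2 h6 e7
  have h8 := step h0 h2 h1 h5 e8
  have h9 := step h0 h1 h2 h6 e9
  have h10 := step h0 h6 h1 h2 e10
  have h11 := step h0 h6 h1 h7 e11
  have h12 := step h0 h2 h1 h7 e12
  refine Equiv.ext fun x => ?_
  rw [Perm.one_apply]
  have : x ∈ ([0, 1, 2, 3, 4, 5, 6, 7, 8, 9, 10, 11, 12] : List (ZMod 13)) := by
    revert x; decide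
  simp only [List.mem_cons, List.not_mem_nil, or_false] at this
  rcases this with rfl | rfl | rfl | rfl | rfl | rfl | rfl | rfl | rfl | rfl | rfl | rfl | rfl <;>
    assumption

theorem card_of_homology_mem (hG : IsSmall G) (h₀ : homology ∈ G) : Nat.card G = 5616 := by
  have hiff {g : Perm (ZMod 13)} (hg : g ∈ G) (x y z) : Collinear (g x) (g y) (g z) ↔ _ :=
    hG.collinear_map_iff h₀ hg
  have hw := hG.wordPerm_mem h₀
  have hfix (x) (g : Perm (ZMod 13)) : g ∈ stabilizer (Perm (ZMod 13)) x ↔ g x = x := Iff.rfl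
  have e0 := card_eq_card_mul_card_inf_stabilizer G 0 Finset.univ fun y =>
    iff_of_true (Finset.mem_univ y) ⟨_, hG.addRight_mem y, by simp⟩
  have e1 := card_eq_card_mul_card_inf_stabilizer (G ⊓ stabilizer (Perm (ZMod 13)) (0 : ZMod 13)) 1
    (Finset.univ.filter fun y => y ≠ 0) fun y => by
    simp only [Finset.mem_filter, Finset.mem_univ, true_and, Subgroup.mem_inf, hfix]
    constructor
    · intro hy
      obtain ⟨l, h0, h1⟩ := exists_wordPerm₁ y hy
      exact ⟨_, ⟨hw l, h0⟩, h1⟩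
    · rintro ⟨g, ⟨hg, h0⟩, rfl⟩ h
      exact absurd (g.injective (h.trans h0.symm)) (by decide)
  have e2 := card_eq_card_mul_card_inf_stabilizer (G ⊓ stabilizer (Perm (ZMod 13)) (0 : ZMod 13) ⊓
    stabilizer (Perm (ZMod 13)) (1 : ZMod 13)) 2
    (Finset.univ.filter fun y => ¬ Collinear 0 1 y) fun y => by
    simp only [Finset.mem_filter, Finset.mem_univ, true_and, Subgroup.mem_inf, hfix]
    constructor
    · intro hy
      obtain ⟨l, h0, h1, h2⟩ := exists_wordPerm₂ y hy
      exact ⟨_, ⟨⟨hw l, h0⟩, h1⟩, h2⟩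
    · rintro ⟨g, ⟨⟨hg, h0⟩, h1⟩, rfl⟩
      have h01 := hiff hg 0 1 2
      rw [h0, h1] at h01
      rw [h01]
      decide +kernel
  have e3 := card_eq_card_mul_card_inf_stabilizer (G ⊓ stabilizer (Perm (ZMod 13)) (0 : ZMod 13) ⊓
    stabilizer (Perm (ZMod 13)) (1 : ZMod 13) ⊓ stabilizer (Perm (ZMod 13)) (2 : ZMod 13)) 5
    (Finset.univ.filter fun y =>
      ¬ Collinear 0 1 y ∧ ¬ Collinear 0 2 y ∧ ¬ Collinear 1 2 y) fun y => by
    simp only [Finset.mem_filter, Finset.mem_univ, true_and, Subgroup.mem_inf, hfix]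
    constructor
    · intro hy
      obtain ⟨l, h0, h1, h2, h5⟩ := exists_wordPerm₃ y hy
      exact ⟨_, ⟨⟨⟨hw l, h0⟩, h1⟩, h2⟩, h5⟩
    · rintro ⟨g, ⟨⟨⟨hg, h0⟩, h1⟩, h2⟩, rfl⟩
      have h01 := hiff hg 0 1 5
      have h02 := hiff hg 0 2 5
      have h12 := hiff hg 1 2 5
      rw [h0, h1] at h01
      rw [h0, h2] at h02
      rw [h1, h2] at h12
      rw [h01, h02, h12]
      decide +kernel
  have e4 : G ⊓ stabilizer (Perm (ZMod 13)) (0 : ZMod 13) ⊓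
      stabilizer (Perm (ZMod 13)) (1 : ZMod 13) ⊓ stabilizer (Perm (ZMod 13)) (2 : ZMod 13) ⊓
      stabilizer (Perm (ZMod 13)) (5 : ZMod 13) = ⊥ := by
    rw [eq_bot_iff]
    rintro g ⟨⟨⟨⟨hg, h0⟩, h1⟩, h2⟩, h5⟩
    exact hG.eq_one_of_fixes h₀ hg h0 h1 h2 h5
  rw [e0, e1, e2, e3, e4, Subgroup.card_bot]
  decide +kernel

theorem card_eq (hG : IsSmall G) (h2 : 2 ∣ Nat.card G) :
    Nat.card G = 26 ∨ Nat.card G = 52 ∨ Nat.card G = 78 ∨ Nat.card G = 156 ∨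
      Nat.card G = 5616 := by
  by_cases h : ∀ t ∈ G, t * t = 1 → t ≠ 1 → ∃ d : ZMod 13, ∀ x, t x = d - x
  · have : Fact (Nat.Prime 2) := ⟨Nat.prime_two⟩
    obtain ⟨t, ht⟩ := exists_prime_orderOf_dvd_card' 2 h2
    have htt : (t : Perm (ZMod 13)) * t = 1 := by
      have := pow_orderOf_eq_one t
      rw [ht, pow_two] at this
      exact congr_arg Subtype.val this
    have ht1 : (t : Perm (ZMod 13)) ≠ 1 := fun e => by
      rw [show t = 1 from Subtype.ext e, orderOf_one] at ht
      omega
    have := hG.card_of_affine h2 fun g hg => hG.exists_affine t.2 htt ht1 h hg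
    tauto
  · push Not at h
    obtain ⟨t, ht, htt, ht1, hd⟩ := h
    obtain ⟨g, hg, hmem⟩ := hG.exists_homology_mem ht htt ht1 (by push Not; exact hd)
    rw [← card_conjBy g, hg.card_of_homology_mem hmem]
    simp

end IsSmall

theorem card_of_alternatingGroup_le {G : Subgroup (Perm (ZMod 13))}
    (h : alternatingGroup (ZMod 13) ≤ G) :
    Nat.card G = 3113510400 ∨ Nat.card G = 6227020800 := by
  have hidx : G.index ∣ 2 := by
    rw [← alternatingGroup.index_eq_two (α := ZMod 13)]
    exact Subgroup.index_dvd_of_le h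
  have hcard : Nat.card G * G.index = 6227020800 := by
    rw [Subgroup.card_mul_index, Nat.card_perm, Nat.card_zmod]
    norm_num [Nat.factorial]
  rcases (Nat.dvd_prime Nat.prime_two).1 hidx with h | h <;> rw [h] at hcard <;> omega

theorem orderOf_addRight_one : orderOf (Equiv.addRight (1 : ZMod 13)) = 13 :=
  orderOf_eq_prime (by rw [Equiv.nsmul_addRight]; decide +kernel) (by decide +kernel)

/-- The possible orders of a permutation group of degree 13 whose order is divisible by 26. -/
theorem card_eq_of_dvd {α : Type*} [Fintype α] (hα : Fintype.card α = 13)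
    (G : Subgroup (Perm α)) (h13 : 13 ∣ Nat.card G) (h2 : 2 ∣ Nat.card G) :
    Nat.card G = 26 ∨ Nat.card G = 52 ∨ Nat.card G = 78 ∨ Nat.card G = 156 ∨
      Nat.card G = 5616 ∨ Nat.card G = 3113510400 ∨ Nat.card G = 6227020800 := by
  have hZ : Fintype.card (ZMod 13) = 13 := ZMod.card 13
  have e : α ≃ ZMod 13 := Fintype.equivOfCardEq (hα.trans hZ.symm)
  have hcard : Nat.card (G.map e.permCongrHom.toMonoidHom) = Nat.card G :=
    (Nat.card_congr (G.equivMapOfInjective _ e.permCongrHom.injective).toEquiv).symm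
  rw [← hcard] at h13 h2 ⊢
  generalize G.map e.permCongrHom.toMonoidHom = H at *
  obtain ⟨s, hs⟩ := exists_prime_orderOf_dvd_card' 13 h13
  have hcycle {t : Perm (ZMod 13)} (ht : orderOf t = 13) : t.IsCycle :=
    isCycle_of_prime_order'' (by rw [hZ]; norm_num) (ht.trans hZ.symm)
  have hs' := hcycle (Subgroup.orderOf_coe s ▸ hs)
  have ha := hcycle orderOf_addRight_one
  obtain ⟨g, hg⟩ := isConj_iff.1 <| hs'.isConj ha <| by
    rw [← hs'.orderOf, ← ha.orderOf, orderOf_addRight_one, Subgroup.orderOf_coe, hs]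
  have hmem : Equiv.addRight 1 ∈ conjBy g H := hg ▸ conj_mem_conjBy s.2
  rw [← card_conjBy g H] at h2 ⊢
  by_cases h : alternatingGroup (ZMod 13) ≤ conjBy g H
  · have := card_of_alternatingGroup_le h
    tauto
  · have := IsSmall.card_eq ⟨hmem, h⟩ h2
    tauto

end PermThirteen

open Polynomial

namespace Polynomial.Gal

theorem card_rootSet_complex {p : ℚ[X]} (hp : Irreducible p) :
    Fintype.card (p.rootSet ℂ) = p.natDegree :=
  card_rootSet_eq_natDegree hp.separable (IsAlgClosed.splits _)

theorem two_dvd_card_of_nonreal_root_s13 {p : ℚ[X]} (hp : p ≠ 0) {z : ℂ} (hz : aeval z p = 0)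
    (him : z.im ≠ 0) : 2 ∣ Nat.card p.Gal := by
  have := splits_ℚ_ℂ (p := p)
  set c := restrict p ℂ (Complex.conjAe.restrictScalars ℚ) with hc
  have hcc : c ^ 2 = 1 := by
    rw [hc, ← map_pow, show Complex.conjAe.restrictScalars ℚ ^ 2 = 1 from
      AlgEquiv.ext Complex.conj_conj, map_one]
  have hc1 : c ≠ 1 := fun h => him <| Complex.conj_eq_iff_im.1 <| by
    have := galActionHom_restrict p ℂ (Complex.conjAe.restrictScalars ℚ)
      ⟨z, mem_rootSet.2 ⟨hp, hz⟩⟩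
    rw [← hc, h, map_one] at this
    exact this.symm
  rw [← orderOf_eq_prime hcc hc1]
  exact orderOf_dvd_natCard c

end Polynomial.Gal

/-- An irreducible polynomial over ℚ of degree 13 with a non-real complex root has Galois
group of one of the listed orders (corresponding to the finitely many possible groups). -/
theorem galois_group_card_of_degree_13_with_nonreal_root
    (f : ℚ[X]) (hdeg : f.natDegree = 13) (hirr : Irreducible f)
    (hroot : ∃ z : ℂ, aeval z f = 0 ∧ z.im ≠ 0) :
    Nat.card f.Gal = 26 ∨ Nat.card f.Gal = 52 ∨ Nat.card f.Gal = 78 ∨ Nat.card f.Gal = 156 ∨ Nat.card f.Gal = 5616 ∨ Nat.card f.Gal = 3113510400 ∨ Nat.card f.Gal = 6227020800 := by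
  obtain ⟨z, hz, him⟩ := hroot
  have := Gal.splits_ℚ_ℂ (p := f)
  have h13 := Gal.prime_degree_dvd_card hirr (by rw [hdeg]; norm_num)
  have h2 := Gal.two_dvd_card_of_nonreal_root_s13 hirr.ne_zero hz him
  rw [hdeg] at h13
  rw [Nat.card_congr (MonoidHom.ofInjective (Gal.galActionHom_injective f ℂ)).toEquiv] at h13 h2 ⊢
  exact PermThirteen.card_eq_of_dvd ((Gal.card_rootSet_complex hirr).trans hdeg) _ h13 h2
end
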